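/- Let G be a separated single-crossing topological multigraph on n ≥ 2 vertices. Then the number of edges of G satisfies |E(G)| ≤ 64·n²·log₂ n. -/

import Mathlib

open Set

/-- A topological multigraph: a finite vertex set `V ⊂ ℝ²` together with a finite family of
edges, each represented by a continuous injective arc `[0,1] → ℝ²` whose endpoints are two
distinct vertices and whose interior avoids all vertices. -/
structure TopMultigraph where
  V : Finset (ℝ × ℝ)
  ι : Type
  fintype_ι : Fintype ι
  arc : ι → unitInterval → ℝ × ℝ
  continuous_arc : ∀ e, Continuous (arc e)
  injective_arc : ∀ e, Function.Injective (arc e)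
  source_mem : ∀ e, arc e 0 ∈ V
  target_mem : ∀ e, arc e 1 ∈ V
  ends_ne : ∀ e, arc e 0 ≠ arc e 1
  interior_avoids : ∀ e (t : unitInterval), t ≠ 0 → t ≠ 1 → arc e t ∉ V

namespace TopMultigraph

variable (G : TopMultigraph)

instance : Fintype G.ι := G.fintype_ι

/-- The number of edges of `G`. -/
noncomputable def edgeCount : ℕ := Nat.card G.ι

/-- The interior of an edge: the image of the open interval `(0,1)`. -/
def arcInterior (e : G.ι) : Set (ℝ × ℝ) :=
  G.arc e '' {t : unitInterval | t ≠ 0 ∧ t ≠ 1}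

/-- The set of the two endpoints of an edge. -/
def endpoints (e : G.ι) : Set (ℝ × ℝ) := {G.arc e 0, G.arc e 1}

/-- Two distinct edges are parallel if they join the same pair of vertices. -/
def Parallel (e f : G.ι) : Prop := e ≠ f ∧ G.endpoints e = G.endpoints f

/-- Two edges are independent if they share no endpoint. -/
def Independent (e f : G.ι) : Prop := Disjoint (G.endpoints e) (G.endpoints f)

/-- Two edges cross if their open arcs share a common point. -/
def Cross (e f : G.ι) : Prop := (G.arcInterior e ∩ G.arcInterior f).Nonempty

/-- `G` is single-crossing if any two distinct edges share at most one common interior point. -/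
def SingleCrossing : Prop :=
  ∀ e f : G.ι, e ≠ f → (G.arcInterior e ∩ G.arcInterior f).Subsingleton

/-- An edge `e` joins `u` and `v` if its endpoint set is `{u, v}`. -/
def Joins (e : G.ι) (u v : ℝ × ℝ) : Prop := G.endpoints e = {u, v}

/-- The union of the images of all edges of `G` joining `u` and `v`. -/
def pairUnion (u v : ℝ × ℝ) : Set (ℝ × ℝ) :=
  ⋃ e ∈ {e : G.ι | G.Joins e u v}, Set.range (G.arc e)

/-- `ℓ` is a lens of `G` at the pair `{u, v}`: `u ≠ v` are joined by at least one edge, no two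
of the parallel edges joining them cross, and `ℓ` is a bounded connected component of the
complement of the union of the edges joining `u` and `v`. -/
def IsLensAt (u v : ℝ × ℝ) (ℓ : Set (ℝ × ℝ)) : Prop :=
  u ≠ v ∧ (∃ e, G.Joins e u v) ∧
  (∀ e f : G.ι, G.Joins e u v → G.Joins f u v → e ≠ f → ¬ G.Cross e f) ∧
  Bornology.IsBounded ℓ ∧
  ∃ x ∈ (G.pairUnion u v)ᶜ, ℓ = connectedComponentIn (G.pairUnion u v)ᶜ x

/-- `ℓ` is a lens of `G`. -/
def IsLens (ℓ : Set (ℝ × ℝ)) : Prop := ∃ u v, G.IsLensAt u v ℓ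

/-- `L(G)`: the set of all lenses of `G`. -/
def lenses : Set (Set (ℝ × ℝ)) := {ℓ | G.IsLens ℓ}

/-- No two parallel edges of `G` cross. -/
def ParallelNoncrossing : Prop := ∀ e f : G.ι, G.Parallel e f → ¬ G.Cross e f

/-- `G` is separated: no two parallel edges cross and every lens contains a vertex. -/
def Separated : Prop :=
  G.ParallelNoncrossing ∧ ∀ ℓ, G.IsLens ℓ → ∃ v ∈ G.V, v ∈ ℓ

/-- The crossing number of `G`: the number of unordered pairs of distinct edges that cross. -/
noncomputable def crossingNumber : ℕ :=
  Nat.card {p : Sym2 G.ι // ¬ p.IsDiag ∧ ∀ e ∈ p, ∀ f ∈ p, e ≠ f → G.Cross e f}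

/-- The degree of a vertex: the number of edges incident to it. -/
noncomputable def degree (v : ℝ × ℝ) : ℕ :=
  Nat.card {e : G.ι // v ∈ G.endpoints e}

end TopMultigraph

namespace LW

/-! ### Angular change along a path -/

theorem exists_log {X : Type} [TopologicalSpace X] [SimplyConnectedSpace X]
    [LocallyPathConnectedSpace X] (F : X → ℂ) (hF : Continuous F) (h0 : ∀ x, F x ≠ 0) :
    ∃ L : X → ℂ, Continuous L ∧ ∀ x, Complex.exp (L x) = F x := by
  have hne : Nonempty X := (inferInstance : PathConnectedSpace X).nonempty
  obtain ⟨x₀⟩ := hne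
  obtain ⟨L, ⟨-, hL⟩, -⟩ := Complex.isCoveringMapOn_exp.existsUnique_continuousMap_lifts
    (⟨F, hF⟩ : C(X, ℂ)) (a₀ := x₀) (e₀ := Complex.log (F x₀)) (Complex.exp_log (h0 x₀))
    (fun a => h0 a)
  exact ⟨L, L.continuous, fun x => congrFun hL x⟩

/-- `L` is a continuous logarithm of `γ - x` on `[a, b]`. -/
def IsLift (γ : ℝ → ℂ) (a b : ℝ) (x : ℂ) (L : ℝ → ℂ) : Prop :=
  ContinuousOn L (Icc a b) ∧ ∀ t ∈ Icc a b, Complex.exp (L t) = γ t - x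

open Classical in
/-- Angular change (in full turns) of `γ` around `x` over `[a, b]`. -/
noncomputable def theta (γ : ℝ → ℂ) (a b : ℝ) (x : ℂ) : ℝ :=
  if h : ∃ L, IsLift γ a b x L then (h.choose b - h.choose a).im / (2 * Real.pi) else 0

theorem exp_eq_im {z w : ℂ} (h : Complex.exp z = Complex.exp w) :
    ∃ n : ℤ, z.im - w.im = n * (2 * Real.pi) := by
  obtain ⟨n, hn⟩ := Complex.exp_eq_exp_iff_exists_int.1 h
  refine ⟨n, ?_⟩
  rw [hn]; simp

/-- A continuous function on an interval with values in `2πℤ` has equal endpoint values. -/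
theorem const_of_int {g : ℝ → ℝ} {a b : ℝ} (hab : a ≤ b) (hg : ContinuousOn g (Icc a b))
    (h : ∀ t ∈ Icc a b, ∃ n : ℤ, g t = n * (2 * Real.pi)) : g a = g b := by
  have hpi := Real.pi_pos
  have hc : ContinuousOn (fun t => g t / (2 * Real.pi)) (Icc a b) := hg.div_const _
  have hmaps : MapsTo (fun t => g t / (2 * Real.pi)) (Icc a b) (range ((↑) : ℤ → ℝ)) := by
    intro t ht
    obtain ⟨n, hn⟩ := h t ht
    refine ⟨n, ?_⟩
    simp only [hn]
    field_simp
  have hd : IsDiscrete (range ((↑) : ℤ → ℝ)) := by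
    rw [isDiscrete_iff_discreteTopology]
    exact Int.isClosedEmbedding_coe_real.isEmbedding.toHomeomorph.symm.isEmbedding.discreteTopology
  have := isPreconnected_Icc.constant_of_mapsTo hd hc hmaps (left_mem_Icc.2 hab)
    (right_mem_Icc.2 hab)
  field_simp at this
  exact this

theorem theta_eq {γ : ℝ → ℂ} {a b : ℝ} {x : ℂ} {L : ℝ → ℂ} (hab : a ≤ b)
    (h : IsLift γ a b x L) : theta γ a b x = (L b - L a).im / (2 * Real.pi) := by
  have hex : ∃ L, IsLift γ a b x L := ⟨L, h⟩
  rw [theta, dif_pos hex]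
  have h2 := hex.choose_spec
  set M := hex.choose
  have := const_of_int (g := fun t => (M t).im - (L t).im) hab
    ((Complex.continuous_im.comp_continuousOn h2.1).sub (Complex.continuous_im.comp_continuousOn h.1))
    (fun t ht => exp_eq_im (by rw [h2.2 t ht, h.2 t ht]))
  simp only [Complex.sub_im]
  congr 1
  linarith

theorem exists_lift {γ : ℝ → ℂ} {a b : ℝ} {x : ℂ} (hab : a ≤ b) (hγ : Continuous γ)
    (hx : x ∉ γ '' Icc a b) : ∃ L, IsLift γ a b x L := by
  obtain ⟨L, hL, hL2⟩ := exists_log (fun t : ℝ => γ (projIcc a b hab t) - x)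
    (by fun_prop)
    (fun t h => hx ⟨projIcc a b hab t, (projIcc a b hab t).2, sub_eq_zero.1 h⟩)
  refine ⟨L, hL.continuousOn, fun t ht => ?_⟩
  rw [hL2, projIcc_of_mem hab ht]

theorem theta_add {γ : ℝ → ℂ} {a b c : ℝ} {x : ℂ} (hab : a ≤ b) (hbc : b ≤ c) (hγ : Continuous γ)
    (hx : x ∉ γ '' Icc a c) : theta γ a c x = theta γ a b x + theta γ b c x := by
  obtain ⟨L, hL⟩ := exists_lift (hab.trans hbc) hγ hx
  have h1 : IsLift γ a b x L := ⟨hL.1.mono (Icc_subset_Icc le_rfl hbc),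
    fun t ht => hL.2 t (Icc_subset_Icc le_rfl hbc ht)⟩
  have h2 : IsLift γ b c x L := ⟨hL.1.mono (Icc_subset_Icc hab le_rfl),
    fun t ht => hL.2 t (Icc_subset_Icc hab le_rfl ht)⟩
  rw [theta_eq (hab.trans hbc) hL, theta_eq hab h1, theta_eq hbc h2]
  simp only [Complex.sub_im]; ring

theorem theta_congr {γ δ : ℝ → ℂ} {a b : ℝ} {x : ℂ} (h : EqOn γ δ (Icc a b)) :
    theta γ a b x = theta δ a b x := by
  have : IsLift γ a b x = IsLift δ a b x := by
    ext L
    refine and_congr Iff.rfl (forall_congr' fun t => ?_)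
    refine imp_congr_right fun ht => by rw [h ht]
  rw [theta, theta, this]

theorem theta_shift (γ : ℝ → ℂ) {a b : ℝ} (c : ℝ) {x : ℂ} (hab : a ≤ b) (hγ : Continuous γ)
    (hx : x ∉ γ '' Icc (a + c) (b + c)) :
    theta (fun t => γ (t + c)) a b x = theta γ (a + c) (b + c) x := by
  obtain ⟨L, hL⟩ := exists_lift (by linarith) hγ hx
  have h1 : IsLift (fun t => γ (t + c)) a b x (fun t => L (t + c)) := by
    have hm : MapsTo (fun t => t + c) (Icc a b) (Icc (a + c) (b + c)) := by
      intro t ht; simpa using ht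
    exact ⟨hL.1.comp (by fun_prop) hm, fun t ht => hL.2 _ (hm ht)⟩
  rw [theta_eq (by linarith) hL, theta_eq hab h1]

theorem theta_reverse (γ : ℝ → ℂ) {a b : ℝ} (c : ℝ) {x : ℂ} (hab : a ≤ b) (hγ : Continuous γ)
    (hx : x ∉ γ '' Icc (c - b) (c - a)) :
    theta (fun t => γ (c - t)) a b x = - theta γ (c - b) (c - a) x := by
  obtain ⟨L, hL⟩ := exists_lift (by linarith) hγ hx
  have h1 : IsLift (fun t => γ (c - t)) a b x (fun t => L (c - t)) := by
    have hm : MapsTo (fun t => c - t) (Icc a b) (Icc (c - b) (c - a)) := by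
      intro t ht; simp only [mem_Icc] at *; constructor <;> linarith
    exact ⟨hL.1.comp (by fun_prop) hm, fun t ht => hL.2 _ (hm ht)⟩
  rw [theta_eq (by linarith) hL, theta_eq hab h1]
  simp only [Complex.sub_im]; ring

/-- Disjoint paths have zero algebraic crossing number. -/
theorem cross_zero {α β : ℝ → ℂ} {a b c d : ℝ} (hab : a ≤ b) (hcd : c ≤ d) (hα : Continuous α)
    (hβ : Continuous β) (hd : ∀ s ∈ Icc a b, ∀ t ∈ Icc c d, α s ≠ β t) :
    theta α a b (β c) - theta α a b (β d) + theta β c d (α b) - theta β c d (α a) = 0 := by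
  obtain ⟨L, hL, hL2⟩ := exists_log
    (fun p : ℝ × ℝ => α (projIcc a b hab p.1) - β (projIcc c d hcd p.2))
    (by fun_prop)
    (fun t h => hd _ (projIcc a b hab t.1).2 _ (projIcc c d hcd t.2).2 (sub_eq_zero.1 h))
  have e : ∀ s ∈ Icc a b, ∀ t ∈ Icc c d, Complex.exp (L (s, t)) = α s - β t := by
    intro s hs t ht
    rw [hL2, projIcc_of_mem hab hs, projIcc_of_mem hcd ht]
  have l1 : ∀ t ∈ Icc c d, IsLift α a b (β t) (fun s => L (s, t)) := fun t ht =>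
    ⟨by fun_prop, fun s hs => e s hs t ht⟩
  have l2 : ∀ s ∈ Icc a b, IsLift β c d (α s) (fun t => L (s, t) + Real.pi * Complex.I) :=
    fun s hs => ⟨by fun_prop, fun t ht => by
      rw [Complex.exp_add, e s hs t ht, Complex.exp_pi_mul_I]; ring⟩
  rw [theta_eq hab (l1 c (left_mem_Icc.2 hcd)), theta_eq hab (l1 d (right_mem_Icc.2 hcd)),
    theta_eq hcd (l2 b (right_mem_Icc.2 hab)), theta_eq hcd (l2 a (left_mem_Icc.2 hab))]
  simp only [Complex.sub_im, Complex.add_im]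
  ring

theorem theta_slit {γ : ℝ → ℂ} {a b : ℝ} {x : ℂ} (c : ℂ) (hab : a ≤ b) (hγ : Continuous γ)
    (h : ∀ t ∈ Icc a b, c * (γ t - x) ∈ Complex.slitPlane) :
    theta γ a b x = (Complex.arg (c * (γ b - x)) - Complex.arg (c * (γ a - x))) / (2 * Real.pi) := by
  have hc : c ≠ 0 := by
    rintro rfl
    have := h a (left_mem_Icc.2 hab)
    simp at this
  have h1 : IsLift γ a b x (fun t => Complex.log (c * (γ t - x)) - Complex.log c) := by
    refine ⟨?_, fun t ht => ?_⟩
    · refine ContinuousOn.sub (ContinuousOn.clog (by fun_prop) h) continuousOn_const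
    · rw [Complex.exp_sub, Complex.exp_log (Complex.slitPlane_ne_zero (h t ht)), Complex.exp_log hc]
      field_simp
  rw [theta_eq hab h1]
  simp only [Complex.sub_im, Complex.log_im]
  ring

/-- The principal angle of `y` seen from `x`, in full turns. -/
noncomputable def ang (y x : ℂ) : ℝ := Complex.arg (y - x) / (2 * Real.pi)

theorem theta_int {γ : ℝ → ℂ} {a b : ℝ} {x : ℂ} (hab : a ≤ b) (hγ : Continuous γ)
    (hx : x ∉ γ '' Icc a b) : ∃ n : ℤ, theta γ a b x = ang (γ b) x - ang (γ a) x + n := by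
  obtain ⟨L, hL⟩ := exists_lift hab hγ hx
  have key : ∀ t ∈ Icc a b, ∃ n : ℤ, (L t).im = Complex.arg (γ t - x) + n * (2 * Real.pi) := by
    intro t ht
    have hne : γ t - x ≠ 0 := fun h => hx ⟨t, ht, sub_eq_zero.1 h⟩
    obtain ⟨n, hn⟩ := exp_eq_im (z := L t) (w := Complex.log (γ t - x))
      (by rw [hL.2 t ht, Complex.exp_log hne])
    refine ⟨n, ?_⟩
    rw [Complex.log_im] at hn; linarith
  obtain ⟨n, hn⟩ := key a (left_mem_Icc.2 hab)
  obtain ⟨m, hm⟩ := key b (right_mem_Icc.2 hab)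
  refine ⟨m - n, ?_⟩
  rw [theta_eq hab hL, ang, ang, Complex.sub_im, hn, hm]
  have := Real.pi_ne_zero
  push_cast
  field_simp
  ring

end LW

namespace LW

/-! ### Integer winding data -/

/-- The image of the unit interval. -/
def img (γ : ℝ → ℂ) : Set ℂ := γ '' Icc 0 1

theorem img_compact {γ : ℝ → ℂ} (h : Continuous γ) : IsCompact (img γ) :=
  isCompact_Icc.image h

theorem mem_img {γ : ℝ → ℂ} {t : ℝ} (ht : t ∈ Icc (0 : ℝ) 1) : γ t ∈ img γ := ⟨t, ht, rfl⟩

theorem z_mem : (0 : ℝ) ∈ Icc (0 : ℝ) 1 := by simp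
theorem o_mem : (1 : ℝ) ∈ Icc (0 : ℝ) 1 := by simp

/-- The integer part of the angular change. -/
noncomputable def kz (γ : ℝ → ℂ) (x : ℂ) : ℤ :=
  round (theta γ 0 1 x - (ang (γ 1) x - ang (γ 0) x))

theorem kz_spec {γ : ℝ → ℂ} {x : ℂ} (hγ : Continuous γ) (hx : x ∉ img γ) :
    theta γ 0 1 x = ang (γ 1) x - ang (γ 0) x + kz γ x := by
  obtain ⟨n, hn⟩ := theta_int zero_le_one hγ hx
  rw [kz, hn, add_sub_cancel_left, round_intCast]

/-- Winding number of the loop formed by two paths with the same ends. -/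
noncomputable def wd (e f : ℝ → ℂ) (x : ℂ) : ℤ := kz e x - kz f x

theorem wd_spec {e f : ℝ → ℂ} {x : ℂ} (he : Continuous e) (hf : Continuous f)
    (h0 : e 0 = f 0) (h1 : e 1 = f 1) (hxe : x ∉ img e) (hxf : x ∉ img f) :
    ((wd e f x : ℤ) : ℝ) = theta e 0 1 x - theta f 0 1 x := by
  rw [kz_spec he hxe, kz_spec hf hxf, h0, h1, wd]; push_cast; ring

/-- The winding number is constant along paths that avoid the loop. -/
theorem wd_path {e f β : ℝ → ℂ} {c d : ℝ} (hcd : c ≤ d) (he : Continuous e) (hf : Continuous f)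
    (hβ : Continuous β) (h0 : e 0 = f 0) (h1 : e 1 = f 1)
    (hde : ∀ t ∈ Icc c d, β t ∉ img e) (hdf : ∀ t ∈ Icc c d, β t ∉ img f) :
    wd e f (β c) = wd e f (β d) := by
  have hc := left_mem_Icc.2 hcd
  have hd := right_mem_Icc.2 hcd
  have a1 := cross_zero zero_le_one hcd he hβ
    (fun s hs t ht h => hde t ht (h ▸ mem_img hs))
  have a2 := cross_zero zero_le_one hcd hf hβ
    (fun s hs t ht h => hdf t ht (h ▸ mem_img hs))
  have b1 := wd_spec he hf h0 h1 (hde c hc) (hdf c hc)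
  have b2 := wd_spec he hf h0 h1 (hde d hd) (hdf d hd)
  rw [h0, h1] at a1
  have : ((wd e f (β c) : ℤ) : ℝ) = wd e f (β d) := by rw [b1, b2]; linarith
  exact_mod_cast this

theorem wd_near {e f : ℝ → ℂ} {x : ℂ} (he : Continuous e) (hf : Continuous f)
    (h0 : e 0 = f 0) (h1 : e 1 = f 1) (hxe : x ∉ img e) (hxf : x ∉ img f) :
    ∀ᶠ y in nhds x, wd e f y = wd e f x := by
  have hop : IsOpen ((img e ∪ img f)ᶜ) :=
    ((img_compact he).union (img_compact hf)).isClosed.isOpen_compl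
  obtain ⟨ε, hε, hb⟩ := Metric.isOpen_iff.1 hop x (by simp [hxe, hxf])
  filter_upwards [Metric.ball_mem_nhds x hε] with y hy
  have hseg : ∀ t ∈ Icc (0 : ℝ) 1, AffineMap.lineMap (k := ℝ) x y t ∈ (img e ∪ img f)ᶜ := by
    intro t ht
    apply hb
    exact (convex_ball x ε).lineMap_mem (Metric.mem_ball_self hε) hy ht
  have := wd_path (e := e) (f := f) (β := fun t => AffineMap.lineMap (k := ℝ) x y t) zero_le_one
    he hf (AffineMap.lineMap_continuous) h0 h1
    (fun t ht h => hseg t ht (Or.inl h)) (fun t ht h => hseg t ht (Or.inr h))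
  simpa using this.symm

theorem wd_preconn {e f : ℝ → ℂ} {s : Set ℂ} (he : Continuous e) (hf : Continuous f)
    (h0 : e 0 = f 0) (h1 : e 1 = f 1) (hs : IsPreconnected s) (hse : ∀ x ∈ s, x ∉ img e)
    (hsf : ∀ x ∈ s, x ∉ img f) {x y : ℂ} (hx : x ∈ s) (hy : y ∈ s) : wd e f x = wd e f y := by
  refine hs.constant (f := wd e f) ?_ hx hy
  intro z hz
  refine ContinuousAt.continuousWithinAt ?_
  have := wd_near he hf h0 h1 (hse z hz) (hsf z hz)
  exact (continuousAt_const (y := wd e f z)).congr (this.mono fun y hy => hy.symm)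

theorem wd_far {e f : ℝ → ℂ} {x : ℂ} {R : ℝ} (he : Continuous e) (hf : Continuous f)
    (h0 : e 0 = f 0) (h1 : e 1 = f 1) (hRe : ∀ z ∈ img e, ‖z‖ < R) (hRf : ∀ z ∈ img f, ‖z‖ < R)
    (hx : R ≤ ‖x‖) : wd e f x = 0 := by
  have hxe : x ∉ img e := fun h => absurd (hRe x h) (by linarith)
  have hxf : x ∉ img f := fun h => absurd (hRf x h) (by linarith)
  have hRpos : 0 < R := lt_of_le_of_lt (norm_nonneg _) (hRe _ (mem_img z_mem))
  have hx0 : x ≠ 0 := by rintro rfl; simp at hx; linarith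
  have key : ∀ z : ℂ, ‖z‖ < R → (-x⁻¹) * (z - x) ∈ Complex.slitPlane := by
    intro z hz
    left
    have e1 : (-x⁻¹) * (z - x) = 1 - z / x := by field_simp; ring
    rw [e1, Complex.sub_re, Complex.one_re]
    have : (z / x).re < 1 := by
      refine lt_of_le_of_lt (Complex.re_le_norm _) ?_
      rw [norm_div, div_lt_one (by positivity)]
      linarith
    linarith
  have t1 := theta_slit (γ := e) (x := x) (-x⁻¹) zero_le_one he
    (fun t ht => key _ (hRe _ (mem_img ht)))
  have t2 := theta_slit (γ := f) (x := x) (-x⁻¹) zero_le_one hf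
    (fun t ht => key _ (hRf _ (mem_img ht)))
  have := wd_spec he hf h0 h1 hxe hxf
  rw [t1, t2, h0, h1, sub_self] at this
  exact_mod_cast this

/-! ### Order on points and crossing numbers -/

open Classical in
/-- A `0/1`-valued tournament on the plane. -/
noncomputable def ord (x y : ℂ) : ℤ := if 0 < Complex.arg (x - y) then 0 else 1

theorem ang_ord {x y : ℂ} (h : x ≠ y) : ang x y - ang y x = 1 / 2 - ord x y ∧
    ord x y + ord y x = 1 := by
  have hz : x - y ≠ 0 := sub_ne_zero.2 h
  have hneg : y - x = -(x - y) := by ring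
  have hpi := Real.pi_pos
  have hpi' := Real.pi_ne_zero
  set z := x - y with hzdef
  rw [ang, ang, ord, ord, hneg, ← hzdef]
  by_cases hpos : 0 < z.arg
  · have h2 : (-z).arg = z.arg - Real.pi := by
      rw [Complex.arg_neg_eq_arg_sub_pi_iff]
      rcases lt_trichotomy z.im 0 with hi | hi | hi
      · exact absurd (Complex.arg_neg_iff.2 hi) (by linarith)
      · right
        refine ⟨hi, ?_⟩
        by_contra hre
        have : z.arg = 0 := Complex.arg_eq_zero_iff.2 ⟨not_lt.1 hre, hi⟩
        linarith
      · left; exact hi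
    have h3 : ¬ 0 < (-z).arg := by rw [h2]; linarith [Complex.arg_le_pi z]
    rw [if_pos hpos, if_neg h3, h2]
    constructor
    · push_cast; field_simp; ring
    · norm_num
  · have h2 : (-z).arg = z.arg + Real.pi := by
      rw [Complex.arg_neg_eq_arg_add_pi_iff]
      rcases lt_trichotomy z.im 0 with hi | hi | hi
      · left; exact hi
      · right
        refine ⟨hi, ?_⟩
        by_contra hre
        have hre' : z.re < 0 := by
          rcases lt_or_eq_of_le (not_lt.1 hre) with h | h
          · exact h
          · exact absurd (Complex.ext h hi) hz
        have : z.arg = Real.pi := Complex.arg_eq_pi_iff.2 ⟨hre', hi⟩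
        linarith
      · exfalso
        rcases lt_or_eq_of_le (Complex.arg_nonneg_iff.2 hi.le) with h | h
        · exact hpos h
        · have := Complex.arg_eq_zero_iff.1 h.symm
          linarith [this.2]
    have h3 : 0 < (-z).arg := by rw [h2]; linarith [Complex.neg_pi_lt_arg z]
    rw [if_neg hpos, if_pos h3, h2]
    constructor
    · push_cast; field_simp; ring
    · norm_num

/-- Algebraic crossing number. -/
noncomputable def crZ (e f : ℝ → ℂ) : ℤ :=
  kz e (f 0) - kz e (f 1) + kz f (e 1) - kz f (e 0) -
    (ord (e 1) (f 0) - ord (e 0) (f 0) - ord (e 1) (f 1) + ord (e 0) (f 1))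

/-- Real-valued crossing number over parameter intervals. -/
noncomputable def cr (α : ℝ → ℂ) (a b : ℝ) (β : ℝ → ℂ) (c d : ℝ) : ℝ :=
  theta α a b (β c) - theta α a b (β d) + theta β c d (α b) - theta β c d (α a)

theorem crZ_spec {e f : ℝ → ℂ} (he : Continuous e) (hf : Continuous f) (h1 : f 0 ∉ img e)
    (h2 : f 1 ∉ img e) (h3 : e 0 ∉ img f) (h4 : e 1 ∉ img f) :
    (crZ e f : ℝ) = cr e 0 1 f 0 1 := by
  have n00 : e 0 ≠ f 0 := fun h => h1 (h ▸ mem_img z_mem)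
  have n01 : e 0 ≠ f 1 := fun h => h2 (h ▸ mem_img z_mem)
  have n10 : e 1 ≠ f 0 := fun h => h1 (h ▸ mem_img o_mem)
  have n11 : e 1 ≠ f 1 := fun h => h2 (h ▸ mem_img o_mem)
  rw [cr, kz_spec he h1, kz_spec he h2, kz_spec hf h3, kz_spec hf h4, crZ]
  have := (ang_ord n00).1
  have := (ang_ord n01).1
  have := (ang_ord n10).1
  have := (ang_ord n11).1
  push_cast
  linarith

theorem crZ_swap {e f : ℝ → ℂ} (he : Continuous e) (hf : Continuous f) (h1 : f 0 ∉ img e)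
    (h2 : f 1 ∉ img e) (h3 : e 0 ∉ img f) (h4 : e 1 ∉ img f) : crZ f e = - crZ e f := by
  have a := crZ_spec he hf h1 h2 h3 h4
  have b := crZ_spec hf he h3 h4 h1 h2
  have : (crZ f e : ℝ) = - crZ e f := by rw [a, b, cr, cr]; ring
  exact_mod_cast this

theorem crZ_diff {e e' f : ℝ → ℂ} (h0 : e 0 = e' 0) (h1 : e 1 = e' 1) :
    crZ e f - crZ e' f = wd e e' (f 0) - wd e e' (f 1) := by
  simp only [crZ, wd, h0, h1]; ring

/-! ### Frontier lemmas -/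

theorem frontier_inter {U t : Set ℂ} (hU : Bornology.IsBounded U) (ht : IsPreconnected t)
    (htU : ¬ Bornology.IsBounded t) (h : (t ∩ U).Nonempty) : (t ∩ frontier U).Nonempty := by
  by_contra hcon
  rw [not_nonempty_iff_eq_empty] at hcon
  have hno : ∀ x ∈ t, x ∈ closure U → x ∈ interior U := by
    intro x hx hc
    by_contra hi
    have : x ∈ t ∩ frontier U := ⟨hx, hc, hi⟩
    rw [hcon] at this
    exact this
  have hex : (t ∩ (closure U)ᶜ).Nonempty := by
    by_contra hne
    rw [not_nonempty_iff_eq_empty] at hne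
    apply htU
    refine hU.subset fun x hx => ?_
    apply interior_subset
    apply hno x hx
    by_contra hc
    have : x ∈ t ∩ (closure U)ᶜ := ⟨hx, hc⟩
    rw [hne] at this
    exact this
  obtain ⟨y, hyt, hyU⟩ := h
  obtain ⟨z, -, hz1, hz2⟩ := ht (interior U) (closure U)ᶜ isOpen_interior isClosed_closure.isOpen_compl
    (fun x hx => by
      by_cases hc : x ∈ closure U
      · exact Or.inl (hno x hx hc)
      · exact Or.inr hc) ⟨y, hyt, hno y hyt (subset_closure hyU)⟩ hex
  exact hz2 (subset_closure (interior_subset hz1))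

theorem eq_empty_of_finite_frontier {U : Set ℂ} (hU : Bornology.IsBounded U) (ho : IsOpen U)
    (hf : (frontier U).Finite) : U = ∅ := by
  by_contra hne
  obtain ⟨x, hx⟩ := nonempty_iff_ne_empty.2 hne
  have hc := (hf.countable.isConnected_compl_of_one_lt_rank (E := ℂ) (by simp)).isPreconnected
  have hxf : x ∉ frontier U := fun h => by
    rw [ho.frontier_eq] at h; exact h.2 hx
  have hunb : ¬ Bornology.IsBounded (frontier U)ᶜ := by
    intro hb
    have : Bornology.IsBounded (univ : Set ℂ) := by
      rw [← compl_union_self (frontier U)]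
      exact hb.union hf.isBounded
    exact NormedSpace.unbounded_univ ℝ ℂ this
  obtain ⟨y, hy1, hy2⟩ := frontier_inter hU hc hunb ⟨x, hxf, hx⟩
  exact hy1 hy2

/-! ### Two lenses around the same point -/

theorem even_on_aux {e f f' : ℝ → ℂ} (he : Continuous e) (hf : Continuous f)
    (hf' : Continuous f') (h0 : f 0 = f' 0) (h1 : f 1 = f' 1)
    (hf0 : f 0 ∉ img e) (hf1 : f 1 ∉ img e)
    (he0 : e 0 ∉ img f) (he0' : e 0 ∉ img f') (he1 : e 1 ∉ img f)
    (hE0 : Even (wd f f' (e 0))) (hcr : Even (crZ e f)) {s : ℝ} (hs : s ∈ Icc (0 : ℝ) 1)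
    (hsf : e s ∉ img f) (hsf' : e s ∉ img f')
    (hd : ∀ t ∈ Icc s 1, e t ∉ img f) (hd' : ∀ t ∈ Icc 0 s, e t ∉ img f') :
    Even (wd f f' (e s)) := by
  have sub0 : Icc 0 s ⊆ Icc (0 : ℝ) 1 := Icc_subset_Icc le_rfl hs.2
  have c1 := cross_zero hs.2 zero_le_one he hf (fun a ha t ht h => hd a ha (h ▸ mem_img ht))
  have c2 := cross_zero hs.1 zero_le_one he hf' (fun a ha t ht h => hd' a ha (h ▸ mem_img ht))
  have c3 := crZ_spec he hf hf0 hf1 he0 he1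
  rw [cr] at c3
  have a1 := theta_add (x := f 0) hs.1 hs.2 he hf0
  have a2 := theta_add (x := f 1) hs.1 hs.2 he hf1
  have w0 := wd_spec hf hf' h0 h1 he0 he0'
  have w1 := wd_spec hf hf' h0 h1 hsf hsf'
  rw [← h0, ← h1] at c2
  have : ((wd f f' (e s) : ℤ) : ℝ) = ((wd f f' (e 0) + crZ e f : ℤ) : ℝ) := by
    push_cast; rw [w0, w1, c3]; linarith
  have h := Int.cast_injective this
  rw [h]
  exact hE0.add hcr

theorem wd_comm (e f : ℝ → ℂ) (x : ℂ) : wd f e x = - wd e f x := by simp [wd]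

theorem even_on {e f f' : ℝ → ℂ} (he : Continuous e) (hf : Continuous f)
    (hf' : Continuous f') (h0 : f 0 = f' 0) (h1 : f 1 = f' 1) (hinj : InjOn e (Icc 0 1))
    (hf0 : f 0 ∉ img e) (hf1 : f 1 ∉ img e)
    (he0 : e 0 ∉ img f) (he0' : e 0 ∉ img f') (he1 : e 1 ∉ img f) (he1' : e 1 ∉ img f')
    (hE0 : Even (wd f f' (e 0))) (hE1 : Even (wd f f' (e 1)))
    (hcr : Even (crZ e f)) (hcr' : Even (crZ e f'))
    (hss : (img e ∩ img f).Subsingleton) (hss' : (img e ∩ img f').Subsingleton)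
    {s : ℝ} (hs : s ∈ Icc (0 : ℝ) 1)
    (hsf : e s ∉ img f) (hsf' : e s ∉ img f') : Even (wd f f' (e s)) := by
  have sub0 : Icc 0 s ⊆ Icc (0 : ℝ) 1 := Icc_subset_Icc le_rfl hs.2
  have sub1 : Icc s 1 ⊆ Icc (0 : ℝ) 1 := Icc_subset_Icc hs.1 le_rfl
  -- a hit on one side of `s` excludes one on the other side
  have excl : ∀ g : ℝ → ℂ, (img e ∩ img g).Subsingleton → e s ∉ img g →
      ∀ a ∈ Icc 0 s, e a ∈ img g → ∀ b ∈ Icc s 1, e b ∉ img g := by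
    intro g hg hsg a ha hag b hb hbg
    have := hg ⟨mem_img (sub0 ha), hag⟩ ⟨mem_img (sub1 hb), hbg⟩
    have hab := hinj (sub0 ha) (sub1 hb) this
    have : a = s := le_antisymm ha.2 (hab ▸ hb.1)
    exact hsg (this ▸ hag)
  by_cases A : ∃ a ∈ Icc 0 s, e a ∈ img f
  · obtain ⟨a, ha, haf⟩ := A
    have B := excl f hss hsf a ha haf
    by_cases C : ∃ a ∈ Icc 0 s, e a ∈ img f'
    · obtain ⟨a', ha', haf'⟩ := C
      have B' := excl f' hss' hsf' a' ha' haf'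
      rw [wd_path hs.2 hf hf' he h0 h1 B B']
      exact hE1
    · push Not at C
      exact even_on_aux he hf hf' h0 h1 hf0 hf1 he0 he0' he1 hE0 hcr hs hsf hsf' B C
  · push Not at A
    by_cases C : ∃ a ∈ Icc 0 s, e a ∈ img f'
    · obtain ⟨a', ha', haf'⟩ := C
      have B' := excl f' hss' hsf' a' ha' haf'
      have := even_on_aux he hf' hf h0.symm h1.symm (h0 ▸ hf0) (h1 ▸ hf1) he0' he0 he1'
        (by rw [wd_comm]; exact hE0.neg) hcr' hs hsf' hsf B' A
      rw [wd_comm]; exact this.neg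
    · push Not at C
      rw [← wd_path hs.1 hf hf' he h0 h1 A C]
      exact hE0

theorem odd_crossing {e e' f f' : ℝ → ℂ} {w : ℂ} (he : Continuous e) (he' : Continuous e')
    (hf : Continuous f) (hf' : Continuous f')
    (hie : InjOn e (Icc 0 1)) (hie' : InjOn e' (Icc 0 1))
    (hif : InjOn f (Icc 0 1)) (hif' : InjOn f' (Icc 0 1))
    (e0 : e 0 = e' 0) (e1 : e 1 = e' 1) (f0 : f 0 = f' 0) (f1 : f 1 = f' 1)
    (a1 : f 0 ∉ img e) (a2 : f 1 ∉ img e) (a3 : f 0 ∉ img e') (a4 : f 1 ∉ img e')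
    (b1 : e 0 ∉ img f) (b2 : e 1 ∉ img f) (b3 : e 0 ∉ img f') (b4 : e 1 ∉ img f')
    (s1 : (img e ∩ img f).Subsingleton) (s2 : (img e ∩ img f').Subsingleton)
    (s3 : (img e' ∩ img f).Subsingleton) (s4 : (img e' ∩ img f').Subsingleton)
    (p1 : Even (wd e e' (f 0))) (p2 : Even (wd e e' (f 1)))
    (q1 : Even (wd f f' (e 0))) (q2 : Even (wd f f' (e 1)))
    (w1 : w ∉ img e) (w2 : w ∉ img e') (w3 : w ∉ img f) (w4 : w ∉ img f')
    (o1 : Odd (wd e e' w)) (o2 : Odd (wd f f' w)) : Odd (crZ e f) := by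
  by_contra hcon
  have c1 : Even (crZ e f) := Int.not_odd_iff_even.1 hcon
  have c2 : Even (crZ e' f) := by
    have := crZ_diff (f := f) e0 e1
    have h : crZ e' f = crZ e f - (wd e e' (f 0) - wd e e' (f 1)) := by omega
    rw [h]; exact c1.sub (p1.sub p2)
  have sw1 := crZ_swap he hf a1 a2 b1 b2
  have sw2 := crZ_swap he' hf a3 a4 (e0 ▸ b1) (e1 ▸ b2)
  have d1 : Even (crZ f e) := by rw [sw1]; exact c1.neg
  have d2 : Even (crZ f e') := by rw [sw2]; exact c2.neg
  have d3 : Even (crZ f' e) := by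
    have := crZ_diff (f := e) f0 f1
    have h : crZ f' e = crZ f e - (wd f f' (e 0) - wd f f' (e 1)) := by omega
    rw [h]; exact d1.sub (q1.sub q2)
  have d4 : Even (crZ f' e') := by
    have := crZ_diff (f := e') f0 f1
    have h : crZ f' e' = crZ f e' - (wd f f' (e' 0) - wd f f' (e' 1)) := by omega
    rw [h, ← e0, ← e1]; exact d2.sub (q1.sub q2)
  have c3 : Even (crZ e f') := by
    rw [crZ_swap hf' he b3 b4 (f0 ▸ a1) (f1 ▸ a2)]; exact d3.neg
  have c4 : Even (crZ e' f') := by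
    rw [crZ_swap hf' he' (e0 ▸ b3) (e1 ▸ b4) (f0 ▸ a3) (f1 ▸ a4)]; exact d4.neg
  -- parity on the edges
  have E1 : ∀ x ∈ img e, x ∉ img f → x ∉ img f' → Even (wd f f' x) := by
    rintro _ ⟨s, hs, rfl⟩ h h'
    exact even_on he hf hf' f0 f1 hie a1 a2 b1 b3 b2 b4 q1 q2 c1 c3 s1 s2 hs h h'
  have E2 : ∀ x ∈ img e', x ∉ img f → x ∉ img f' → Even (wd f f' x) := by
    rintro _ ⟨s, hs, rfl⟩ h h'
    exact even_on he' hf hf' f0 f1 hie' a3 a4 (e0 ▸ b1) (e0 ▸ b3) (e1 ▸ b2) (e1 ▸ b4)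
      (e0 ▸ q1) (e1 ▸ q2) c2 c4 s3 s4 hs h h'
  have E3 : ∀ x ∈ img f, x ∉ img e → x ∉ img e' → Even (wd e e' x) := by
    rintro _ ⟨s, hs, rfl⟩ h h'
    exact even_on hf he he' e0 e1 hif b1 b2 a1 a3 a2 a4 p1 p2 d1 d2
      (by rwa [inter_comm]) (by rwa [inter_comm]) hs h h'
  have E4 : ∀ x ∈ img f', x ∉ img e → x ∉ img e' → Even (wd e e' x) := by
    rintro _ ⟨s, hs, rfl⟩ h h'
    exact even_on hf' he he' e0 e1 hif' b3 b4 (f0 ▸ a1) (f0 ▸ a3) (f1 ▸ a2) (f1 ▸ a4)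
      (f0 ▸ p1) (f1 ▸ p2) d3 d4
      (by rwa [inter_comm]) (by rwa [inter_comm]) hs h h'
  set A : Set ℂ := {x | (x ∉ img e ∧ x ∉ img e' ∧ x ∉ img f ∧ x ∉ img f') ∧
    Odd (wd e e' x) ∧ Odd (wd f f' x)} with hA
  have nrm : ∀ g : ℝ → ℂ, Continuous g → ∀ x, x ∉ img g → ∀ᶠ y in nhds x, y ∉ img g :=
    fun g hg x hx => (img_compact hg).isClosed.isOpen_compl.mem_nhds hx
  have hopen : IsOpen A := by
    rw [isOpen_iff_mem_nhds]
    rintro x ⟨⟨x1, x2, x3, x4⟩, y1, y2⟩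
    filter_upwards [nrm e he x x1, nrm e' he' x x2, nrm f hf x x3, nrm f' hf' x x4,
      wd_near he he' e0 e1 x1 x2, wd_near hf hf' f0 f1 x3 x4] with y z1 z2 z3 z4 z5 z6
    exact ⟨⟨z1, z2, z3, z4⟩, by rwa [z5], by rwa [z6]⟩
  have hbdd : Bornology.IsBounded A := by
    obtain ⟨R, hR⟩ := ((img_compact he).union (img_compact he')).isBounded.subset_ball 0
    refine (Metric.isBounded_ball (x := (0 : ℂ)) (r := R)).subset ?_
    rintro x ⟨-, y1, -⟩
    by_contra hx
    have hx' : R ≤ ‖x‖ := by simpa using hx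
    have := wd_far he he' e0 e1 (fun z hz => by simpa using hR (Or.inl hz))
      (fun z hz => by simpa using hR (Or.inr hz)) hx'
    rw [this] at y1
    exact absurd y1 (by decide)
  have hfr : frontier A ⊆ (img e ∩ img f ∪ img e ∩ img f') ∪ (img e' ∩ img f ∪ img e' ∩ img f') := by
    intro x hx
    rw [hopen.frontier_eq] at hx
    obtain ⟨hcl, hnA⟩ := hx
    have hfreq := mem_closure_iff_frequently.1 hcl
    by_contra hno
    simp only [mem_union, mem_inter_iff, not_or, not_and] at hno
    obtain ⟨⟨n1, n2⟩, n3, n4⟩ := hno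
    have T1 : x ∉ img f → x ∉ img f' → Odd (wd f f' x) := by
      intro h h'
      obtain ⟨y, hy, hy'⟩ := (hfreq.and_eventually (wd_near hf hf' f0 f1 h h')).exists
      rw [← hy']; exact hy.2.2
    have T2 : x ∉ img e → x ∉ img e' → Odd (wd e e' x) := by
      intro h h'
      obtain ⟨y, hy, hy'⟩ := (hfreq.and_eventually (wd_near he he' e0 e1 h h')).exists
      rw [← hy']; exact hy.2.1
    have neo : ∀ n : ℤ, Even n → Odd n → False := fun n h h' => Int.not_even_iff_odd.2 h' h
    by_cases i1 : x ∈ img e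
    · exact neo _ (E1 x i1 (n1 i1) (n2 i1)) (T1 (n1 i1) (n2 i1))
    by_cases i2 : x ∈ img e'
    · exact neo _ (E2 x i2 (n3 i2) (n4 i2)) (T1 (n3 i2) (n4 i2))
    by_cases i3 : x ∈ img f
    · exact neo _ (E3 x i3 i1 i2) (T2 i1 i2)
    by_cases i4 : x ∈ img f'
    · exact neo _ (E4 x i4 i1 i2) (T2 i1 i2)
    exact hnA ⟨⟨i1, i2, i3, i4⟩, T2 i1 i2, T1 i3 i4⟩
  have hfin := ((s1.finite.union s2.finite).union (s3.finite.union s4.finite)).subset hfr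
  have := eq_empty_of_finite_frontier hbdd hopen hfin
  have hw : w ∈ A := ⟨⟨w1, w2, w3, w4⟩, o1, o2⟩
  rw [this] at hw
  exact hw

end LW

namespace LW

/-! ### A point of odd winding inside a simple closed curve -/

theorem joined_vert {S : Set ℂ} {x y₁ y₂ : ℝ} (h : ∀ y ∈ uIcc y₁ y₂, (⟨x, y⟩ : ℂ) ∈ S) :
    JoinedIn S ⟨x, y₁⟩ ⟨x, y₂⟩ := by
  have hc : ContinuousOn (fun y : ℝ => (⟨x, y⟩ : ℂ)) (uIcc y₁ y₂) := by
    have : (fun y : ℝ => (⟨x, y⟩ : ℂ)) = fun y : ℝ => (x : ℂ) + y * Complex.I := by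
      ext y; exact Complex.mk_eq_add_mul_I x y
    rw [this]; fun_prop
  have hp : IsPathConnected (uIcc y₁ y₂) := (convex_uIcc y₁ y₂).isPathConnected nonempty_uIcc
  have := (hp.image' hc).joinedIn _ ⟨y₁, left_mem_uIcc, rfl⟩ _ ⟨y₂, right_mem_uIcc, rfl⟩
  refine this.mono ?_
  rintro _ ⟨y, hy, rfl⟩
  exact h y hy

theorem joined_arc {S : Set ℂ} {α : ℝ → ℂ} (hα : Continuous α) {s t : ℝ}
    (h : ∀ y ∈ uIcc s t, α y ∈ S) : JoinedIn S (α s) (α t) := by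
  have hp : IsPathConnected (uIcc s t) := (convex_uIcc s t).isPathConnected nonempty_uIcc
  have := (hp.image hα).joinedIn _ ⟨s, left_mem_uIcc, rfl⟩ _ ⟨t, right_mem_uIcc, rfl⟩
  refine this.mono ?_
  rintro _ ⟨y, hy, rfl⟩
  exact h y hy

theorem joined_fun {S : Set ℂ} {p q : ℂ} (h : JoinedIn S p q) :
    ∃ γ : ℝ → ℂ, Continuous γ ∧ γ 0 = p ∧ γ 1 = q ∧ ∀ t, γ t ∈ S := by
  obtain ⟨γ, hγ⟩ := h
  refine ⟨γ.extend, γ.continuous_extend, by simp, by simp, fun t => ?_⟩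
  have : γ.extend t ∈ range γ := by rw [← γ.extend_range]; exact ⟨t, rfl⟩
  obtain ⟨s, hs⟩ := this
  rw [← hs]; exact hγ s

theorem arg_pos_half {z : ℂ} (h1 : 0 ≤ z.re) (h2 : 0 < z.im) :
    0 < Complex.arg z ∧ Complex.arg z ≤ Real.pi / 2 := by
  constructor
  · have := Complex.arg_nonneg_iff.2 h2.le
    refine lt_of_le_of_ne this fun h => ?_
    have := (Complex.arg_eq_zero_iff.1 h.symm).2
    linarith
  · exact Complex.arg_le_pi_div_two_iff.2 (Or.inl h1)

theorem arg_neg_half {z : ℂ} (h1 : 0 ≤ z.re) (h2 : z.im < 0) :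
    Complex.arg z < 0 ∧ -(Real.pi / 2) ≤ Complex.arg z :=
  ⟨Complex.arg_neg_iff.2 h2, Complex.neg_pi_div_two_le_arg_iff.2 (Or.inl h1)⟩

/-- The part of a vertical strip that avoids an arc. -/
def strip (a b : ℂ) (S : Set ℂ) : Set ℂ := {z | a.re ≤ z.re ∧ z.re ≤ b.re ∧ z ∉ S}

theorem slit_of {z : ℂ} (h : 0 ≤ z.re) (h0 : z ≠ 0) : z ∈ Complex.slitPlane := by
  rw [Complex.mem_slitPlane_iff]
  rcases h.lt_or_eq with h1 | h1
  · exact Or.inl h1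
  · refine Or.inr fun h2 => h0 (Complex.ext h1.symm h2)

theorem maehara_calc {α β : ℝ → ℂ} (hα : Continuous α) (hβ : Continuous β) {a b z : ℂ} {x M : ℝ}
    (a0 : α 0 = a) (b0 : β 0 = a) (a1 : α 1 = b) (b1 : β 1 = b) (hax : a.re < x) (hxb : x < b.re)
    (hMα : ∀ t ∈ Icc (0 : ℝ) 1, -M < (α t).im ∧ (α t).im < M)
    (hMβ : ∀ t ∈ Icc (0 : ℝ) 1, -M < (β t).im ∧ (β t).im < M)
    (h1 : JoinedIn (strip a b (img β)) ⟨x, M⟩ z) (h2 : JoinedIn (strip a b (img α)) z ⟨x, -M⟩) :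
    theta α 0 1 z - theta β 0 1 z ≤ 0 ∧ -2 ≤ theta α 0 1 z - theta β 0 1 z ∧
    theta α 0 1 z - theta β 0 1 z ≠ 0 ∧ theta α 0 1 z - theta β 0 1 z ≠ -2 := by
  obtain ⟨L, hL, L0, L1, hLs⟩ := joined_fun h1
  obtain ⟨K, hK, K0, K1, hKs⟩ := joined_fun h2
  have c1 := cross_zero zero_le_one zero_le_one hβ hL
    (fun s hs t _ h => (hLs t).2.2 (h ▸ mem_img hs))
  have c2 := cross_zero zero_le_one zero_le_one hα hK
    (fun s hs t _ h => (hKs t).2.2 (h ▸ mem_img hs))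
  have hLa : ∀ t, L t ≠ a := fun t h => (hLs t).2.2 (by rw [h, ← b0]; exact mem_img z_mem)
  have hLb : ∀ t, L t ≠ b := fun t h => (hLs t).2.2 (by rw [h, ← b1]; exact mem_img o_mem)
  have hKa : ∀ t, K t ≠ a := fun t h => (hKs t).2.2 (by rw [h, ← a0]; exact mem_img z_mem)
  have hKb : ∀ t, K t ≠ b := fun t h => (hKs t).2.2 (by rw [h, ← a1]; exact mem_img o_mem)
  have tLa := theta_slit (γ := L) (x := a) 1 zero_le_one hL (fun t _ => by
    refine slit_of ?_ ?_
    · simpa using (hLs t).1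
    · simpa [sub_eq_zero] using hLa t)
  have tKa := theta_slit (γ := K) (x := a) 1 zero_le_one hK (fun t _ => by
    refine slit_of ?_ ?_
    · simpa using (hKs t).1
    · simpa [sub_eq_zero] using hKa t)
  have tLb := theta_slit (γ := L) (x := b) (-1) zero_le_one hL (fun t _ => by
    refine slit_of ?_ ?_
    · simpa using (hLs t).2.1
    · rw [neg_one_mul, neg_ne_zero, sub_ne_zero]; exact hLb t)
  have tKb := theta_slit (γ := K) (x := b) (-1) zero_le_one hK (fun t _ => by
    refine slit_of ?_ ?_
    · simpa using (hKs t).2.1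
    · rw [neg_one_mul, neg_ne_zero, sub_ne_zero]; exact hKb t)
  have tα := theta_slit (γ := α) (x := ⟨x, -M⟩) (-Complex.I) zero_le_one hα (fun t ht => by
    rw [Complex.mem_slitPlane_iff]; left
    have := hMα t ht
    simp; linarith)
  have tβ := theta_slit (γ := β) (x := ⟨x, M⟩) (Complex.I) zero_le_one hβ (fun t ht => by
    rw [Complex.mem_slitPlane_iff]; left
    have := hMβ t ht
    simp; linarith)
  rw [b0, b1, L0, L1] at c1
  rw [a0, a1, K0, K1] at c2
  rw [L0, L1] at tLa tLb
  rw [K0, K1] at tKa tKb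
  rw [a0, a1] at tα
  rw [b0, b1] at tβ
  have ha0 := hMα 0 z_mem
  have ha1 := hMα 1 o_mem
  rw [a0] at ha0
  rw [a1] at ha1
  have g1 := arg_pos_half (z := 1 * ((⟨x, M⟩ : ℂ) - a)) (by simp; linarith) (by simp; linarith)
  have g2 := arg_neg_half (z := 1 * ((⟨x, -M⟩ : ℂ) - a)) (by simp; linarith) (by simp; linarith)
  have g3 := arg_neg_half (z := -1 * ((⟨x, M⟩ : ℂ) - b)) (by simp; linarith) (by simp; linarith)
  have g4 := arg_pos_half (z := -1 * ((⟨x, -M⟩ : ℂ) - b)) (by simp; linarith) (by simp; linarith)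
  have g5 := arg_pos_half (z := -Complex.I * (a - (⟨x, -M⟩ : ℂ)))
    (by simp; linarith) (by simp; linarith)
  have g6 := arg_neg_half (z := -Complex.I * (b - (⟨x, -M⟩ : ℂ)))
    (by simp; linarith) (by simp; linarith)
  have g7 := arg_neg_half (z := Complex.I * (a - (⟨x, M⟩ : ℂ)))
    (by simp; linarith) (by simp; linarith)
  have g8 := arg_pos_half (z := Complex.I * (b - (⟨x, M⟩ : ℂ)))
    (by simp; linarith) (by simp; linarith)
  have g5' : Complex.arg (-Complex.I * (a - (⟨x, -M⟩ : ℂ))) < Real.pi / 2 := by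
    refine Complex.arg_lt_pi_div_two_iff.2 (Or.inl ?_)
    simp; linarith
  have hpi := Real.pi_pos
  set W := theta α 0 1 z - theta β 0 1 z with hW
  have key : W * (2 * Real.pi) =
      (Complex.arg (-Complex.I * (b - (⟨x, -M⟩ : ℂ))) - Complex.arg (-Complex.I * (a - (⟨x, -M⟩ : ℂ))))
      - (Complex.arg (Complex.I * (b - (⟨x, M⟩ : ℂ))) - Complex.arg (Complex.I * (a - (⟨x, M⟩ : ℂ))))
      - (Complex.arg (-1 * ((⟨x, -M⟩ : ℂ) - b)) - Complex.arg (-1 * ((⟨x, M⟩ : ℂ) - b)))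
      + (Complex.arg (1 * ((⟨x, -M⟩ : ℂ) - a)) - Complex.arg (1 * ((⟨x, M⟩ : ℂ) - a))) := by
    have : W = theta α 0 1 ⟨x, -M⟩ - theta β 0 1 ⟨x, M⟩ - (theta L 0 1 b + theta K 0 1 b)
      + (theta L 0 1 a + theta K 0 1 a) := by rw [hW]; linarith
    rw [this, tα, tβ, tLa, tKa, tLb, tKb]
    field_simp
    ring
  refine ⟨?_, ?_, ?_, ?_⟩
  · by_contra h; push Not at h
    nlinarith
  · by_contra h; push Not at h
    nlinarith
  · intro h; rw [h] at key; linarith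
  · intro h; rw [h] at key; linarith

theorem maehara_aux {α β : ℝ → ℂ} (hα : Continuous α) (hβ : Continuous β) {a b : ℂ}
    (a0 : α 0 = a) (b0 : β 0 = a) (a1 : α 1 = b) (b1 : β 1 = b) {x M : ℝ}
    (hax : a.re < x) (hxb : x < b.re)
    (hsα : ∀ t ∈ Icc (0 : ℝ) 1, a.re ≤ (α t).re ∧ (α t).re ≤ b.re)
    (hsβ : ∀ t ∈ Icc (0 : ℝ) 1, a.re ≤ (β t).re ∧ (β t).re ≤ b.re)
    (d1 : ∀ s ∈ Ioo (0 : ℝ) 1, α s ∉ img β) (d2 : ∀ s ∈ Ioo (0 : ℝ) 1, β s ∉ img α)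
    (hMα : ∀ t ∈ Icc (0 : ℝ) 1, -M < (α t).im ∧ (α t).im < M)
    (hMβ : ∀ t ∈ Icc (0 : ℝ) 1, -M < (β t).im ∧ (β t).im < M)
    {l : ℝ} (hl : l ∈ Icc (0 : ℝ) 1) (hlx : (α l).re = x)
    (hlm : ∀ t ∈ Icc (0 : ℝ) 1, (β t).re = x → (β t).im < (α l).im) :
    ∃ z, z ∉ img α ∧ z ∉ img β ∧ Odd (wd α β z) := by
  have hmem : ∀ {z : ℂ} {S : Set ℂ}, z.re = x → z ∉ S → z ∈ strip a b S := by
    intro z S h1 h2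
    exact ⟨by rw [h1]; exact hax.le, by rw [h1]; exact hxb.le, h2⟩
  have interior : ∀ {γ : ℝ → ℂ} {t : ℝ}, γ 0 = a → γ 1 = b → t ∈ Icc (0 : ℝ) 1 → (γ t).re = x →
      t ∈ Ioo (0 : ℝ) 1 := by
    intro γ t g0 g1 ht hx
    refine ⟨lt_of_le_of_ne ht.1 ?_, lt_of_le_of_ne ht.2 ?_⟩
    · rintro rfl; rw [g0] at hx; linarith
    · rintro rfl; rw [g1] at hx; linarith
  have sub : ∀ {s t : ℝ}, s ∈ Ioo (0 : ℝ) 1 → t ∈ Ioo (0 : ℝ) 1 → uIcc s t ⊆ Ioo 0 1 :=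
    fun hs ht => ordConnected_Ioo.uIcc_subset hs ht
  have cl : ∀ γ : ℝ → ℂ, Continuous γ → IsCompact (Icc (0 : ℝ) 1 ∩ {t | (γ t).re = x}) := by
    intro γ hγ
    exact isCompact_Icc.inter_right (isClosed_eq (Complex.continuous_re.comp hγ) continuous_const)
  -- conclusion from the two joins
  have fin : ∀ z : ℂ, z ∉ img α → z ∉ img β → JoinedIn (strip a b (img β)) ⟨x, M⟩ z →
      JoinedIn (strip a b (img α)) z ⟨x, -M⟩ → wd α β z = -1 := by
    intro z z1 z2 h1 h2
    have c := maehara_calc hα hβ a0 b0 a1 b1 hax hxb hMα hMβ h1 h2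
    have w := wd_spec (x := z) hα hβ (a0.trans b0.symm) (a1.trans b1.symm) z1 z2
    rw [← w] at c
    obtain ⟨c1, c2, c3, c4⟩ := c
    have c1' : wd α β z ≤ 0 := by exact_mod_cast c1
    have c2' : -2 ≤ wd α β z := by exact_mod_cast c2
    have c3' : wd α β z ≠ 0 := by exact_mod_cast c3
    have c4' : wd α β z ≠ -2 := by exact_mod_cast c4
    omega
  obtain ⟨m, ⟨hm, hmx⟩, hmin⟩ := (cl α hα).exists_isMinOn ⟨l, hl, hlx⟩
    (f := fun t => (α t).im) (Complex.continuous_im.comp hα).continuousOn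
  have hmx' : (α m).re = x := hmx
  have hli := interior a0 a1 hl hlx
  have hmi := interior a0 a1 hm hmx
  have j1 : JoinedIn (strip a b (img β)) ⟨x, M⟩ (α m) := by
    have e1 : JoinedIn (strip a b (img β)) ⟨x, M⟩ (α l) := by
      have : α l = ⟨x, (α l).im⟩ := Complex.ext hlx rfl
      rw [this]
      refine joined_vert fun y hy => hmem rfl ?_
      rintro ⟨t, ht, h⟩
      have k1 := hlm t ht (by rw [h])
      rw [h] at k1
      rw [uIcc_of_ge (hMα l hl).2.le] at hy
      have := hy.1
      simp at k1; linarith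
    refine e1.trans (joined_arc hα fun t ht => ?_)
    have ht' := sub hli hmi ht
    exact ⟨(hsα t (Ioo_subset_Icc_self ht')).1, (hsα t (Ioo_subset_Icc_self ht')).2, d1 t ht'⟩
  have hαm : α m = ⟨x, (α m).im⟩ := Complex.ext hmx' rfl
  have hMbot : ∀ {γ : ℝ → ℂ}, (∀ t ∈ Icc (0 : ℝ) 1, -M < (γ t).im ∧ (γ t).im < M) →
      (⟨x, -M⟩ : ℂ) ∉ img γ := by
    rintro γ hγ ⟨t, ht, h⟩
    have := (hγ t ht).1
    rw [h] at this
    simp at this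
  by_cases hcase : ∃ t ∈ Icc (0 : ℝ) 1, (β t).re = x ∧ (β t).im ≤ (α m).im
  · obtain ⟨t₀, ht₀, ht₀x, ht₀m⟩ := hcase
    have hcomp : IsCompact ((Icc (0 : ℝ) 1 ∩ {t | (β t).re = x}) ∩ {t | (β t).im ≤ (α m).im}) :=
      (cl β hβ).inter_right (isClosed_le (Complex.continuous_im.comp hβ) continuous_const)
    obtain ⟨p, ⟨⟨hp, hpx⟩, hpm⟩, hpmax⟩ := hcomp.exists_isMaxOn ⟨t₀, ⟨ht₀, ht₀x⟩, ht₀m⟩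
      (f := fun t => (β t).im) (Complex.continuous_im.comp hβ).continuousOn
    have hpx' : (β p).re = x := hpx
    have hpm' : (β p).im ≤ (α m).im := hpm
    have hpi := interior b0 b1 hp hpx
    have hβp : β p = ⟨x, (β p).im⟩ := Complex.ext hpx' rfl
    have hlt : (β p).im < (α m).im := by
      refine lt_of_le_of_ne hpm' fun h => d1 m hmi ?_
      rw [hαm, ← h, ← hβp]; exact mem_img hp
    set y₀ := ((β p).im + (α m).im) / 2 with hy₀
    have nα : ∀ y, y < (α m).im → (⟨x, y⟩ : ℂ) ∉ img α := by
      rintro y hy ⟨t, ht, h⟩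
      have := hmin ⟨ht, (by simp [h] : (α t).re = x)⟩
      simp only [mem_ofPred_eq, h] at this
      linarith
    have nβ : ∀ y, (β p).im < y → y ≤ (α m).im → (⟨x, y⟩ : ℂ) ∉ img β := by
      rintro y hy hy2 ⟨t, ht, h⟩
      have := hpmax ⟨⟨ht, (by simp [h] : (β t).re = x)⟩, (by simpa [h] using hy2 : (β t).im ≤ (α m).im)⟩
      simp only [mem_ofPred_eq, h] at this
      linarith
    have hz1 : (⟨x, y₀⟩ : ℂ) ∉ img α := nα _ (by rw [hy₀]; linarith)
    have hz2 : (⟨x, y₀⟩ : ℂ) ∉ img β := nβ _ (by rw [hy₀]; linarith) (by rw [hy₀]; linarith)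
    refine ⟨⟨x, y₀⟩, hz1, hz2, ?_⟩
    rw [fin _ hz1 hz2]
    · decide
    · refine j1.trans ?_
      rw [hαm]
      refine joined_vert fun y hy => hmem rfl ?_
      rw [uIcc_of_ge (by rw [hy₀]; linarith)] at hy
      refine nβ y ?_ hy.2
      have := hy.1
      rw [hy₀] at this
      linarith
    · have e1 : JoinedIn (strip a b (img α)) ⟨x, y₀⟩ (β p) := by
        rw [hβp]
        refine joined_vert fun y hy => hmem rfl (nα y ?_)
        rw [uIcc_of_ge (by rw [hy₀]; linarith)] at hy
        have := hy.2
        rw [hy₀] at this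
        linarith
      refine e1.trans ?_
      rw [hβp]
      refine joined_vert fun y hy => hmem rfl (nα y ?_)
      rw [uIcc_of_ge (hMβ p hp).1.le] at hy
      exact hy.2.trans_lt hlt
  · exfalso
    push Not at hcase
    have hb1 := hMbot hMα
    have hb2 := hMbot hMβ
    have := fin ⟨x, -M⟩ hb1 hb2 (j1.trans (by
      rw [hαm]
      refine joined_vert fun y hy => hmem rfl ?_
      rintro ⟨t, ht, h⟩
      have k1 := hcase t ht (by rw [h])
      rw [h] at k1
      rw [uIcc_of_ge (hMα m hm).1.le] at hy
      have := hy.2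
      simp at k1; linarith)) (JoinedIn.refl (hmem rfl hb1))
    have w := wd_spec (x := ⟨x, -M⟩) hα hβ (a0.trans b0.symm) (a1.trans b1.symm) hb1 hb2
    have tα := theta_slit (γ := α) (x := ⟨x, -M⟩) (-Complex.I) zero_le_one hα (fun t ht => by
      rw [Complex.mem_slitPlane_iff]; left
      have := hMα t ht
      simp; linarith)
    have tβ := theta_slit (γ := β) (x := ⟨x, -M⟩) (-Complex.I) zero_le_one hβ (fun t ht => by
      rw [Complex.mem_slitPlane_iff]; left
      have := hMβ t ht
      simp; linarith)
    rw [tα, tβ, a0, a1, b0, b1, this] at w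
    simp at w

end LW

namespace LW

theorem maehara {α β : ℝ → ℂ} (hα : Continuous α) (hβ : Continuous β) {a b : ℂ}
    (a0 : α 0 = a) (b0 : β 0 = a) (a1 : α 1 = b) (b1 : β 1 = b)
    (hab : a.re < b.re)
    (hsα : ∀ t ∈ Icc (0 : ℝ) 1, a.re ≤ (α t).re ∧ (α t).re ≤ b.re)
    (hsβ : ∀ t ∈ Icc (0 : ℝ) 1, a.re ≤ (β t).re ∧ (β t).re ≤ b.re)
    (d1 : ∀ s ∈ Ioo (0 : ℝ) 1, α s ∉ img β) (d2 : ∀ s ∈ Ioo (0 : ℝ) 1, β s ∉ img α) :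
    ∃ z, z ∉ img α ∧ z ∉ img β ∧ Odd (wd α β z) := by
  obtain ⟨x, hax, hxb⟩ := exists_between hab
  obtain ⟨R, hR⟩ := ((img_compact hα).union (img_compact hβ)).isBounded.exists_norm_le
  have hM : ∀ {γ : ℝ → ℂ}, img γ ⊆ img α ∪ img β → ∀ t ∈ Icc (0 : ℝ) 1,
      -(R + 1) < (γ t).im ∧ (γ t).im < R + 1 := by
    intro γ hγ t ht
    have := (Complex.abs_im_le_norm (γ t)).trans (hR _ (hγ (mem_img ht)))
    have := abs_le.1 this
    constructor <;> linarith
  have hMα := hM (γ := α) subset_union_left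
  have hMβ := hM (γ := β) subset_union_right
  have top : ∀ γ : ℝ → ℂ, Continuous γ → γ 0 = a → γ 1 = b → ∃ l ∈ Icc (0 : ℝ) 1, (γ l).re = x ∧
      ∀ t ∈ Icc (0 : ℝ) 1, (γ t).re = x → (γ t).im ≤ (γ l).im := by
    intro γ hγ g0 g1
    have hc : IsCompact (Icc (0 : ℝ) 1 ∩ {t | (γ t).re = x}) :=
      isCompact_Icc.inter_right (isClosed_eq (Complex.continuous_re.comp hγ) continuous_const)
    have hne : (Icc (0 : ℝ) 1 ∩ {t | (γ t).re = x}).Nonempty := by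
      have := intermediate_value_Icc zero_le_one (Complex.continuous_re.comp hγ).continuousOn
      simp only [Function.comp, g0, g1] at this
      obtain ⟨t, ht, h⟩ := this ⟨hax.le, hxb.le⟩
      exact ⟨t, ht, h⟩
    obtain ⟨l, ⟨hl, hlx⟩, hmax⟩ := hc.exists_isMaxOn hne
      (f := fun t => (γ t).im) (Complex.continuous_im.comp hγ).continuousOn
    exact ⟨l, hl, hlx, fun t ht h => hmax ⟨ht, h⟩⟩
  obtain ⟨l, hl, hlx, hlm⟩ := top α hα a0 a1
  obtain ⟨k, hk, hkx, hkm⟩ := top β hβ b0 b1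
  rcases lt_trichotomy (α l).im (β k).im with h | h | h
  · obtain ⟨z, z1, z2, z3⟩ := maehara_aux hβ hα b0 a0 b1 a1 hax hxb hsβ hsα d2 d1 hMβ hMα hk hkx
      (fun t ht h' => (hlm t ht h').trans_lt h)
    refine ⟨z, z2, z1, ?_⟩
    rw [wd_comm]; exact z3.neg
  · exfalso
    refine d1 l ⟨lt_of_le_of_ne hl.1 ?_, lt_of_le_of_ne hl.2 ?_⟩ ?_
    · rintro rfl; rw [a0] at hlx; linarith
    · rintro rfl; rw [a1] at hlx; linarith
    · rw [Complex.ext (hlx.trans hkx.symm) h]; exact mem_img hk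
  · exact maehara_aux hα hβ a0 b0 a1 b1 hax hxb hsα hsβ d1 d2 hMα hMβ hl hlx
      (fun t ht h' => (hkm t ht h').trans_lt h)

theorem theta_affine (γ : ℝ → ℂ) {k c : ℝ} {x : ℂ} (hk : 0 ≤ k) (hγ : Continuous γ)
    (hx : x ∉ γ '' Icc c (c + k)) :
    theta (fun t => γ (c + t * k)) 0 1 x = theta γ c (c + k) x := by
  obtain ⟨L, hL⟩ := exists_lift (by linarith) hγ hx
  have hm : MapsTo (fun t : ℝ => c + t * k) (Icc 0 1) (Icc c (c + k)) := by
    intro t ht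
    constructor
    · have := mul_nonneg ht.1 hk
      simp only; linarith
    · have := mul_le_mul_of_nonneg_right ht.2 hk
      simp only; linarith
  have h1 : IsLift (fun t => γ (c + t * k)) 0 1 x (fun t => L (c + t * k)) :=
    ⟨hL.1.comp (by fun_prop) hm, fun t ht => hL.2 _ (hm ht)⟩
  rw [theta_eq zero_le_one h1, theta_eq (by linarith) hL]
  simp

theorem theta_affine_rev (γ : ℝ → ℂ) {k c : ℝ} {x : ℂ} (hk : 0 ≤ k) (hγ : Continuous γ)
    (hx : x ∉ γ '' Icc (c - k) c) :
    theta (fun t => γ (c - t * k)) 0 1 x = - theta γ (c - k) c x := by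
  obtain ⟨L, hL⟩ := exists_lift (by linarith) hγ hx
  have hm : MapsTo (fun t : ℝ => c - t * k) (Icc 0 1) (Icc (c - k) c) := by
    intro t ht
    constructor
    · have := mul_le_mul_of_nonneg_right ht.2 hk
      simp only; linarith
    · have := mul_nonneg ht.1 hk
      simp only; linarith
  have h1 : IsLift (fun t => γ (c - t * k)) 0 1 x (fun t => L (c - t * k)) :=
    ⟨hL.1.comp (by fun_prop) hm, fun t ht => hL.2 _ (hm ht)⟩
  rw [theta_eq zero_le_one h1, theta_eq (by linarith) hL]
  simp; ring

theorem maehara_rev {α β : ℝ → ℂ} (hα : Continuous α) (hβ : Continuous β) {a b : ℂ}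
    (a0 : α 0 = b) (b0 : β 0 = b) (a1 : α 1 = a) (b1 : β 1 = a)
    (hab : a.re < b.re)
    (hsα : ∀ t ∈ Icc (0 : ℝ) 1, a.re ≤ (α t).re ∧ (α t).re ≤ b.re)
    (hsβ : ∀ t ∈ Icc (0 : ℝ) 1, a.re ≤ (β t).re ∧ (β t).re ≤ b.re)
    (d1 : ∀ s ∈ Ioo (0 : ℝ) 1, α s ∉ img β) (d2 : ∀ s ∈ Ioo (0 : ℝ) 1, β s ∉ img α) :
    ∃ z, z ∉ img α ∧ z ∉ img β ∧ Odd (wd α β z) := by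
  have hi : ∀ t : ℝ, t ∈ Icc (0 : ℝ) 1 → 1 - t ∈ Icc (0 : ℝ) 1 := fun t ht =>
    ⟨by linarith [ht.2], by linarith [ht.1]⟩
  have hi' : ∀ t : ℝ, t ∈ Ioo (0 : ℝ) 1 → 1 - t ∈ Ioo (0 : ℝ) 1 := fun t ht =>
    ⟨by linarith [ht.2], by linarith [ht.1]⟩
  have him : ∀ γ : ℝ → ℂ, img (fun t => γ (1 - t)) = img γ := by
    intro γ; ext z; constructor
    · rintro ⟨t, ht, rfl⟩; exact mem_img (hi t ht)
    · rintro ⟨t, ht, rfl⟩; exact ⟨1 - t, hi t ht, by simp⟩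
  have hα' : Continuous (fun t => α (1 - t)) := by fun_prop
  have hβ' : Continuous (fun t => β (1 - t)) := by fun_prop
  obtain ⟨z, z1, z2, z3⟩ := maehara (α := fun t => α (1 - t)) (β := fun t => β (1 - t)) (a := a) (b := b)
    hα' hβ' (by simp [a1]) (by simp [b1]) (by simp [a0]) (by simp [b0]) hab
    (fun t ht => hsα _ (hi t ht)) (fun t ht => hsβ _ (hi t ht))
    (fun t ht => by rw [him]; exact d1 _ (hi' t ht))
    (fun t ht => by rw [him]; exact d2 _ (hi' t ht))
  have s1 := wd_spec hα' hβ' (by simp [a1, b1]) (by simp [a0, b0]) z1 z2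
  rw [him] at z1 z2
  have s2 := wd_spec hα hβ (by simp [a0, b0]) (by simp [a1, b1]) z1 z2
  have r1 := theta_reverse α (a := 0) (b := 1) 1 (x := z) zero_le_one hα (by rw [sub_self, sub_zero]; exact z1)
  have r2 := theta_reverse β (a := 0) (b := 1) 1 (x := z) zero_le_one hβ (by rw [sub_self, sub_zero]; exact z2)
  simp only [sub_self, sub_zero] at r1 r2
  have : ((wd (fun t => α (1 - t)) (fun t => β (1 - t)) z : ℤ) : ℝ) = ((- wd α β z : ℤ) : ℝ) := by
    push_cast
    rw [s1, s2, r1, r2]; ring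
  have := Int.cast_injective this
  refine ⟨z, z1, z2, ?_⟩
  rw [this] at z3
  simpa using z3.neg

theorem exists_odd_wd {e f : ℝ → ℂ} (he : Continuous e) (hf : Continuous f)
    (hie : InjOn e (Icc 0 1)) (hif : InjOn f (Icc 0 1)) (h0 : e 0 = f 0) (h1 : e 1 = f 1)
    (hd : img e ∩ img f ⊆ {e 0, e 1}) :
    ∃ z, z ∉ img e ∧ z ∉ img f ∧ Odd (wd e f z) := by
  classical
  set c : ℝ → ℂ := fun t => if t ≤ 1 then e t else f (2 - t) with hc
  have hcc : Continuous c := by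
    refine Continuous.if_le he (by fun_prop) continuous_id continuous_const ?_
    intro t ht
    have : t = 1 := ht
    subst this
    norm_num [h1]
  set C : ℝ → ℂ := fun t => if t ≤ 2 then c t else c (t - 2) with hC
  have c0 : c 0 = e 0 := by simp [hc]
  have c2 : c 2 = e 0 := by simp [hc, h0]
  have hCc : Continuous C := by
    refine Continuous.if_le hcc (by fun_prop) continuous_id continuous_const ?_
    intro t ht
    have : t = 2 := ht
    subst this
    rw [c2, sub_self, c0]
  have Clow : ∀ t, t ≤ 2 → C t = c t := fun t ht => by simp [hC, ht]
  have Cper : ∀ t, 0 ≤ t → t ≤ 2 → C (t + 2) = C t := by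
    intro t ht ht2
    rw [Clow t ht2]
    rcases ht.eq_or_lt with rfl | hpos
    · rw [zero_add, Clow 2 le_rfl, c2, c0]
    · have : ¬ (t + 2 ≤ 2) := by linarith
      simp [hC, this]
  have Ce : ∀ t, t ≤ 1 → C t = e t := by
    intro t ht
    rw [Clow t (by linarith)]; simp [hc, ht]
  have Cf : ∀ t, 1 ≤ t → t ≤ 2 → C t = f (2 - t) := by
    intro t ht ht2
    rw [Clow t ht2]
    rcases ht.eq_or_lt with rfl | h
    · simp [hc, h1]; norm_num
    · simp [hc, not_le.2 h]
  have Cinj : InjOn C (Ico 0 2) := by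
    have mixed : ∀ s t, 0 ≤ s → s ≤ 1 → 1 < t → t < 2 → C s ≠ C t := by
      intro s t hs0 hs1 ht1 ht2 h
      rw [Ce s hs1, Cf t ht1.le ht2.le] at h
      have m1 : (2 - t) ∈ Icc (0 : ℝ) 1 := ⟨by linarith, by linarith⟩
      have := hd ⟨⟨s, ⟨hs0, hs1⟩, h⟩, mem_img m1⟩
      rcases this with h' | h'
      · rw [h0] at h'
        have := hif m1 z_mem h'
        linarith
      · rw [mem_singleton_iff, h1] at h'
        have := hif m1 o_mem h'
        linarith
    intro s hs t ht h
    rcases le_or_gt s 1 with s1 | s1 <;> rcases le_or_gt t 1 with t1 | t1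
    · rw [Ce s s1, Ce t t1] at h
      exact hie ⟨hs.1, s1⟩ ⟨ht.1, t1⟩ h
    · exact absurd h (mixed s t hs.1 s1 t1 ht.2)
    · exact absurd h.symm (mixed t s ht.1 t1 s1 hs.2)
    · rw [Cf s s1.le hs.2.le, Cf t t1.le ht.2.le] at h
      have := hif (⟨by linarith [hs.2], by linarith⟩ : 2 - s ∈ Icc (0 : ℝ) 1)
        (⟨by linarith [ht.2], by linarith⟩ : 2 - t ∈ Icc (0 : ℝ) 1) h
      linarith
  -- extremal points
  have hre : Continuous fun t => (C t).re := Complex.continuous_re.comp hCc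
  have C02 : C 2 = C 0 := by have := Cper 0 le_rfl (by norm_num); simpa using this
  have hnorm : ∀ s ∈ Icc (0 : ℝ) 2, ∃ s' ∈ Ico (0 : ℝ) 2, C s' = C s := by
    intro s hs
    rcases hs.2.eq_or_lt with rfl | h
    · exact ⟨0, ⟨le_rfl, by norm_num⟩, C02.symm⟩
    · exact ⟨s, ⟨hs.1, h⟩, rfl⟩
  obtain ⟨s₁, hs₁, hmin⟩ := isCompact_Icc.exists_isMinOn (s := Icc (0 : ℝ) 2)
    ⟨0, by simp⟩ hre.continuousOn
  obtain ⟨t₁, ht₁, hmax⟩ := isCompact_Icc.exists_isMaxOn (s := Icc (0 : ℝ) 2)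
    ⟨0, by simp⟩ hre.continuousOn
  obtain ⟨s, hs, hss⟩ := hnorm s₁ hs₁
  obtain ⟨t, ht, htt⟩ := hnorm t₁ ht₁
  have hlo : ∀ x ∈ Icc (0 : ℝ) 4, (C s).re ≤ (C x).re ∧ (C x).re ≤ (C t).re := by
    have base : ∀ x ∈ Icc (0 : ℝ) 2, (C s).re ≤ (C x).re ∧ (C x).re ≤ (C t).re := by
      intro x hx
      rw [hss, htt]; exact ⟨hmin hx, hmax hx⟩
    intro x hx
    rcases le_total x 2 with h | h
    · exact base x ⟨hx.1, h⟩
    · have := Cper (x - 2) (by linarith) (by linarith [hx.2])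
      rw [sub_add_cancel] at this
      rw [this]
      exact base _ ⟨by linarith, by linarith [hx.2]⟩
  have hlt : (C s).re < (C t).re := by
    by_contra hcon
    have hconst : ∀ x ∈ Icc (0 : ℝ) 2, (C x).re = (C s).re := by
      intro x hx
      have := hlo x ⟨hx.1, by linarith [hx.2]⟩
      linarith
    have hee : ∀ x ∈ Icc (0 : ℝ) 1, (e x).re = (C s).re := by
      intro x hx
      rw [← Ce x hx.2]; exact hconst x ⟨hx.1, by linarith [hx.2]⟩
    have hff : ∀ x ∈ Icc (0 : ℝ) 1, (f x).re = (C s).re := by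
      intro x hx
      have := Cf (2 - x) (by linarith [hx.2]) (by linarith [hx.1])
      rw [sub_sub_cancel] at this
      rw [← this]; exact hconst _ ⟨by linarith [hx.2], by linarith [hx.1]⟩
    have hne : (e 0).im ≠ (e 1).im := by
      intro h
      have : e 0 = e 1 := Complex.ext ((hee 0 z_mem).trans (hee 1 o_mem).symm) h
      have := hie z_mem o_mem this
      norm_num at this
    set y := ((e 0).im + (e 1).im) / 2 with hy
    have ymem : y ∈ uIcc (e 0).im (e 1).im := by
      rw [mem_uIcc]
      rcases le_total (e 0).im (e 1).im with h | h
      · left; constructor <;> linarith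
      · right; constructor <;> linarith
    obtain ⟨p, hp, hpy⟩ := intermediate_value_uIcc (a := (0 : ℝ)) (b := 1)
      (Complex.continuous_im.comp he).continuousOn ymem
    obtain ⟨q, hq, hqy⟩ := intermediate_value_uIcc (a := (0 : ℝ)) (b := 1)
      (Complex.continuous_im.comp hf).continuousOn (by simpa only [Function.comp, ← h0, ← h1] using ymem)
    rw [uIcc_of_le zero_le_one] at hp hq
    have hpq : e p = f q := Complex.ext ((hee p hp).trans (hff q hq).symm) (hpy.trans hqy.symm)
    rcases hd ⟨mem_img hp, ⟨q, hq, hpq.symm⟩⟩ with h | h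
    · have : (e p).im = (e 0).im := by rw [h]
      simp only [Function.comp] at hpy
      apply hne; linarith
    · rw [mem_singleton_iff] at h
      have : (e p).im = (e 1).im := by rw [h]
      simp only [Function.comp] at hpy
      apply hne; linarith
  -- splitting the loop
  have split : ∀ p q : ℝ, 0 ≤ p → p < q → q < 2 →
      (∀ x, (∀ r ∈ Icc (0 : ℝ) 2, C r ≠ x) → ((wd (fun τ => C (p + τ * (q - p)))
        (fun τ => C (p + 2 - τ * (p + 2 - q))) x : ℤ) : ℝ) = theta C 0 2 x) := by
    intro p q hp hpq hq x hx
    have hx4 : ∀ r ∈ Icc (0 : ℝ) 4, C r ≠ x := by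
      intro r hr
      rcases le_total r 2 with h | h
      · exact hx r ⟨hr.1, h⟩
      · have := Cper (r - 2) (by linarith) (by linarith [hr.2])
        rw [sub_add_cancel] at this
        rw [this]
        exact hx _ ⟨by linarith, by linarith [hr.2]⟩
    have hni : ∀ u v : ℝ, 0 ≤ u → v ≤ 4 → x ∉ C '' Icc u v := by
      rintro u v hu hv ⟨r, hr, h⟩
      exact hx4 r ⟨hu.trans hr.1, hr.2.trans hv⟩ h
    have e1 := theta_affine C (k := q - p) (c := p) (x := x) (by linarith) hCc
      (hni _ _ hp (by linarith))
    have e2 := theta_affine_rev C (k := p + 2 - q) (c := p + 2) (x := x) (by linarith) hCc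
      (hni _ _ (by linarith) (by linarith))
    rw [wd_spec (by fun_prop) (by fun_prop)]
    · rw [e1, e2]
      have r1 : p + (q - p) = q := by ring
      have r2 : p + 2 - (p + 2 - q) = q := by ring
      rw [r1, r2, sub_neg_eq_add, ← theta_add hpq.le (by linarith) hCc (hni _ _ hp (by linarith)),
        theta_add (b := 2) (by linarith) (by linarith) hCc (hni _ _ hp (by linarith)),
        theta_add (a := 0) (b := p) (c := 2) hp (by linarith) hCc (hni _ _ le_rfl (by linarith))]
      have r3 := theta_shift C (a := 0) (b := p) 2 (x := x) hp hCc (hni _ _ (by linarith) (by linarith))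
      have r4 : theta (fun t => C (t + 2)) 0 p x = theta C 0 p x :=
        theta_congr fun r hr => Cper r hr.1 (by linarith [hr.2])
      rw [zero_add] at r3
      rw [← r3, r4]; ring
    · have := Cper p hp (by linarith)
      simp [this]
    · simp
    · rintro ⟨τ, hτ, h⟩
      refine hx4 _ ?_ h
      have := mul_nonneg hτ.1 (by linarith : 0 ≤ q - p)
      have := mul_le_mul_of_nonneg_right hτ.2 (by linarith : 0 ≤ q - p)
      constructor <;> linarith
    · rintro ⟨τ, hτ, h⟩
      refine hx4 _ ?_ h
      have := mul_nonneg hτ.1 (by linarith : 0 ≤ p + 2 - q)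
      have := mul_le_mul_of_nonneg_right hτ.2 (by linarith : 0 ≤ p + 2 - q)
      constructor <;> linarith
  -- crossing-free
  have free : ∀ p q : ℝ, 0 ≤ p → p < q → q < 2 →
      (∀ τ ∈ Ioo (0 : ℝ) 1, C (p + τ * (q - p)) ∉ img (fun τ => C (p + 2 - τ * (p + 2 - q)))) ∧
      (∀ τ ∈ Ioo (0 : ℝ) 1, C (p + 2 - τ * (p + 2 - q)) ∉ img (fun τ => C (p + τ * (q - p)))) := by
    intro p q hp hpq hq
    constructor
    · rintro τ hτ ⟨σ, hσ, h⟩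
      have a1 := mul_pos hτ.1 (by linarith : 0 < q - p)
      have a2 := mul_lt_mul_of_pos_right hτ.2 (by linarith : 0 < q - p)
      have a3 := mul_nonneg hσ.1 (by linarith : 0 ≤ p + 2 - q)
      have a4 := mul_le_mul_of_nonneg_right hσ.2 (by linarith : 0 ≤ p + 2 - q)
      simp only at h
      rcases lt_or_ge (p + 2 - σ * (p + 2 - q)) 2 with h2 | h2
      · have := Cinj ⟨by linarith, h2⟩ ⟨by linarith, by linarith⟩ h
        linarith
      · have k := Cper (p + 2 - σ * (p + 2 - q) - 2) (by linarith) (by linarith)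
        rw [sub_add_cancel] at k
        rw [k] at h
        have := Cinj ⟨by linarith, by linarith⟩ ⟨by linarith, by linarith⟩ h
        linarith
    · rintro τ hτ ⟨σ, hσ, h⟩
      have a1 := mul_pos hτ.1 (by linarith : 0 < p + 2 - q)
      have a2 := mul_lt_mul_of_pos_right hτ.2 (by linarith : 0 < p + 2 - q)
      have a3 := mul_nonneg hσ.1 (by linarith : 0 ≤ q - p)
      have a4 := mul_le_mul_of_nonneg_right hσ.2 (by linarith : 0 ≤ q - p)
      simp only at h
      rcases lt_or_ge (p + 2 - τ * (p + 2 - q)) 2 with h2 | h2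
      · have := Cinj ⟨by linarith, by linarith⟩ ⟨by linarith, h2⟩ h
        linarith
      · have k := Cper (p + 2 - τ * (p + 2 - q) - 2) (by linarith) (by linarith)
        rw [sub_add_cancel] at k
        rw [k] at h
        have := Cinj ⟨by linarith, by linarith⟩ ⟨by linarith, by linarith⟩ h
        linarith
  have bnd1 : ∀ p q : ℝ, 0 ≤ p → p < q → q < 2 → ∀ τ ∈ Icc (0 : ℝ) 1,
      (p + τ * (q - p)) ∈ Icc (0 : ℝ) 4 ∧ p + 2 - τ * (p + 2 - q) ∈ Icc (0 : ℝ) 4 := by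
    intro p q hp hpq hq τ hτ
    have a1 := mul_nonneg hτ.1 (by linarith : 0 ≤ p + 2 - q)
    have a2 := mul_le_mul_of_nonneg_right hτ.2 (by linarith : 0 ≤ p + 2 - q)
    have a3 := mul_nonneg hτ.1 (by linarith : 0 ≤ q - p)
    have a4 := mul_le_mul_of_nonneg_right hτ.2 (by linarith : 0 ≤ q - p)
    refine ⟨⟨?_, ?_⟩, ?_, ?_⟩ <;> linarith
  -- covering
  have cover : ∀ p q : ℝ, 0 ≤ p → p < q → q < 2 → ∀ x, x ∉ img (fun τ => C (p + τ * (q - p))) →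
      x ∉ img (fun τ => C (p + 2 - τ * (p + 2 - q))) → ∀ r ∈ Icc (0 : ℝ) 2, C r ≠ x := by
    intro p q hp hpq hq x h1 h2 r hr hx
    have c2 : ∀ r', q ≤ r' → r' ≤ p + 2 → C r' ≠ x := by
      intro r' hr1 hr2 h
      apply h2
      refine ⟨(p + 2 - r') / (p + 2 - q), ⟨div_nonneg (by linarith) (by linarith), ?_⟩, ?_⟩
      · rw [div_le_one (by linarith)]; linarith
      · simp only
        rw [div_mul_cancel₀ _ (by linarith)]
        rw [sub_sub_cancel]; exact h
    rcases le_or_gt r q with hq' | hq'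
    · rcases le_or_gt p r with hp' | hp'
      · apply h1
        refine ⟨(r - p) / (q - p), ⟨div_nonneg (by linarith) (by linarith), ?_⟩, ?_⟩
        · rw [div_le_one (by linarith)]; linarith
        · simp only
          rw [div_mul_cancel₀ _ (by linarith)]
          rw [add_sub_cancel]; exact hx
      · refine c2 (r + 2) (by linarith [hr.1]) (by linarith) ?_
        rw [Cper r hr.1 hr.2]; exact hx
    · exact c2 r hq'.le (by linarith [hr.2]) hx
  -- final transfer
  have final : ∀ z, (∀ r ∈ Icc (0 : ℝ) 2, C r ≠ z) → z ∉ img e ∧ z ∉ img f ∧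
      ((wd e f z : ℤ) : ℝ) = theta C 0 2 z := by
    intro z hz
    have ze : z ∉ img e := by
      rintro ⟨r, hr, h⟩
      rw [← Ce r hr.2] at h
      exact hz r ⟨hr.1, by linarith [hr.2]⟩ h
    have zf : z ∉ img f := by
      rintro ⟨r, hr, h⟩
      have := Cf (2 - r) (by linarith [hr.2]) (by linarith [hr.1])
      rw [sub_sub_cancel, h] at this
      exact hz _ ⟨by linarith [hr.2], by linarith [hr.1]⟩ this
    refine ⟨ze, zf, ?_⟩
    rw [wd_spec he hf h0 h1 ze zf, theta_add (a := 0) (b := 1) (c := 2) (by norm_num) (by norm_num) hCc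
      (by rintro ⟨r, hr, h⟩; exact hz r hr h)]
    have q1 : theta C 0 1 z = theta e 0 1 z := theta_congr fun r hr => Ce r hr.2
    have q2 : theta C 1 2 z = theta (fun r => f (2 - r)) 1 2 z :=
      theta_congr fun r hr => Cf r hr.1 hr.2
    have q3 := theta_reverse f (a := 1) (b := 2) 2 (x := z) (by norm_num) hf
      (by rw [show (2 : ℝ) - 2 = 0 by norm_num, show (2 : ℝ) - 1 = 1 by norm_num]; exact zf)
    norm_num at q3
    rw [q1, q2, q3]; ring
  have wrap : ∀ p q : ℝ, 0 ≤ p → p < q → q < 2 →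
      (∃ z, z ∉ img (fun τ => C (p + τ * (q - p))) ∧ z ∉ img (fun τ => C (p + 2 - τ * (p + 2 - q))) ∧
        Odd (wd (fun τ => C (p + τ * (q - p))) (fun τ => C (p + 2 - τ * (p + 2 - q))) z)) →
      ∃ z, z ∉ img e ∧ z ∉ img f ∧ Odd (wd e f z) := by
    rintro p q hp hpq hq ⟨z, z1, z2, z3⟩
    have hz := cover p q hp hpq hq z z1 z2
    obtain ⟨y1, y2, y3⟩ := final z hz
    have := split p q hp hpq hq z hz
    rw [← y3] at this
    rw [Int.cast_injective this] at z3
    exact ⟨z, y1, y2, z3⟩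
  rcases lt_trichotomy s t with hst | hst | hst
  · apply wrap s t hs.1 hst ht.2
    have Cs := Cper s hs.1 hs.2.le
    exact maehara (a := C s) (b := C t) (by fun_prop) (by fun_prop) (by simp) (by simp [Cs]) (by simp) (by simp) hlt
      (fun τ hτ => hlo _ (bnd1 s t hs.1 hst ht.2 τ hτ).1)
      (fun τ hτ => hlo _ (bnd1 s t hs.1 hst ht.2 τ hτ).2)
      (free s t hs.1 hst ht.2).1 (free s t hs.1 hst ht.2).2
  · rw [hst] at hlt; exact absurd hlt (lt_irrefl _)
  · apply wrap t s ht.1 hst hs.2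
    have Ct := Cper t ht.1 ht.2.le
    exact maehara_rev (a := C s) (b := C t) (by fun_prop) (by fun_prop) (by simp) (by simp [Ct]) (by simp) (by simp) hlt
      (fun τ hτ => hlo _ (bnd1 t s ht.1 hst hs.2 τ hτ).1)
      (fun τ hτ => hlo _ (bnd1 t s ht.1 hst hs.2 τ hτ).2)
      (free t s ht.1 hst hs.2).1 (free t s ht.1 hst hs.2).2

end LW

namespace LW

/-! ### An arc does not separate the plane -/

theorem loop_theta {a : ℂ} {R : ℝ} (haR : ‖a‖ < R) :
    theta (fun t : ℝ => (R : ℂ) * Complex.exp (2 * Real.pi * t * Complex.I)) 0 1 a = 1 := by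
  have hR : 0 < R := (norm_nonneg a).trans_lt haR
  have hRc : (R : ℂ) ≠ 0 := by exact_mod_cast hR.ne'
  set γ : ℝ → ℂ := fun t : ℝ => (R : ℂ) * Complex.exp (2 * Real.pi * t * Complex.I) with hγ
  have hc : Continuous γ := by fun_prop
  have hnorm : ∀ t, ‖γ t‖ = R := by
    intro t
    have : (2 * Real.pi * t * Complex.I : ℂ) = ((2 * Real.pi * t : ℝ) : ℂ) * Complex.I := by push_cast; ring
    rw [hγ]; simp only
    rw [norm_mul, this, Complex.norm_exp_ofReal_mul_I]
    simp [abs_of_pos hR]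
  have h01 : γ 0 = γ 1 := by
    simp [hγ]
  have hz : theta γ 0 1 0 = 1 := by
    rw [theta_eq (L := fun t => Complex.log R + 2 * Real.pi * t * Complex.I) zero_le_one]
    · have := Real.pi_ne_zero
      simp
    · refine ⟨by fun_prop, fun t _ => ?_⟩
      rw [Complex.exp_add, Complex.exp_log hRc, sub_zero]
  have hb : Continuous fun t : ℝ => (t : ℂ) * a := by fun_prop
  have := cross_zero (α := γ) (β := fun t : ℝ => (t : ℂ) * a) (a := 0) (b := 1) (c := 0) (d := 1)
    zero_le_one zero_le_one hc hb (fun s hs t ht h => by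
      have h2 := hnorm s
      rw [h, norm_mul] at h2
      have : ‖(t : ℂ)‖ ≤ 1 := by
        rw [Complex.norm_real, Real.norm_eq_abs, abs_of_nonneg ht.1]; exact ht.2
      have := mul_le_mul_of_nonneg_right this (norm_nonneg a)
      linarith)
  rw [h01] at this
  simp at this
  linarith

theorem arc_no_sep {α : ℝ → ℂ} (hα : Continuous α) (hi : InjOn α (Icc 0 1)) {U : Set ℂ}
    (hb : Bornology.IsBounded U) (hd : ∀ x ∈ U, x ∉ img α)
    (hf : frontier U ⊆ img α) : U = ∅ := by
  classical
  by_contra hne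
  obtain ⟨a, ha⟩ := nonempty_iff_ne_empty.2 hne
  obtain ⟨L, hL⟩ := exists_lift zero_le_one hα (hd a ha)
  have hemb : Topology.IsClosedEmbedding (fun t : Icc (0 : ℝ) 1 => α t) := by
    refine Continuous.isClosedEmbedding (by fun_prop) ?_
    intro s t h
    exact Subtype.ext (hi s.2 t.2 h)
  obtain ⟨G, hG⟩ := ContinuousMap.exists_extension' hemb
    (⟨fun t : Icc (0 : ℝ) 1 => L t, continuousOn_iff_continuous_domRestrict.1 hL.1⟩ : C(Icc (0 : ℝ) 1, ℂ))
  have hG2 : ∀ t ∈ Icc (0 : ℝ) 1, G (α t) = L t := by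
    intro t ht
    exact congrFun hG ⟨t, ht⟩
  set F : ℂ → ℂ := fun z => if z ∈ U then Complex.exp (G z) else z - a with hF
  have hFc : Continuous F := by
    refine Continuous.if ?_ (by fun_prop) (by fun_prop)
    intro z hz
    obtain ⟨t, ht, rfl⟩ := hf hz
    rw [hG2 t ht, hL.2 t ht]
  have hF0 : ∀ z, F z ≠ 0 := by
    intro z
    by_cases hz : z ∈ U
    · simp [hF, hz, Complex.exp_ne_zero]
    · simp only [hF, hz, if_false]
      rw [sub_ne_zero]; rintro rfl; exact hz ha
  obtain ⟨H, hH, hH2⟩ := exists_log F hFc hF0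
  obtain ⟨R, hR⟩ := hb.exists_norm_le
  have haR := hR a ha
  have hl := loop_theta (a := a) (R := R + 1) (by linarith)
  set γ : ℝ → ℂ := fun t : ℝ => ((R + 1 : ℝ) : ℂ) * Complex.exp (2 * Real.pi * t * Complex.I) with hγ
  have hnorm : ∀ t, ‖γ t‖ = R + 1 := by
    intro t
    have : (2 * Real.pi * t * Complex.I : ℂ) = ((2 * Real.pi * t : ℝ) : ℂ) * Complex.I := by push_cast; ring
    rw [hγ]; simp only
    rw [norm_mul, this, Complex.norm_exp_ofReal_mul_I]
    rw [Complex.norm_real, Real.norm_eq_abs, abs_of_nonneg (by linarith [norm_nonneg a]), mul_one]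
  have hγc : Continuous γ := by fun_prop
  rw [theta_eq (L := fun t => H (γ t)) zero_le_one] at hl
  · have : γ 0 = γ 1 := by simp [hγ]
    rw [this] at hl
    simp at hl
  · refine ⟨(hH.comp hγc).continuousOn, fun t _ => ?_⟩
    rw [hH2]
    have : γ t ∉ U := fun h => by
      have := hR _ h
      rw [hnorm] at this; linarith
    simp [hF, this]

theorem ball_diff {p q : ℂ} {ε : ℝ} (hε : 0 < ε) (hq : q ∈ Metric.ball p ε) :
    IsPreconnected (Metric.ball p ε \ {q}) := by
  set Φ := OpenPartialHomeomorph.univBall p ε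
  have hs : Φ.source = univ := OpenPartialHomeomorph.univBall_source p ε
  have ht : Φ.target = Metric.ball p ε := OpenPartialHomeomorph.univBall_target p hε
  have hc : ContinuousOn Φ univ := hs ▸ Φ.continuousOn
  have hpre := (isConnected_compl_singleton_of_one_lt_rank (E := ℂ) (by simp)
    (Φ.symm q)).isPreconnected.image Φ (hc.mono (subset_univ _))
  convert hpre using 1
  ext z
  constructor
  · rintro ⟨h1, h2⟩
    rw [← ht] at h1
    refine ⟨Φ.symm z, fun h => h2 ?_, Φ.right_inv h1⟩
    have h' : Φ.symm z = Φ.symm q := h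
    rw [mem_singleton_iff, ← Φ.right_inv h1, h', Φ.right_inv (ht ▸ hq)]
  · rintro ⟨w, hw, rfl⟩
    have hws : w ∈ Φ.source := by rw [hs]; trivial
    refine ⟨ht ▸ Φ.map_source hws, fun h => hw ?_⟩
    have h' : Φ w = q := h
    rw [mem_singleton_iff, ← h', Φ.left_inv hws]

theorem arc_interior {α : ℝ → ℂ} (hα : Continuous α) (hi : InjOn α (Icc 0 1)) :
    interior (img α) = ∅ := by
  by_contra hne
  obtain ⟨p, hp⟩ := nonempty_iff_ne_empty.2 hne
  obtain ⟨ε, hε, hball⟩ := Metric.isOpen_iff.1 isOpen_interior p hp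
  have hball' : Metric.ball p ε ⊆ img α := hball.trans interior_subset
  -- three points
  have hinf : (Metric.ball p ε).Infinite := infinite_of_mem_nhds p (Metric.ball_mem_nhds p hε)
  set J := {t | t ∈ Icc (0 : ℝ) 1 ∧ α t ∈ Metric.ball p ε} with hJ
  have hJinf : J.Infinite := by
    intro hfin
    apply hinf
    refine (hfin.image α).subset fun z hz => ?_
    obtain ⟨t, ht, rfl⟩ := hball' hz
    exact ⟨t, ⟨ht, hz⟩, rfl⟩
  obtain ⟨S, hS, hcard⟩ := hJinf.exists_subset_card_eq 3
  obtain ⟨x1, x2, x3, m1, m2, m3, h12, h23⟩ : ∃ x1 x2 x3 : ℝ, x1 ∈ J ∧ x2 ∈ J ∧ x3 ∈ J ∧ x1 < x2 ∧ x2 < x3 := by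
    have hmono := (S.orderEmbOfFin hcard).strictMono
    have hm : ∀ i, S.orderEmbOfFin hcard i ∈ J := fun i => hS (S.orderEmbOfFin_mem hcard i)
    exact ⟨_, _, _, hm 0, hm 1, hm 2, hmono (by decide), hmono (by decide)⟩
  have hconn : IsPreconnected (Metric.ball p ε \ {α x2}) := by
    exact ball_diff hε m2.2
  have hcl1 : IsClosed (α '' Icc 0 x2) := (isCompact_Icc.image hα).isClosed
  have hcl2 : IsClosed (α '' Icc x2 1) := (isCompact_Icc.image hα).isClosed
  obtain ⟨z, hz, ⟨s, hs, hs'⟩, ⟨t, ht, ht'⟩⟩ := isPreconnected_closed_iff.1 hconn _ _ hcl1 hcl2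
    (fun z hz => by
      obtain ⟨t, ht, rfl⟩ := hball' hz.1
      rcases le_total t x2 with h | h
      · exact Or.inl ⟨t, ⟨ht.1, h⟩, rfl⟩
      · exact Or.inr ⟨t, ⟨h, ht.2⟩, rfl⟩)
    ⟨α x1, ⟨m1.2, fun h => h12.ne (hi m1.1 m2.1 h)⟩, x1, ⟨m1.1.1, h12.le⟩, rfl⟩
    ⟨α x3, ⟨m3.2, fun h => h23.ne' (hi m3.1 m2.1 h)⟩, x3, ⟨h23.le, m3.1.2⟩, rfl⟩
  have hs1 : s ∈ Icc (0 : ℝ) 1 := ⟨hs.1, hs.2.trans m2.1.2⟩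
  have ht1 : t ∈ Icc (0 : ℝ) 1 := ⟨m2.1.1.trans ht.1, ht.2⟩
  have hst := hi hs1 ht1 (hs'.trans ht'.symm)
  have : s = x2 := le_antisymm hs.2 (hst ▸ ht.1)
  exact hz.2 (by rw [← hs', this]; rfl)

end LW

namespace LW

/-! ### Families of parallel arcs -/

/-- A finite family of internally disjoint arcs from `u` to `v`. -/
structure Fam (I : Type) (γ : I → ℝ → ℂ) (u v : ℂ) : Prop where
  cont : ∀ i, Continuous (γ i)
  inj : ∀ i, InjOn (γ i) (Icc 0 1)
  zero : ∀ i, γ i 0 = u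
  one : ∀ i, γ i 1 = v
  disj : ∀ i j, i ≠ j → img (γ i) ∩ img (γ j) ⊆ {u, v}

variable {I : Type} {γ : I → ℝ → ℂ} {u v : ℂ}

theorem Fam.near (h : Fam I γ u v) (i j : I) {x : ℂ} (hi : x ∉ img (γ i)) (hj : x ∉ img (γ j)) :
    ∀ᶠ y in nhds x, wd (γ i) (γ j) y = wd (γ i) (γ j) x :=
  wd_near (h.cont i) (h.cont j) (by rw [h.zero, h.zero]) (by rw [h.one, h.one]) hi hj

theorem Fam.inside (h : Fam I γ u v) {i j : I} (hij : i ≠ j) {t : ℝ} (ht : t ∈ Ioo (0 : ℝ) 1) :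
    γ i t ∉ img (γ j) := by
  intro hm
  have htI := Ioo_subset_Icc_self ht
  rcases h.disj i j hij ⟨mem_img htI, hm⟩ with h' | h'
  · rw [← h.zero i] at h'
    exact ht.1.ne' (h.inj i htI z_mem h')
  · rw [mem_singleton_iff, ← h.one i] at h'
    have hx := h.inj i htI o_mem h'
    exact absurd hx ht.2.ne

/-- The parity of a winding number is constant along the interior of a third arc. -/
theorem Fam.along (h : Fam I γ u v) {a f g : I} (haf : a ≠ f) (hag : a ≠ g) {s t : ℝ}
    (hs : s ∈ Ioo (0 : ℝ) 1) (ht : t ∈ Ioo (0 : ℝ) 1) :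
    wd (γ f) (γ g) (γ a s) = wd (γ f) (γ g) (γ a t) := by
  refine wd_preconn (s := γ a '' Ioo 0 1) (h.cont f) (h.cont g) (by rw [h.zero, h.zero])
    (by rw [h.one, h.one]) (isPreconnected_Ioo.image _ (h.cont a).continuousOn) ?_ ?_
    ⟨s, hs, rfl⟩ ⟨t, ht, rfl⟩
  · rintro _ ⟨r, hr, rfl⟩; exact h.inside haf hr
  · rintro _ ⟨r, hr, rfl⟩; exact h.inside hag hr

theorem Fam.mem_cases (h : Fam I γ u v) {i : I} {x : ℂ} (hx : x ∈ img (γ i)) :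
    x = u ∨ x = v ∨ ∃ t ∈ Ioo (0 : ℝ) 1, γ i t = x := by
  obtain ⟨t, ht, rfl⟩ := hx
  rcases ht.1.eq_or_lt with h0 | h0
  · left; rw [← h0, h.zero]
  rcases ht.2.eq_or_lt with h1 | h1
  · right; left; rw [h1, h.one]
  · exact Or.inr (Or.inr ⟨t, ⟨h0, h1⟩, rfl⟩)

theorem Fam.ends (h : Fam I γ u v) (i : I) : u ∈ img (γ i) ∧ v ∈ img (γ i) :=
  ⟨by rw [← h.zero i]; exact mem_img z_mem, by rw [← h.one i]; exact mem_img o_mem⟩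

theorem Fam.bounded (h : Fam I γ u v) (i j : I) : ∃ R, ∀ x, R ≤ ‖x‖ → wd (γ i) (γ j) x = 0 := by
  obtain ⟨R, hR⟩ := ((img_compact (h.cont i)).union (img_compact (h.cont j))).isBounded.exists_norm_le
  refine ⟨R + 1, fun x hx => wd_far (R := R + 1) (h.cont i) (h.cont j) (by rw [h.zero, h.zero])
    (by rw [h.one, h.one]) ?_ ?_ hx⟩
  · intro z hz; have := hR z (Or.inl hz); linarith
  · intro z hz; have := hR z (Or.inr hz); linarith

theorem Fam.extremal [Finite I] [Nonempty I] (h : Fam I γ u v) :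
    ∃ a : I, ∀ f g : I, f ≠ a → g ≠ a → ∀ t ∈ Ioo (0 : ℝ) 1, Even (wd (γ f) (γ g) (γ a t)) := by
  classical
  set K := ⋃ i, img (γ i) with hK
  have hKc : IsCompact K := isCompact_iUnion fun i => img_compact (h.cont i)
  set O := {x | x ∉ K ∧ ∀ i j, Even (wd (γ i) (γ j) x)} with hO
  have nK : ∀ {x i}, x ∉ K → x ∉ img (γ i) := fun hx hi => hx (mem_iUnion.2 ⟨_, hi⟩)
  have nearall : ∀ x ∉ K, ∀ᶠ y in nhds x, y ∉ K ∧ ∀ i j, wd (γ i) (γ j) y = wd (γ i) (γ j) x := by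
    intro x hx
    refine (hKc.isClosed.isOpen_compl.eventually_mem hx).and ?_
    rw [Filter.eventually_all]; intro i
    rw [Filter.eventually_all]; intro j
    exact h.near i j (nK hx) (nK hx)
  obtain ⟨i₀⟩ := ‹Nonempty I›
  -- a frontier point off the ends
  obtain ⟨x, hxe, hxf⟩ : ∃ x, x ∉ ({u, v} : Set ℂ) ∧ x ∈ frontier O := by
    by_contra hcon
    push Not at hcon
    have hconn := ((toFinite ({u, v} : Set ℂ)).countable.isConnected_compl_of_one_lt_rank
      (E := ℂ) (by simp)).isPreconnected
    have hmid : γ i₀ (1 / 2) ∉ ({u, v} : Set ℂ) := by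
      rintro (h' | h')
      · rw [← h.zero i₀] at h'
        have := h.inj i₀ (by norm_num) z_mem h'
        norm_num at this
      · rw [mem_singleton_iff, ← h.one i₀] at h'
        have := h.inj i₀ (by norm_num) o_mem h'
        norm_num at this
    have hmidO : γ i₀ (1 / 2) ∉ O := fun h' => h'.1 (mem_iUnion.2 ⟨i₀, mem_img (by norm_num)⟩)
    -- a far point
    obtain ⟨R, hR⟩ := hKc.isBounded.exists_norm_le
    choose B hB using fun p : I × I => h.bounded p.1 p.2
    obtain ⟨M, hM⟩ := (finite_range B).bddAbove
    set y : ℂ := ((max (|R| + 1) |M| : ℝ) : ℂ) with hy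
    have hyn : ‖y‖ = max (|R| + 1) |M| := by
      rw [hy, Complex.norm_real, Real.norm_eq_abs, abs_of_nonneg]
      exact (abs_nonneg M).trans (le_max_right _ _)
    have hyK : y ∉ K := by
      intro h'
      have h1 := hR y h'
      have h2 := le_max_left (|R| + 1) |M|
      have h3 := le_abs_self R
      linarith
    have hyO : y ∈ O := by
      refine ⟨hyK, fun i j => ?_⟩
      rw [hB (i, j) y ?_]
      · exact Even.zero
      · have h1 : B (i, j) ≤ M := hM ⟨(i, j), rfl⟩
        have h2 := le_max_right (|R| + 1) |M|
        have h3 := le_abs_self M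
        linarith
    have hye : y ∉ ({u, v} : Set ℂ) := by
      rintro (h' | h')
      · exact nK hyK (h' ▸ (h.ends i₀).1)
      · rw [mem_singleton_iff] at h'; exact nK hyK (h' ▸ (h.ends i₀).2)
    have hno : ∀ z ∈ ({u, v} : Set ℂ)ᶜ, z ∈ closure O → z ∈ interior O := by
      intro z hz hc
      by_contra hi
      exact hcon z hz ⟨hc, hi⟩
    obtain ⟨z, -, hz1, hz2⟩ := hconn (interior O) (closure O)ᶜ isOpen_interior
      isClosed_closure.isOpen_compl
      (fun z hz => by
        by_cases hc : z ∈ closure O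
        · exact Or.inl (hno z hz hc)
        · exact Or.inr hc) ⟨y, hye, hno y hye (subset_closure hyO)⟩
      ⟨_, hmid, fun hc => hmidO (interior_subset (hno _ hmid hc))⟩
    exact hz2 (subset_closure (interior_subset hz1))
  have hxK : x ∈ K := by
    by_contra hx
    have hn := nearall x hx
    obtain ⟨y, hyO, hy1, hy2⟩ := ((mem_closure_iff_frequently.1 hxf.1).and_eventually hn).exists
    apply hxf.2
    rw [mem_interior_iff_mem_nhds]
    filter_upwards [hn] with z hz
    refine ⟨hz.1, fun i j => ?_⟩
    rw [hz.2, ← hy2]; exact hyO.2 i j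
  obtain ⟨a, ha⟩ := mem_iUnion.1 hxK
  have hxi : ∃ s ∈ Ioo (0 : ℝ) 1, γ a s = x := by
    rcases h.mem_cases ha with h' | h' | h'
    · exact absurd (by simp [h']) hxe
    · exact absurd (by simp [h']) hxe
    · exact h'
  obtain ⟨s, hs, rfl⟩ := hxi
  refine ⟨a, fun f g hf hg t ht => ?_⟩
  rw [h.along hf.symm hg.symm ht hs]
  have hn := h.near f g (h.inside hf.symm hs) (h.inside hg.symm hs)
  obtain ⟨y, hyO, hy⟩ := ((mem_closure_iff_frequently.1 hxf.1).and_eventually hn).exists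
  rw [← hy]; exact hyO.2 f g

theorem wd_add (e f g : ℝ → ℂ) (x : ℂ) : wd f g x = wd e g x - wd e f x := by
  simp only [wd]; ring

/-- Emptiness of a bounded region described by winding numbers. -/
theorem Fam.region (h : Fam I γ u v) {a f g k : I} (P : ℤ → ℤ → Prop)
    (hP : ∀ p q, P p q → p ≠ 0 ∨ q ≠ 0)
    (hfr : ∀ i, (i = a ∨ i = f ∨ i = g) → i ≠ k → ∀ t ∈ Ioo (0 : ℝ) 1,
      ¬ ∃ᶠ y in nhds (γ i t), P (wd (γ a) (γ f) y) (wd (γ a) (γ g) y))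
    (hk : k = a ∨ k = f ∨ k = g) {x : ℂ}
    (hxa : x ∉ img (γ a)) (hxf : x ∉ img (γ f)) (hxg : x ∉ img (γ g)) :
    ¬ P (wd (γ a) (γ f) x) (wd (γ a) (γ g) x) := by
  intro hPx
  set K := img (γ a) ∪ img (γ f) ∪ img (γ g) with hK
  set U := {x | x ∉ K ∧ P (wd (γ a) (γ f) x) (wd (γ a) (γ g) x)} with hU
  have hKc : IsCompact K :=
    ((img_compact (h.cont a)).union (img_compact (h.cont f))).union (img_compact (h.cont g))
  have hsub : ∀ i, (i = a ∨ i = f ∨ i = g) → img (γ i) ⊆ K := by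
    rintro i (rfl | rfl | rfl) z hz
    · exact Or.inl (Or.inl hz)
    · exact Or.inl (Or.inr hz)
    · exact Or.inr hz
  have hn : ∀ y ∉ K, ∀ᶠ z in nhds y, z ∉ K ∧ wd (γ a) (γ f) z = wd (γ a) (γ f) y ∧
      wd (γ a) (γ g) z = wd (γ a) (γ g) y := by
    intro y hy
    have y1 : y ∉ img (γ a) := fun h' => hy (hsub a (Or.inl rfl) h')
    have y2 : y ∉ img (γ f) := fun h' => hy (hsub f (Or.inr (Or.inl rfl)) h')
    have y3 : y ∉ img (γ g) := fun h' => hy (hsub g (Or.inr (Or.inr rfl)) h')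
    exact (hKc.isClosed.isOpen_compl.eventually_mem hy).and
      ((h.near a f y1 y2).and (h.near a g y1 y3))
  have hempty : U = ∅ := by
    refine arc_no_sep (h.cont k) (h.inj k) ?_ (fun z hz hz' => hz.1 (hsub k hk hz')) ?_
    · obtain ⟨R1, h1⟩ := h.bounded a f
      obtain ⟨R2, h2⟩ := h.bounded a g
      refine (Metric.isBounded_closedBall (x := (0 : ℂ)) (r := max R1 R2)).subset fun z hz => ?_
      rw [mem_closedBall_zero_iff]
      by_contra hcon
      push Not at hcon
      have l1 := h1 z ((le_max_left _ _).trans hcon.le)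
      have l2 := h2 z ((le_max_right _ _).trans hcon.le)
      rcases hP _ _ hz.2 with h' | h'
      · exact h' l1
      · exact h' l2
    · intro z hz
      have hzK : z ∈ K := by
        by_contra hzK
        obtain ⟨y, hyU, hy⟩ := ((mem_closure_iff_frequently.1 hz.1).and_eventually (hn z hzK)).exists
        apply hz.2
        rw [mem_interior_iff_mem_nhds]
        filter_upwards [hn z hzK] with w hw
        refine ⟨hw.1, ?_⟩
        have := hyU.2
        rw [hy.2.1, hy.2.2] at this
        rw [hw.2.1, hw.2.2]; exact this
      obtain ⟨i, hi, hzi⟩ : ∃ i, (i = a ∨ i = f ∨ i = g) ∧ z ∈ img (γ i) := by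
        rcases hzK with (h' | h') | h'
        · exact ⟨a, Or.inl rfl, h'⟩
        · exact ⟨f, Or.inr (Or.inl rfl), h'⟩
        · exact ⟨g, Or.inr (Or.inr rfl), h'⟩
      by_cases hik : i = k
      · rw [← hik]; exact hzi
      · rcases h.mem_cases hzi with h' | h' | ⟨t, ht, h'⟩
        · rw [h']; exact (h.ends k).1
        · rw [h']; exact (h.ends k).2
        · exfalso
          refine hfr i hi hik t ht ?_
          rw [h']
          exact (mem_closure_iff_frequently.1 hz.1).mono fun y hy => hy.2
  have : x ∈ U := ⟨by simp [hK, hxa, hxf, hxg], hPx⟩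
  rw [hempty] at this
  exact this

theorem Fam.chain (h : Fam I γ u v) {a f g : I}
    (ha : ∀ f g : I, f ≠ a → g ≠ a → ∀ t ∈ Ioo (0 : ℝ) 1, Even (wd (γ f) (γ g) (γ a t)))
    (hfa : f ≠ a) (hga : g ≠ a) (hfg : f ≠ g) :
    (∀ x, x ∉ img (γ a) → x ∉ img (γ f) → x ∉ img (γ g) →
      Odd (wd (γ a) (γ f) x) → Odd (wd (γ a) (γ g) x)) ∨
    (∀ x, x ∉ img (γ a) → x ∉ img (γ f) → x ∉ img (γ g) →
      Odd (wd (γ a) (γ g) x) → Odd (wd (γ a) (γ f) x)) := by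
  have m : (1 / 2 : ℝ) ∈ Ioo (0 : ℝ) 1 := by norm_num
  -- near the interior of a
  have na : ∀ t ∈ Ioo (0 : ℝ) 1, ∀ᶠ y in nhds (γ a t),
      (Odd (wd (γ a) (γ f) y) ↔ Odd (wd (γ a) (γ g) y)) := by
    intro t ht
    filter_upwards [h.near f g (h.inside hfa.symm ht) (h.inside hga.symm ht)] with y hy
    have := ha f g hfa hga t ht
    rw [← hy, wd_add (γ a), Int.even_sub'] at this
    exact this.symm
  have nf : ∀ t ∈ Ioo (0 : ℝ) 1, ∀ᶠ y in nhds (γ f t),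
      wd (γ a) (γ g) y = wd (γ a) (γ g) (γ f (1 / 2)) := by
    intro t ht
    filter_upwards [h.near a g (h.inside hfa ht) (h.inside hfg ht)] with y hy
    rw [hy, h.along hfa hfg ht m]
  have ng : ∀ t ∈ Ioo (0 : ℝ) 1, ∀ᶠ y in nhds (γ g t),
      wd (γ a) (γ f) y = wd (γ a) (γ f) (γ g (1 / 2)) := by
    intro t ht
    filter_upwards [h.near a f (h.inside hga ht) (h.inside hfg.symm ht)] with y hy
    rw [hy, h.along hga hfg.symm ht m]
  by_cases c1 : Odd (wd (γ a) (γ g) (γ f (1 / 2)))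
  · left
    intro x xa xf xg ho
    by_contra hno
    refine h.region (a := a) (f := f) (g := g) (k := g) (fun p q => Odd p ∧ ¬ Odd q) ?_ ?_
      (Or.inr (Or.inr rfl)) xa xf xg ⟨ho, hno⟩
    · rintro p q ⟨hp, -⟩; left; rintro rfl; simp at hp
    · rintro i (rfl | rfl | rfl) hik t ht hfq
      · obtain ⟨y, ⟨y1, y2⟩, y3⟩ := (hfq.and_eventually (na t ht)).exists
        exact y2 (y3.1 y1)
      · obtain ⟨y, ⟨y1, y2⟩, y3⟩ := (hfq.and_eventually (nf t ht)).exists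
        exact y2 (y3 ▸ c1)
      · exact hik rfl
  by_cases c2 : Odd (wd (γ a) (γ f) (γ g (1 / 2)))
  · right
    intro x xa xf xg ho
    by_contra hno
    refine h.region (a := a) (f := f) (g := g) (k := g) (fun p q => Odd q ∧ ¬ Odd p) ?_ ?_
      (Or.inr (Or.inr rfl)) xa xf xg ⟨ho, hno⟩
    · rintro p q ⟨hp, -⟩; right; rintro rfl; simp at hp
    · rintro i (rfl | rfl | rfl) hik t ht hfq
      · obtain ⟨y, ⟨y1, y2⟩, y3⟩ := (hfq.and_eventually (na t ht)).exists
        exact y2 (y3.2 y1)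
      · obtain ⟨y, ⟨y1, y2⟩, y3⟩ := (hfq.and_eventually (nf t ht)).exists
        exact c1 (y3 ▸ y1)
      · exact hik rfl
  · left
    intro x xa xf xg ho
    by_contra hno
    refine h.region (a := a) (f := f) (g := g) (k := f) (fun p q => Odd p ∧ ¬ Odd q) ?_ ?_
      (Or.inr (Or.inl rfl)) xa xf xg ⟨ho, hno⟩
    · rintro p q ⟨hp, -⟩; left; rintro rfl; simp at hp
    · rintro i (rfl | rfl | rfl) hik t ht hfq
      · obtain ⟨y, ⟨y1, y2⟩, y3⟩ := (hfq.and_eventually (na t ht)).exists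
        exact y2 (y3.1 y1)
      · exact hik rfl
      · obtain ⟨y, ⟨y1, y2⟩, y3⟩ := (hfq.and_eventually (ng t ht)).exists
        exact c2 (y3 ▸ y1)

theorem Fam.odd_vertex [Finite I] (h : Fam I γ u v) {V : Finset ℂ}
    (hlens : ∀ z ∉ ⋃ i, img (γ i), Bornology.IsBounded (connectedComponentIn (⋃ i, img (γ i))ᶜ z) →
      ∃ x ∈ V, x ∈ connectedComponentIn (⋃ i, img (γ i))ᶜ z) {f g : I} (hfg : f ≠ g) :
    ∃ x ∈ V, (∀ i, x ∉ img (γ i)) ∧ Odd (wd (γ f) (γ g) x) := by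
  obtain ⟨z, z1, z2, z3⟩ := exists_odd_wd (h.cont f) (h.cont g) (h.inj f) (h.inj g)
    (by rw [h.zero, h.zero]) (by rw [h.one, h.one])
    (by rw [h.zero, h.one]; exact h.disj f g hfg)
  have hdense : Dense (⋂ i, (img (γ i))ᶜ) :=
    dense_iInter_of_isOpen (fun i => (img_compact (h.cont i)).isClosed.isOpen_compl)
      (fun i => interior_eq_empty_iff_dense_compl.1 (arc_interior (h.cont i) (h.inj i)))
  obtain ⟨w, hw, hwK⟩ : ∃ w, wd (γ f) (γ g) w = wd (γ f) (γ g) z ∧ w ∈ ⋂ i, (img (γ i))ᶜ := by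
    have hn := h.near f g z1 z2
    obtain ⟨U, hU, hUo, hzU⟩ := eventually_nhds_iff.1 hn
    obtain ⟨w, hw1, hw2⟩ := hdense.inter_open_nonempty U hUo ⟨z, hzU⟩
    exact ⟨w, hU w hw1, hw2⟩
  rw [← hw] at z3
  set K := ⋃ i, img (γ i) with hK
  have hwK' : w ∈ Kᶜ := by rw [hK, compl_iUnion]; exact hwK
  have nK : ∀ {x i}, x ∈ Kᶜ → x ∉ img (γ i) := fun hx hi => hx (mem_iUnion.2 ⟨_, hi⟩)
  have hconst : ∀ x ∈ connectedComponentIn Kᶜ w, wd (γ f) (γ g) x = wd (γ f) (γ g) w := by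
    intro x hx
    exact wd_preconn (h.cont f) (h.cont g) (by rw [h.zero, h.zero]) (by rw [h.one, h.one])
      isPreconnected_connectedComponentIn
      (fun y hy => nK (connectedComponentIn_subset _ _ hy))
      (fun y hy => nK (connectedComponentIn_subset _ _ hy)) hx (mem_connectedComponentIn hwK')
  obtain ⟨R, hR⟩ := h.bounded f g
  obtain ⟨x, hxV, hx⟩ := hlens w hwK' (by
    refine (Metric.isBounded_closedBall (x := (0 : ℂ)) (r := R)).subset fun y hy => ?_
    rw [mem_closedBall_zero_iff]
    by_contra hcon
    push Not at hcon
    have h1 := hR y hcon.le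
    rw [hconst y hy] at h1
    rw [h1] at z3
    simp at z3)
  refine ⟨x, hxV, fun i => nK (connectedComponentIn_subset _ _ hx), ?_⟩
  rw [hconst x hx]; exact z3

/-- Abstract chain decomposition. -/
theorem chain_pred {I α : Type} [Finite I] [DecidableEq α] (X : I → Finset α)
    (hX : Function.Injective X) (hch : ∀ f g, X f ⊆ X g ∨ X g ⊆ X f) (a : I) (ha : X a = ∅) :
    ∃ pred : I → I, (∀ f, f ≠ a → X (pred f) ⊆ X f ∧ (X f \ X (pred f)).Nonempty) ∧
      ∀ f g, f ≠ a → g ≠ a → f ≠ g → Disjoint (X f \ X (pred f)) (X g \ X (pred g)) := by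
  classical
  have hex : ∀ f, ∃ p, f ≠ a → X p ⊂ X f ∧ ∀ g, X g ⊂ X f → (X g).card ≤ (X p).card := by
    intro f
    by_cases hf : f = a
    · exact ⟨a, fun h => absurd hf h⟩
    · have hne : ({g | X g ⊂ X f} : Set I).Nonempty := by
        refine ⟨a, ?_⟩
        have : X a ≠ X f := fun h => hf (hX h).symm
        exact lt_of_le_of_ne (by rw [ha]; exact Finset.empty_subset _) this
      obtain ⟨p, hp, hmax⟩ := (toFinite {g | X g ⊂ X f}).exists_maximalFor (fun g => (X g).card) _ hne
      refine ⟨p, fun _ => ⟨hp, fun g hg => ?_⟩⟩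
      by_contra hcon
      push Not at hcon
      exact absurd (hmax hg hcon.le) (not_le.2 hcon)
  choose pred hpred using hex
  have main : ∀ f g, f ≠ a → g ≠ a → f ≠ g → X f ⊆ X g →
      Disjoint (X f \ X (pred f)) (X g \ X (pred g)) := by
    intro f g hf hg hfg hsub
    have hss : X f ⊂ X g := lt_of_le_of_ne hsub fun h => hfg (hX h)
    have hcard := (hpred g hg).2 f hss
    have hle : X f ⊆ X (pred g) := by
      rcases hch f (pred g) with h | h
      · exact h
      · rw [Finset.eq_of_subset_of_card_le h hcard]
    rw [Finset.disjoint_left]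
    intro x hx hx2
    exact (Finset.mem_sdiff.1 hx2).2 (hle (Finset.mem_sdiff.1 hx).1)
  refine ⟨pred, fun f hf => ⟨(hpred f hf).1.subset, ?_⟩, fun f g hf hg hfg => ?_⟩
  · rw [Finset.sdiff_nonempty]; exact (hpred f hf).1.not_subset
  · rcases hch f g with h | h
    · exact main f g hf hg hfg h
    · exact (main g f hg hf hfg.symm h).symm

theorem Fam.decomp [Finite I] [Nonempty I] (h : Fam I γ u v) {V : Finset ℂ}
    (hV : ∀ i, ∀ x ∈ V, x ∈ img (γ i) → x = u ∨ x = v)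
    (hlens : ∀ z ∉ ⋃ i, img (γ i), Bornology.IsBounded (connectedComponentIn (⋃ i, img (γ i))ᶜ z) →
      ∃ x ∈ V, x ∈ connectedComponentIn (⋃ i, img (γ i))ᶜ z) :
    ∃ (a : I) (pred : I → I) (D : I → Finset ℂ),
      (∀ f, f ≠ a → (D f).Nonempty ∧ ∀ x, x ∈ D f ↔ x ∈ V ∧ x ≠ u ∧ x ≠ v ∧
        Odd (wd (γ f) (γ (pred f)) x)) ∧
      ∀ f g, f ≠ a → g ≠ a → f ≠ g → Disjoint (D f) (D g) := by
  classical
  obtain ⟨a, ha⟩ := h.extremal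
  set X : I → Finset ℂ := fun f => V.filter fun x => x ≠ u ∧ x ≠ v ∧ Odd (wd (γ a) (γ f) x) with hX
  have memX : ∀ f x, x ∈ X f ↔ x ∈ V ∧ x ≠ u ∧ x ≠ v ∧ Odd (wd (γ a) (γ f) x) := by
    intro f x; simp [hX]
  have nimg : ∀ {x}, x ∈ V → x ≠ u → x ≠ v → ∀ i, x ∉ img (γ i) := by
    intro x h1 h2 h3 i h4
    rcases hV i x h1 h4 with h5 | h5
    · exact h2 h5
    · exact h3 h5
  have Xa : X a = ∅ := by
    ext x; simp [memX, wd]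
  have hinj : Function.Injective X := by
    intro f g hXfg
    by_contra hfg
    obtain ⟨x, hxV, hxn, hodd⟩ := h.odd_vertex hlens hfg
    have hu : x ≠ u := fun h' => hxn f (h' ▸ (h.ends f).1)
    have hv : x ≠ v := fun h' => hxn f (h' ▸ (h.ends f).2)
    rw [wd_add (γ a), Int.odd_sub] at hodd
    have h1 : x ∈ X f ↔ x ∈ X g := by rw [hXfg]
    rw [memX, memX] at h1
    simp only [hxV, hu, hv, ne_eq, not_false_eq_true, true_and] at h1
    rw [← h1, ← Int.not_even_iff_odd] at hodd
    exact absurd hodd (by tauto)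
  have hch : ∀ f g, X f ⊆ X g ∨ X g ⊆ X f := by
    intro f g
    by_cases hfa : f = a
    · left; rw [hfa, Xa]; exact Finset.empty_subset _
    by_cases hga : g = a
    · right; rw [hga, Xa]; exact Finset.empty_subset _
    by_cases hfg : f = g
    · left; rw [hfg]
    rcases h.chain ha hfa hga hfg with h' | h'
    · left; intro x hx
      rw [memX] at hx ⊢
      have n := nimg hx.1 hx.2.1 hx.2.2.1
      exact ⟨hx.1, hx.2.1, hx.2.2.1, h' x (n _) (n _) (n _) hx.2.2.2⟩
    · right; intro x hx
      rw [memX] at hx ⊢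
      have n := nimg hx.1 hx.2.1 hx.2.2.1
      exact ⟨hx.1, hx.2.1, hx.2.2.1, h' x (n _) (n _) (n _) hx.2.2.2⟩
  obtain ⟨pred, hp1, hp2⟩ := chain_pred X hinj hch a Xa
  refine ⟨a, pred, fun f => X f \ X (pred f), fun f hf => ⟨(hp1 f hf).2, fun x => ?_⟩, hp2⟩
  have hsub := (hp1 f hf).1
  rw [Finset.mem_sdiff]
  have h1 : x ∈ X (pred f) → x ∈ X f := fun h' => hsub h'
  rw [memX, memX] at h1 ⊢
  rw [wd_add (γ a) (γ f) (γ (pred f)), Int.odd_sub]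
  simp only [← Int.not_even_iff_odd] at h1 ⊢
  clear hsub hp1 hp2 hch hinj nimg memX ha hlens hV
  generalize Even (wd (γ a) (γ f) x) = A at h1 ⊢
  generalize Even (wd (γ a) (γ (pred f)) x) = B at h1 ⊢
  generalize (x ∈ V) = P at h1 ⊢
  generalize (x ≠ u) = Q at h1 ⊢
  generalize (x ≠ v) = R at h1 ⊢
  by_cases hA : A <;> by_cases hB : B <;> simp only [hA, hB] at h1 ⊢ <;> tauto

end LW

namespace LW

/-! ### Dense graphs contain a complete minor on five vertices -/

section Minor

variable {V : Type} [DecidableEq V] (Adj : V → V → Prop)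

/-- There is a walk from `x` to `y` inside `B`. -/
def Linked (B : Finset V) (x y : V) : Prop :=
  ∃ l : List (V × V), (∀ d ∈ l, Adj d.1 d.2 ∧ d.1 ∈ B ∧ d.2 ∈ B) ∧
    ∀ g : V → ZMod 2, (l.map fun d => g d.1 + g d.2).sum = g x + g y

theorem two_mul_zmod (a : ZMod 2) : a + a = 0 := CharTwo.add_self_eq_zero a

variable {Adj}

theorem Linked.refl (B : Finset V) (x : V) : Linked Adj B x x :=
  ⟨[], by simp, fun g => by simp [two_mul_zmod]⟩

theorem Linked.symm {B : Finset V} {x y : V} (h : Linked Adj B x y) : Linked Adj B y x := by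
  obtain ⟨l, h1, h2⟩ := h
  exact ⟨l, h1, fun g => by rw [h2, add_comm]⟩

theorem Linked.trans {B : Finset V} {x y z : V} (h : Linked Adj B x y) (h' : Linked Adj B y z) :
    Linked Adj B x z := by
  obtain ⟨l, h1, h2⟩ := h
  obtain ⟨m, h3, h4⟩ := h'
  refine ⟨l ++ m, ?_, fun g => ?_⟩
  · intro d hd
    rcases List.mem_append.1 hd with h | h
    · exact h1 d h
    · exact h3 d h
  · rw [List.map_append, List.sum_append, h2, h4]
    have := two_mul_zmod (g y)
    linear_combination this

theorem Linked.mono {B C : Finset V} (hBC : B ⊆ C) {x y : V} (h : Linked Adj B x y) :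
    Linked Adj C x y := by
  obtain ⟨l, h1, h2⟩ := h
  exact ⟨l, fun d hd => ⟨(h1 d hd).1, hBC (h1 d hd).2.1, hBC (h1 d hd).2.2⟩, h2⟩

theorem Linked.edge {B : Finset V} {x y : V} (h : Adj x y) (hx : x ∈ B) (hy : y ∈ B) :
    Linked Adj B x y :=
  ⟨[(x, y)], by simp [h, hx, hy], fun g => by simp⟩

variable (Adj) in
/-- Blocks are nonempty and connected. -/
def IsBlock (B : Finset V) : Prop := B.Nonempty ∧ ∀ x ∈ B, ∀ y ∈ B, Linked Adj B x y

variable (Adj) in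
/-- Adjacency of blocks. -/
def BAdj (X Y : Finset V) : Prop := X ≠ Y ∧ ∃ x ∈ X, ∃ y ∈ Y, Adj x y

variable (Adj) in
/-- A system of disjoint blocks. -/
def IsSys (P : Finset (Finset V)) : Prop :=
  (∀ X ∈ P, IsBlock Adj X) ∧ ∀ X ∈ P, ∀ Y ∈ P, X ≠ Y → Disjoint X Y

open Classical in
variable (Adj) in
/-- Twice the number of adjacent pairs. -/
noncomputable def E2 (P : Finset (Finset V)) : ℕ :=
  ∑ X ∈ P, ∑ Y ∈ P, if BAdj Adj X Y then 1 else 0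

theorem badj_symm (hs : ∀ x y, Adj x y → Adj y x) {X Y : Finset V} (h : BAdj Adj X Y) :
    BAdj Adj Y X := by
  obtain ⟨h0, x, hx, y, hy, h⟩ := h
  exact ⟨h0.symm, y, hy, x, hx, hs _ _ h⟩

open Classical in
theorem E2_insert (hs : ∀ x y, Adj x y → Adj y x) {X : Finset V} {P : Finset (Finset V)}
    (hX : X ∉ P) :
    E2 Adj (insert X P) = E2 Adj P + 2 * ∑ Y ∈ P, if BAdj Adj X Y then 1 else 0 := by
  unfold E2
  rw [Finset.sum_insert hX, Finset.sum_insert hX]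
  have h1 : ∀ Z ∈ P, (∑ Y ∈ insert X P, if BAdj Adj Z Y then 1 else 0) =
      (if BAdj Adj X Z then 1 else 0) + ∑ Y ∈ P, if BAdj Adj Z Y then 1 else 0 := by
    intro Z _
    rw [Finset.sum_insert hX]
    congr 1
    have : BAdj Adj Z X ↔ BAdj Adj X Z := ⟨badj_symm hs, badj_symm hs⟩
    simp only [this]
  rw [Finset.sum_congr rfl h1, Finset.sum_add_distrib]
  have h2 : ¬ BAdj Adj X X := fun h => h.1 rfl
  simp only [h2, if_false]
  ring

/-- Merging two adjacent blocks. -/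
theorem merge_block {X Y : Finset V} (hs : ∀ x y, Adj x y → Adj y x) (hX : IsBlock Adj X)
    (hY : IsBlock Adj Y) (h : BAdj Adj X Y) : IsBlock Adj (X ∪ Y) := by
  obtain ⟨-, x, hx, y, hy, hxy⟩ := h
  refine ⟨hX.1.mono Finset.subset_union_left, ?_⟩
  have toX : ∀ z ∈ X ∪ Y, Linked Adj (X ∪ Y) z x := by
    intro z hz
    rcases Finset.mem_union.1 hz with hz | hz
    · exact (hX.2 z hz x hx).mono Finset.subset_union_left
    · exact ((hY.2 z hz y hy).mono Finset.subset_union_right).trans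
        (Linked.edge (hs _ _ hxy) (Finset.mem_union_right _ hy) (Finset.mem_union_left _ hx))
  intro a ha b hb
  exact (toX a ha).trans (toX b hb).symm

variable (Adj) in
/-- A complete minor with `t` branch sets inside the union of the blocks of `P`, each branch set
containing a block. -/
def Model (t : ℕ) (P : Finset (Finset V)) : Prop :=
  ∃ B : Fin t → Finset V,
    (∀ i, IsBlock Adj (B i) ∧ B i ⊆ P.biUnion id ∧ ∃ Z ∈ P, Z ⊆ B i) ∧
    ∀ i j, i ≠ j → Disjoint (B i) (B j) ∧ BAdj Adj (B i) (B j)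

variable (Adj) in
/-- The statement that edge density `d` forces a complete minor with `t` branch sets. -/
def MinorStep (d t : ℕ) : Prop :=
  ∀ P : Finset (Finset V), IsSys Adj P → P.Nonempty → d * P.card ≤ E2 Adj P →
    Model Adj t P

theorem minor_one : MinorStep Adj 0 1 := by
  intro P hP hne _
  obtain ⟨X, hX⟩ := hne
  refine ⟨fun _ => X, fun _ => ⟨hP.1 X hX, ?_, X, hX, subset_rfl⟩, fun i j h => absurd (Subsingleton.elim i j) h⟩
  exact Finset.subset_biUnion_of_mem id hX

open Classical in
theorem minor_succ (hs : ∀ x y, Adj x y → Adj y x) {d d' t : ℕ} (hd : 1 ≤ d) (hdd : 2 * d' ≤ d)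
    (ih : MinorStep Adj d' t) : MinorStep Adj d (t + 1) := by
  intro P₀
  induction hn : P₀.card using Nat.strong_induction_on generalizing P₀ with
  | _ n IH =>
  intro hP hne hE
  -- an adjacent pair
  have hcardpos : 0 < P₀.card := hne.card_pos
  have hpos : 0 < E2 Adj P₀ := by
    have : 1 * 1 ≤ d * n := Nat.mul_le_mul hd (by omega)
    omega
  obtain ⟨X, hX, Y₀, hY₀, hXY₀⟩ : ∃ X ∈ P₀, ∃ Y ∈ P₀, BAdj Adj X Y := by
    by_contra hcon
    push Not at hcon
    have : E2 Adj P₀ = 0 := by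
      unfold E2
      refine Finset.sum_eq_zero fun X hX => Finset.sum_eq_zero fun Y hY => ?_
      simp [hcon X hX Y hY]
    omega
  set N := P₀.filter fun Z => BAdj Adj X Z with hN
  have hNP : N ⊆ P₀ := Finset.filter_subset _ _
  by_cases hmerge : ∃ Y ∈ N, (∑ Z ∈ N, if BAdj Adj Y Z then 1 else 0) < d'
  · obtain ⟨Y, hYN, hlt⟩ := hmerge
    obtain ⟨hY, hXY⟩ := Finset.mem_filter.1 hYN
    set Q := (P₀.erase X).erase Y with hQ
    have hYe : Y ∈ P₀.erase X := Finset.mem_erase.2 ⟨hXY.1.symm, hY⟩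
    have hQP : Q ⊆ P₀ := (Finset.erase_subset _ _).trans (Finset.erase_subset _ _)
    have hYQ : Y ∉ Q := Finset.notMem_erase _ _
    have hXQ : X ∉ insert Y Q := by
      rw [hQ, Finset.insert_erase hYe]; exact Finset.notMem_erase _ _
    have hP0 : P₀ = insert X (insert Y Q) := by
      rw [hQ, Finset.insert_erase hYe, Finset.insert_erase hX]
    have hXnQ : X ∉ Q := fun h => hXQ (Finset.mem_insert_of_mem h)
    have hWQ : X ∪ Y ∉ Q := by
      intro h
      have hWX : X ∪ Y ≠ X := by
        intro h'
        rw [h'] at h; exact hXnQ h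
      have := hP.2 _ (hQP h) X hX hWX
      obtain ⟨x, hx⟩ := (hP.1 X hX).1
      exact Finset.disjoint_left.1 this (Finset.mem_union_left _ hx) hx
    have hcardQ : P₀.card = Q.card + 2 := by
      rw [hP0, Finset.card_insert_of_notMem hXQ, Finset.card_insert_of_notMem hYQ]
    have hcardW : (insert (X ∪ Y) Q).card = Q.card + 1 := Finset.card_insert_of_notMem hWQ
    have hdisjQ : ∀ Z ∈ Q, Disjoint X Z ∧ Disjoint Y Z := by
      intro Z hZ
      exact ⟨hP.2 X hX Z (hQP hZ) (fun h => hXnQ (h ▸ hZ)),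
        hP.2 Y hY Z (hQP hZ) (fun h => hYQ (h ▸ hZ))⟩
    have hsys : IsSys Adj (insert (X ∪ Y) Q) := by
      constructor
      · intro Z hZ
        rcases Finset.mem_insert.1 hZ with rfl | hZ
        · exact merge_block hs (hP.1 X hX) (hP.1 Y hY) hXY
        · exact hP.1 Z (hQP hZ)
      · intro Z hZ Z' hZ' hne'
        rcases Finset.mem_insert.1 hZ with rfl | hZ <;> rcases Finset.mem_insert.1 hZ' with rfl | hZ'
        · exact absurd rfl hne'
        · exact Finset.disjoint_union_left.2 (hdisjQ Z' hZ')
        · exact (Finset.disjoint_union_left.2 (hdisjQ Z hZ)).symm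
        · exact hP.2 Z (hQP hZ) Z' (hQP hZ') hne'
    have hE2 : d * (insert (X ∪ Y) Q).card ≤ E2 Adj (insert (X ∪ Y) Q) := by
      have e1 : E2 Adj P₀ = E2 Adj Q + 2 * (∑ Z ∈ Q, if BAdj Adj Y Z then 1 else 0) +
          2 * (1 + ∑ Z ∈ Q, if BAdj Adj X Z then 1 else 0) := by
        conv_lhs => rw [hP0]
        rw [E2_insert hs hXQ, E2_insert hs hYQ, Finset.sum_insert hYQ]
        simp [hXY]
      have e2 := E2_insert hs hWQ
      have e3 : (∑ Z ∈ Q, if BAdj Adj X Z then 1 else 0) + (∑ Z ∈ Q, if BAdj Adj Y Z then 1 else 0)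
          ≤ (∑ Z ∈ Q, if BAdj Adj (X ∪ Y) Z then 1 else 0) +
            ∑ Z ∈ Q, if BAdj Adj X Z ∧ BAdj Adj Y Z then 1 else 0 := by
        rw [← Finset.sum_add_distrib, ← Finset.sum_add_distrib]
        refine Finset.sum_le_sum fun Z hZ => ?_
        have hWZ : X ∪ Y ≠ Z := fun h => hWQ (h ▸ hZ)
        have i1 : BAdj Adj X Z → BAdj Adj (X ∪ Y) Z := by
          rintro ⟨-, x, hx, z, hz, h⟩
          exact ⟨hWZ, x, Finset.mem_union_left _ hx, z, hz, h⟩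
        have i2 : BAdj Adj Y Z → BAdj Adj (X ∪ Y) Z := by
          rintro ⟨-, x, hx, z, hz, h⟩
          exact ⟨hWZ, x, Finset.mem_union_right _ hx, z, hz, h⟩
        by_cases a1 : BAdj Adj X Z <;> by_cases a2 : BAdj Adj Y Z
        · simp [a1, a2, i1 a1]
        · simp [a1, a2, i1 a1]
        · simp [a1, a2, i2 a2]
        · simp [a1, a2]
      have e4 : (∑ Z ∈ Q, if BAdj Adj X Z ∧ BAdj Adj Y Z then 1 else 0) ≤
          ∑ Z ∈ N, if BAdj Adj Y Z then 1 else 0 := by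
        rw [hN, Finset.sum_filter]
        calc _ = ∑ Z ∈ Q, (if BAdj Adj X Z then (if BAdj Adj Y Z then 1 else 0) else 0) := by
              refine Finset.sum_congr rfl fun Z _ => ?_
              by_cases a1 : BAdj Adj X Z <;> by_cases a2 : BAdj Adj Y Z <;> simp [a1, a2]
          _ ≤ _ := Finset.sum_le_sum_of_subset hQP
      rw [hcardW]
      have hn' : n = Q.card + 2 := by omega
      rw [hn', show d * (Q.card + 2) = d * (Q.card + 1) + d by ring] at hE
      omega
    have := IH (insert (X ∪ Y) Q).card (by omega) (insert (X ∪ Y) Q) rfl hsys ⟨_, Finset.mem_insert_self _ _⟩ hE2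
    obtain ⟨B, h1, h2⟩ := this
    refine ⟨B, fun i => ⟨(h1 i).1, (h1 i).2.1.trans ?_, ?_⟩, h2⟩
    swap
    · obtain ⟨Z, hZ, hZB⟩ := (h1 i).2.2
      rcases Finset.mem_insert.1 hZ with rfl | hZ
      · exact ⟨X, hX, Finset.subset_union_left.trans hZB⟩
      · exact ⟨Z, hQP hZ, hZB⟩
    intro z hz
    rw [Finset.mem_biUnion] at hz ⊢
    obtain ⟨Z, hZ, hz⟩ := hz
    rcases Finset.mem_insert.1 hZ with rfl | hZ
    · rcases Finset.mem_union.1 hz with h | h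
      · exact ⟨X, hX, h⟩
      · exact ⟨Y, hY, h⟩
    · exact ⟨Z, hQP hZ, hz⟩
  · push Not at hmerge
    have hNsys : IsSys Adj N :=
      ⟨fun Z hZ => hP.1 Z (hNP hZ), fun Z hZ Z' hZ' => hP.2 Z (hNP hZ) Z' (hNP hZ')⟩
    have hNne : N.Nonempty := ⟨Y₀, Finset.mem_filter.2 ⟨hY₀, hXY₀⟩⟩
    have hNE : d' * N.card ≤ E2 Adj N := by
      unfold E2
      rw [mul_comm, ← smul_eq_mul]
      exact Finset.card_nsmul_le_sum _ _ _ hmerge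
    obtain ⟨B, h1, h2⟩ := ih N hNsys hNne hNE
    -- every branch set touches X
    have hXB : ∀ i, Disjoint X (B i) := by
      intro i
      rw [Finset.disjoint_left]
      intro x hx hxB
      obtain ⟨Z, hZ, hz⟩ := Finset.mem_biUnion.1 ((h1 i).2.1 hxB)
      have hXZ := (Finset.mem_filter.1 hZ).2
      exact Finset.disjoint_left.1 (hP.2 X hX Z (hNP hZ) hXZ.1) hx hz
    have hadj : ∀ i, BAdj Adj X (B i) := by
      intro i
      obtain ⟨Z, hZ, hZB⟩ := (h1 i).2.2
      obtain ⟨-, x, hx, z, hz, hxz⟩ := (Finset.mem_filter.1 hZ).2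
      refine ⟨?_, x, hx, z, hZB hz, hxz⟩
      intro h
      exact Finset.disjoint_left.1 (hXB i) hx (h ▸ hx)
    refine ⟨Fin.cons X B, ?_, ?_⟩
    · intro i
      refine Fin.cases ?_ ?_ i
      · exact ⟨hP.1 X hX, Finset.subset_biUnion_of_mem id hX, X, hX, subset_rfl⟩
      · intro i
        simp only [Fin.cons_succ]
        obtain ⟨Z, hZ, hZB⟩ := (h1 i).2.2
        exact ⟨(h1 i).1, (h1 i).2.1.trans (Finset.biUnion_subset_biUnion_of_subset_left _ hNP),
          Z, hNP hZ, hZB⟩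
    · intro i j
      refine Fin.cases ?_ (fun i => ?_) i <;> refine Fin.cases ?_ (fun j => ?_) j
      · intro h; exact absurd rfl h
      · intro _; exact ⟨hXB j, hadj j⟩
      · intro _; exact ⟨(hXB i).symm, badj_symm hs (hadj i)⟩
      · intro h
        exact h2 i j (fun h' => h (by rw [h']))

theorem minor_five (hs : ∀ x y, Adj x y → Adj y x) : MinorStep Adj 8 5 :=
  minor_succ hs (by norm_num) (by norm_num : 2 * 4 ≤ 8)
    (minor_succ hs (by norm_num) (by norm_num : 2 * 2 ≤ 4)
      (minor_succ hs (by norm_num) (by norm_num : 2 * 1 ≤ 2)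
        (minor_succ hs (by norm_num) (by norm_num : 2 * 0 ≤ 1) minor_one)))

end Minor

end LW

namespace LW

/-! ### Edge bounds from parity equations -/

section Parity

variable {V : Type}

theorem path_eq (o : V → V → ZMod 2) (D : V → V → V → ZMod 2) (l m : List (V × V)) (a b c d : V)
    (hl : ∀ g : V → ZMod 2, (l.map fun p => g p.1 + g p.2).sum = g a + g b)
    (hm : ∀ g : V → ZMod 2, (m.map fun p => g p.1 + g p.2).sum = g c + g d)
    (h : ∀ p ∈ l, ∀ q ∈ m, o p.1 q.1 + o p.1 q.2 + o p.2 q.1 + o p.2 q.2 + D p.1 p.2 q.1 +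
      D p.1 p.2 q.2 + D q.1 q.2 p.1 + D q.1 q.2 p.2 = 0) :
    o a c + o a d + o b c + o b d + (l.map fun p => D p.1 p.2 c).sum +
      (l.map fun p => D p.1 p.2 d).sum + (m.map fun q => D q.1 q.2 a).sum +
      (m.map fun q => D q.1 q.2 b).sum = 0 := by
  set F : V → ZMod 2 := fun x => (m.map fun q => D q.1 q.2 x).sum with hF
  have h1 : ∀ p ∈ l, (o p.1 c + o p.1 d + F p.1) + (o p.2 c + o p.2 d + F p.2) +
      (D p.1 p.2 c + D p.1 p.2 d) = 0 := by
    intro p hp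
    have e := hm (fun z => o p.1 z + o p.2 z + D p.1 p.2 z)
    have e2 : (m.map fun q => (o p.1 q.1 + o p.2 q.1 + D p.1 p.2 q.1) +
        (o p.1 q.2 + o p.2 q.2 + D p.1 p.2 q.2) + (D q.1 q.2 p.1 + D q.1 q.2 p.2)).sum = 0 := by
      apply List.sum_eq_zero
      intro x hx
      obtain ⟨q, hq, rfl⟩ := List.mem_map.1 hx
      rw [← h p hp q hq]; ring
    rw [List.sum_map_add, e, List.sum_map_add] at e2
    simp only [hF]
    rw [← e2]; ring
  have h2 : (l.map fun p => (o p.1 c + o p.1 d + F p.1) + (o p.2 c + o p.2 d + F p.2) +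
      (D p.1 p.2 c + D p.1 p.2 d)).sum = 0 := by
    apply List.sum_eq_zero
    intro x hx
    obtain ⟨q, hq, rfl⟩ := List.mem_map.1 hx
    exact h1 q hq
  have e := hl (fun x => o x c + o x d + F x)
  rw [List.sum_map_add, e, List.sum_map_add] at h2
  rw [← h2]; simp only [hF]; ring

theorem five_contra (o : Fin 5 → Fin 5 → ZMod 2) (ho : ∀ x y, x ≠ y → o x y + o y x = 1)
    (D : Fin 5 → Fin 5 → Fin 5 → ZMod 2)
    (h : ∀ i j k l : Fin 5, i < j → k < l → i ≠ k → i ≠ l → j ≠ k → j ≠ l →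
      o i k + o i l + o j k + o j l + D i j k + D i j l + D k l i + D k l j = 0) : False := by
  have a1 := h 0 1 2 3 (by decide) (by decide) (by decide) (by decide) (by decide) (by decide)
  have a2 := h 0 1 2 4 (by decide) (by decide) (by decide) (by decide) (by decide) (by decide)
  have a3 := h 0 1 3 4 (by decide) (by decide) (by decide) (by decide) (by decide) (by decide)
  have a4 := h 0 2 1 3 (by decide) (by decide) (by decide) (by decide) (by decide) (by decide)
  have a5 := h 0 2 1 4 (by decide) (by decide) (by decide) (by decide) (by decide) (by decide)
  have a6 := h 0 2 3 4 (by decide) (by decide) (by decide) (by decide) (by decide) (by decide)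
  have a7 := h 0 3 1 2 (by decide) (by decide) (by decide) (by decide) (by decide) (by decide)
  have a8 := h 0 3 1 4 (by decide) (by decide) (by decide) (by decide) (by decide) (by decide)
  have a9 := h 0 3 2 4 (by decide) (by decide) (by decide) (by decide) (by decide) (by decide)
  have b1 := h 0 4 1 2 (by decide) (by decide) (by decide) (by decide) (by decide) (by decide)
  have b2 := h 0 4 1 3 (by decide) (by decide) (by decide) (by decide) (by decide) (by decide)
  have b3 := h 0 4 2 3 (by decide) (by decide) (by decide) (by decide) (by decide) (by decide)
  have b4 := h 1 2 3 4 (by decide) (by decide) (by decide) (by decide) (by decide) (by decide)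
  have b5 := h 1 3 2 4 (by decide) (by decide) (by decide) (by decide) (by decide) (by decide)
  have b6 := h 1 4 2 3 (by decide) (by decide) (by decide) (by decide) (by decide) (by decide)
  have c1 := ho 2 1 (by decide)
  have c2 := ho 3 1 (by decide)
  have c3 := ho 3 2 (by decide)
  have c4 := ho 4 1 (by decide)
  have c5 := ho 4 2 (by decide)
  have c6 := ho 4 3 (by decide)
  have key := congrArg₂ (· + ·) (congrArg₂ (· + ·) (congrArg₂ (· + ·) (congrArg₂ (· + ·)
    (congrArg₂ (· + ·) (congrArg₂ (· + ·) (congrArg₂ (· + ·) (congrArg₂ (· + ·)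
    (congrArg₂ (· + ·) (congrArg₂ (· + ·) (congrArg₂ (· + ·) (congrArg₂ (· + ·)
    (congrArg₂ (· + ·) (congrArg₂ (· + ·) a1 a2) a3) a4) a5) a6) a7) a8) a9) b1) b2) b3) b4) b5) b6
  have d1 : o 2 1 = 1 - o 1 2 := by linear_combination c1
  have d2 : o 3 1 = 1 - o 1 3 := by linear_combination c2
  have d3 : o 3 2 = 1 - o 2 3 := by linear_combination c3
  have d4 : o 4 1 = 1 - o 1 4 := by linear_combination c4
  have d5 : o 4 2 = 1 - o 2 4 := by linear_combination c5
  have d6 : o 4 3 = 1 - o 3 4 := by linear_combination c6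
  simp only [d1, d2, d3, d4, d5, d6] at key
  ring_nf at key
  reduce_mod_char at key
  revert key
  decide

variable [Fintype V] [DecidableEq V]

open Classical in
theorem planar_bound (Adj : V → V → Prop) (hs : ∀ x y, Adj x y → Adj y x)
    (hirr : ∀ x, ¬ Adj x x) (o : V → V → ZMod 2) (ho : ∀ x y, x ≠ y → o x y + o y x = 1)
    (D : V → V → V → ZMod 2)
    (heq : ∀ x y z w, Adj x y → Adj z w → x ≠ z → x ≠ w → y ≠ z → y ≠ w →
      o x z + o x w + o y z + o y w + D x y z + D x y w + D z w x + D z w y = 0) :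
    (Finset.univ.filter fun p : V × V => Adj p.1 p.2).card ≤ 8 * Fintype.card V := by
  rcases isEmpty_or_nonempty V with hV | hV
  · simp
  by_contra hcon
  push Not at hcon
  set P : Finset (Finset V) := Finset.univ.image fun x : V => ({x} : Finset V) with hP
  have hinj : Function.Injective fun x : V => ({x} : Finset V) := fun x y h => by
    simpa using h
  have hcard : P.card = Fintype.card V := by
    rw [hP, Finset.card_image_of_injective _ hinj, Finset.card_univ]
  have hE : E2 Adj P = (Finset.univ.filter fun p : V × V => Adj p.1 p.2).card := by
    unfold E2
    rw [hP, Finset.sum_image (fun x _ y _ h => hinj h), Finset.card_filter,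
      ← Finset.univ_product_univ, Finset.sum_product]
    refine Finset.sum_congr rfl fun x _ => ?_
    rw [Finset.sum_image (fun x _ y _ h => hinj h)]
    refine Finset.sum_congr rfl fun y _ => ?_
    have : BAdj Adj {x} {y} ↔ Adj x y := by
      unfold BAdj
      simp only [Finset.mem_singleton, exists_eq_left, ne_eq, Finset.singleton_inj]
      constructor
      · exact fun h => h.2
      · intro h
        refine ⟨?_, h⟩
        rintro rfl
        exact hirr _ h
    simp only [this]
  have hsys : IsSys Adj P := by
    constructor
    · intro X hX
      obtain ⟨x, -, rfl⟩ := Finset.mem_image.1 hX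
      refine ⟨⟨x, by simp⟩, ?_⟩
      intro y hy z hz
      rw [Finset.mem_singleton] at hy hz
      subst hy; subst hz
      exact Linked.refl _ _
    · intro X hX Y hY hne
      obtain ⟨x, -, rfl⟩ := Finset.mem_image.1 hX
      obtain ⟨y, -, rfl⟩ := Finset.mem_image.1 hY
      rw [Finset.disjoint_singleton]
      rintro rfl
      exact hne rfl
  obtain ⟨B, hB1, hB2⟩ := minor_five hs P hsys
    ⟨{hV.some}, by rw [hP]; exact Finset.mem_image_of_mem _ (Finset.mem_univ _)⟩
    (by rw [hcard, hE]; exact hcon.le)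
  choose b hb using fun i => (hB1 i).1.1
  have hL : ∀ i j : Fin 5, ∃ l : List (V × V), i < j →
      (∀ d ∈ l, Adj d.1 d.2 ∧ d.1 ∈ B i ∪ B j ∧ d.2 ∈ B i ∪ B j) ∧
      ∀ g : V → ZMod 2, (l.map fun d => g d.1 + g d.2).sum = g (b i) + g (b j) := by
    intro i j
    by_cases hij : i < j
    · have := (merge_block hs (hB1 i).1 (hB1 j).1 (hB2 i j hij.ne).2).2 (b i)
        (Finset.mem_union_left _ (hb i)) (b j) (Finset.mem_union_right _ (hb j))
      obtain ⟨l, hl⟩ := this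
      exact ⟨l, fun _ => hl⟩
    · exact ⟨[], fun h => absurd h hij⟩
  choose L hL using hL
  have hbne : ∀ i j, i ≠ j → b i ≠ b j := by
    intro i j hij h
    exact Finset.disjoint_left.1 (hB2 i j hij).1 (hb i) (h ▸ hb j)
  refine five_contra (fun i j => o (b i) (b j)) (fun i j hij => ho _ _ (hbne i j hij))
    (fun i j k => ((L i j).map fun p => D p.1 p.2 (b k)).sum) ?_
  intro i j k l hij hkl hik hil hjk hjl
  have hdis : ∀ x ∈ B i ∪ B j, ∀ y ∈ B k ∪ B l, x ≠ y := by
    intro x hx y hy hxy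
    subst hxy
    rcases Finset.mem_union.1 hx with hx | hx <;> rcases Finset.mem_union.1 hy with hy | hy
    · exact Finset.disjoint_left.1 (hB2 i k hik).1 hx hy
    · exact Finset.disjoint_left.1 (hB2 i l hil).1 hx hy
    · exact Finset.disjoint_left.1 (hB2 j k hjk).1 hx hy
    · exact Finset.disjoint_left.1 (hB2 j l hjl).1 hx hy
  refine path_eq o D (L i j) (L k l) _ _ _ _ (hL i j hij).2 (hL k l hkl).2 ?_
  intro p hp q hq
  obtain ⟨p1, p2, p3⟩ := (hL i j hij).1 p hp
  obtain ⟨q1, q2, q3⟩ := (hL k l hkl).1 q hq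
  exact heq _ _ _ _ p1 q1 (hdis _ p2 _ q2) (hdis _ p2 _ q3) (hdis _ p3 _ q2) (hdis _ p3 _ q3)

/-- A large cut. -/
theorem exists_cut {ι : Type} (Φ : Finset ι) (s t : ι → V) (hst : ∀ f ∈ Φ, s f ≠ t f) :
    ∃ c : V → Bool, Φ.card ≤ 2 * (Φ.filter fun f => c (s f) ≠ c (t f)).card := by
  have hsum : ∑ c : V → Bool, ∑ f ∈ Φ, (if c (s f) ≠ c (t f) then (1 : ℤ) else -1) = 0 := by
    rw [Finset.sum_comm]
    refine Finset.sum_eq_zero fun f hf => ?_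
    refine Finset.sum_involution (fun c _ => Function.update c (s f) (!c (s f))) ?_ ?_ ?_ ?_
    · intro c _
      simp only [Function.update_self, Function.update_of_ne (hst f hf).symm]
      cases c (s f) <;> cases c (t f) <;> simp
    · intro c _ _ h
      have := congrFun h (s f)
      simp at this
    · intro c _; exact Finset.mem_univ _
    · intro c _
      simp
  obtain ⟨c, -, hc⟩ := Finset.exists_le_of_sum_le (s := Finset.univ)
    (f := fun _ : V → Bool => (0 : ℤ)) (g := fun c => ∑ f ∈ Φ, (if c (s f) ≠ c (t f) then (1 : ℤ) else -1))
    ⟨fun _ => true, Finset.mem_univ _⟩ (by simpa using hsum.ge)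
  refine ⟨c, ?_⟩
  have e : ∑ f ∈ Φ, (if c (s f) ≠ c (t f) then (1 : ℤ) else -1) =
      2 * (Φ.filter fun f => c (s f) ≠ c (t f)).card - Φ.card := by
    rw [Finset.card_filter, Finset.card_eq_sum_ones]
    push_cast
    rw [Finset.mul_sum, ← Finset.sum_sub_distrib]
    refine Finset.sum_congr rfl fun f _ => ?_
    split_ifs <;> norm_num
  rw [e] at hc
  omega

theorem cut_term {c : V → Bool} {x y : V} (h : c x ≠ c y) {rk : V → ℕ} (k : ℕ) :
    (if c x = true ∧ k < rk x then (1 : ZMod 2) else 0) +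
      (if c y = true ∧ k < rk y then 1 else 0) =
    if k < rk (if c x = true then x else y) then 1 else 0 := by
  cases hx : c x <;> cases hy : c y
  · rw [hx, hy] at h; exact absurd rfl h
  · simp
  · simp
  · rw [hx, hy] at h; exact absurd rfl h

open Classical in
theorem thrackle_bound {ι : Type} (Φ : Finset ι) (s t : ι → V) (hst : ∀ f ∈ Φ, s f ≠ t f)
    (hinj : ∀ f ∈ Φ, ∀ g ∈ Φ, s f = s g → t f = t g → f = g)
    (hinj' : ∀ f ∈ Φ, ∀ g ∈ Φ, s f = t g → t f = s g → False)
    (o : V → V → ZMod 2) (ho : ∀ x y, x ≠ y → o x y + o y x = 1) (δ : ι → V → ZMod 2)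
    (h : ∀ f ∈ Φ, ∀ g ∈ Φ, s f ≠ s g → s f ≠ t g → t f ≠ s g → t f ≠ t g →
      o (s f) (s g) + o (s f) (t g) + o (t f) (s g) + o (t f) (t g) + δ f (s g) + δ f (t g) +
        δ g (s f) + δ g (t f) = 1) : Φ.card ≤ 8 * Fintype.card V := by
  obtain ⟨c, hc⟩ := exists_cut Φ s t hst
  set Ψ := Φ.filter fun f => c (s f) ≠ c (t f) with hΨ
  have hΨΦ : Ψ ⊆ Φ := Finset.filter_subset _ _
  set rk : V → ℕ := fun x => (Fintype.equivFin V x : ℕ) with hrk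
  have hrkinj : ∀ x y, rk x = rk y → x = y := fun x y hxy =>
    (Fintype.equivFin V).injective (Fin.ext hxy)
  set a : ι → V := fun f => if c (s f) = true then s f else t f with ha
  set D' : ι → V → ZMod 2 := fun f x => δ f x + if c x = true ∧ rk (a f) < rk x then 1 else 0 with hD'
  have h0 : ∀ f ∈ Ψ, ∀ g ∈ Ψ, s f ≠ s g → s f ≠ t g → t f ≠ s g → t f ≠ t g →
      o (s f) (s g) + o (s f) (t g) + o (t f) (s g) + o (t f) (t g) + D' f (s g) + D' f (t g) +
        D' g (s f) + D' g (t f) = 0 := by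
    intro f hf g hg h1 h2 h3 h4
    have hh := h f (hΨΦ hf) g (hΨΦ hg) h1 h2 h3 h4
    have hcf := (Finset.mem_filter.1 hf).2
    have hcg := (Finset.mem_filter.1 hg).2
    have i1 : (if c (s g) = true ∧ rk (a f) < rk (s g) then (1 : ZMod 2) else 0) +
        (if c (t g) = true ∧ rk (a f) < rk (t g) then 1 else 0) =
        if rk (a f) < rk (a g) then 1 else 0 := by
      exact cut_term hcg _
    have i2 : (if c (s f) = true ∧ rk (a g) < rk (s f) then (1 : ZMod 2) else 0) +
        (if c (t f) = true ∧ rk (a g) < rk (t f) then 1 else 0) =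
        if rk (a g) < rk (a f) then 1 else 0 := by
      exact cut_term hcf _
    have hne : rk (a f) ≠ rk (a g) := by
      intro h
      have := hrkinj _ _ h
      simp only [ha] at this
      split_ifs at this <;> contradiction
    have i3 : (if rk (a f) < rk (a g) then (1 : ZMod 2) else 0) +
        (if rk (a g) < rk (a f) then 1 else 0) = 1 := by
      rcases lt_or_gt_of_ne hne with h | h
      · simp [h, h.le]
      · simp [h, h.le]
    have i4 : (1 : ZMod 2) + 1 = 0 := two_mul_zmod 1
    simp only [hD']
    linear_combination hh + i1 + i2 + i3 + i4
  set Adj : V → V → Prop := fun x y => ∃ f ∈ Ψ, (s f = x ∧ t f = y) ∨ (s f = y ∧ t f = x) with hAdj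
  set D : V → V → V → ZMod 2 := fun x y z => if h : Adj x y then D' h.choose z else 0 with hD
  have hb := planar_bound Adj
    (fun x y ⟨f, hf, hxy⟩ => ⟨f, hf, hxy.symm⟩)
    (fun x ⟨f, hf, hxy⟩ => by
      rcases hxy with ⟨h1, h2⟩ | ⟨h1, h2⟩ <;> exact hst f (hΨΦ hf) (h1.trans h2.symm)) o ho D (by
      intro x y z w hxy hzw h1 h2 h3 h4
      have e1 : ∀ u, D x y u = D' hxy.choose u := fun u => by simp only [hD, hxy, dif_pos]
      have e2 : ∀ u, D z w u = D' hzw.choose u := fun u => by simp only [hD, hzw, dif_pos]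
      simp only [e1, e2]
      obtain ⟨hf, hf'⟩ := hxy.choose_spec
      obtain ⟨hg, hg'⟩ := hzw.choose_spec
      generalize hxy.choose = f at *
      generalize hzw.choose = g at *
      have := h0 f hf g hg
      rcases hf' with ⟨rfl, rfl⟩ | ⟨rfl, rfl⟩ <;> rcases hg' with ⟨rfl, rfl⟩ | ⟨rfl, rfl⟩
      · rw [← this h1 h2 h3 h4]
      · rw [← this h2 h1 h4 h3]; ring
      · rw [← this h3 h4 h1 h2]; ring
      · rw [← this h4 h3 h2 h1]; ring)
  have hcount : 2 * Ψ.card ≤ (Finset.univ.filter fun p : V × V => Adj p.1 p.2).card := by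
    have : (Ψ.image (fun f => (s f, t f)) ∪ Ψ.image (fun f => (t f, s f))).card = 2 * Ψ.card := by
      rw [Finset.card_union_of_disjoint, Finset.card_image_of_injOn, Finset.card_image_of_injOn]
      · ring
      · intro f hf g hg hfg
        simp only [Prod.mk.injEq] at hfg
        exact hinj f (hΨΦ hf) g (hΨΦ hg) hfg.2 hfg.1
      · intro f hf g hg hfg
        simp only [Prod.mk.injEq] at hfg
        exact hinj f (hΨΦ hf) g (hΨΦ hg) hfg.1 hfg.2
      · rw [Finset.disjoint_left]
        intro p hp hp'
        obtain ⟨f, hf, rfl⟩ := Finset.mem_image.1 hp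
        obtain ⟨g, hg, hfg⟩ := Finset.mem_image.1 hp'
        simp only [Prod.mk.injEq] at hfg
        exact hinj' f (hΨΦ hf) g (hΨΦ hg) hfg.1.symm hfg.2.symm
    rw [← this]
    refine Finset.card_le_card ?_
    intro p hp
    rw [Finset.mem_filter]
    refine ⟨Finset.mem_univ _, ?_⟩
    rcases Finset.mem_union.1 hp with hp | hp
    · obtain ⟨f, hf, rfl⟩ := Finset.mem_image.1 hp
      exact ⟨f, hf, Or.inl ⟨rfl, rfl⟩⟩
    · obtain ⟨f, hf, rfl⟩ := Finset.mem_image.1 hp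
      exact ⟨f, hf, Or.inr ⟨rfl, rfl⟩⟩
  refine hc.trans (hcount.trans (le_trans (le_of_eq ?_) hb))
  congr

end Parity

end LW

namespace LW

/-! ### Weighted sampling -/

/-- The sampling weight. -/
noncomputable def phi (K i : ℕ) : ℝ := 1 / ((K + 1 : ℝ) * (K.choose i : ℝ))

theorem phi_nonneg (K i : ℕ) : 0 ≤ phi K i := by unfold phi; positivity

theorem phi_rec {K i : ℕ} (h : i ≤ K) : phi (K + 1) i + phi (K + 1) (i + 1) = phi K i := by
  unfold phi
  have h0 : (0 : ℝ) < (K.choose i : ℝ) := by exact_mod_cast Nat.choose_pos h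
  have h1 : (0 : ℝ) < ((K + 1).choose i : ℝ) := by exact_mod_cast Nat.choose_pos (by omega)
  have h2 : (0 : ℝ) < ((K + 1).choose (i + 1) : ℝ) := by exact_mod_cast Nat.choose_pos (by omega)
  have e1 : ((K + 1).choose i : ℝ) * (K + 1 - i) = (K + 1) * K.choose i := by
    have := Nat.add_one_mul_choose_eq K i
    have h3 := Nat.choose_succ_right_eq (K + 1) i
    have h4 : (K + 1) * K.choose i = (K + 1).choose i * (K + 1 - i) := by rw [this, h3]
    have h5 : ((K + 1 - i : ℕ) : ℝ) = (K : ℝ) + 1 - i := by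
      rw [Nat.cast_sub (by omega)]; push_cast; ring
    rw [← h5]
    exact_mod_cast h4.symm
  have e2 : ((K + 1).choose (i + 1) : ℝ) * (i + 1) = (K + 1) * K.choose i := by
    have := Nat.add_one_mul_choose_eq K i
    exact_mod_cast this.symm
  have h3 : (0 : ℝ) < (K : ℝ) + 1 - i := by
    have : (i : ℝ) ≤ K := by exact_mod_cast h
    linarith
  have f1 : ((K + 1).choose i : ℝ) = (K + 1) * K.choose i / (K + 1 - i) := by
    rw [eq_div_iff h3.ne']; exact e1
  have f2 : ((K + 1).choose (i + 1) : ℝ) = (K + 1) * K.choose i / (i + 1) := by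
    rw [eq_div_iff (by positivity)]; exact e2
  rw [f1, f2]
  push_cast
  field_simp
  ring

theorem phi_sum {α : Type} [DecidableEq α] (Q : Finset α) :
    ∀ K j : ℕ, Q.card + j ≤ K → ∑ R ∈ Q.powerset, phi K (j + R.card) = phi (K - Q.card) j := by
  induction Q using Finset.induction_on with
  | empty => intro K j h; simp
  | insert a Q ha ih =>
    intro K j h
    rw [Finset.card_insert_of_notMem ha] at h ⊢
    rw [Finset.sum_powerset_insert ha, ← Finset.sum_add_distrib]
    obtain ⟨K, rfl⟩ : ∃ L, K = L + 1 := ⟨K - 1, by omega⟩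
    rw [show K + 1 - (Q.card + 1) = K - Q.card by omega, ← ih K j (by omega)]
    refine Finset.sum_congr rfl fun R hR => ?_
    have hR' := Finset.mem_powerset.1 hR
    rw [Finset.card_insert_of_notMem (fun h => ha (hR' h)), ← add_assoc, phi_rec]
    have := Finset.card_le_card hR'
    omega

theorem choose_three (N k : ℕ) :
    ((N + 3).choose (k + 3) : ℝ) * ((k + 3) * (k + 2)) * (k + 1) =
      (N + 3) * (N + 2) * (N + 1) * N.choose k := by
  have h1 : ((N + 3 : ℝ)) * (N + 2).choose (k + 2) = (N + 3).choose (k + 3) * (k + 3) := by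
    have := Nat.add_one_mul_choose_eq (N + 2) (k + 2); exact_mod_cast this
  have h2 : ((N + 2 : ℝ)) * (N + 1).choose (k + 1) = (N + 2).choose (k + 2) * (k + 2) := by
    have := Nat.add_one_mul_choose_eq (N + 1) (k + 1); exact_mod_cast this
  have h3 : ((N + 1 : ℝ)) * N.choose k = (N + 1).choose (k + 1) * (k + 1) := by
    have := Nat.add_one_mul_choose_eq N k; exact_mod_cast this
  calc _ = ((N + 3).choose (k + 3) * (k + 3) : ℝ) * (k + 2) * (k + 1) := by ring
    _ = (N + 3) * ((N + 2).choose (k + 2) * (k + 2)) * (k + 1) := by rw [← h1]; ring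
    _ = (N + 3) * (N + 2) * ((N + 1).choose (k + 1) * (k + 1)) := by rw [← h2]; ring
    _ = _ := by rw [← h3]; ring

theorem sample_one {α : Type} [DecidableEq α] {V D : Finset α} {u v : α} {N : ℕ}
    (hn : V.card = N + 3) (hu : u ∈ V) (hv : v ∈ V) (huv : u ≠ v) (hD : D ⊆ V)
    (hne : D.Nonempty) (huD : u ∉ D) (hvD : v ∉ D) :
    1 ≤ ∑ S ∈ V.powerset.filter (fun S => u ∈ S ∧ v ∈ S ∧ (D ∩ S).card = 1),
      phi N (S.card - 3) := by
  set Q := ((V.erase u).erase v) \ D with hQ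
  have hDe : D ⊆ (V.erase u).erase v := by
    intro x hx
    refine Finset.mem_erase.2 ⟨?_, Finset.mem_erase.2 ⟨?_, hD hx⟩⟩
    · rintro rfl; exact hvD hx
    · rintro rfl; exact huD hx
  have hcQ : Q.card + D.card = N + 1 := by
    rw [hQ, Finset.card_sdiff_add_card_eq_card hDe, Finset.card_erase_of_mem
      (Finset.mem_erase.2 ⟨huv.symm, hv⟩), Finset.card_erase_of_mem hu, hn]
    omega
  have hDpos := hne.card_pos
  have hsum : ∑ x ∈ D, ∑ R ∈ Q.powerset, phi N R.card = 1 := by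
    have := phi_sum Q N 0 (by omega)
    simp only [zero_add] at this
    rw [this, Finset.sum_const, nsmul_eq_mul]
    unfold phi
    have : ((N - Q.card : ℕ) : ℝ) + 1 = D.card := by
      have : N - Q.card + 1 = D.card := by omega
      exact_mod_cast this
    rw [this, Nat.choose_zero_right]
    have : (0 : ℝ) < D.card := by exact_mod_cast hDpos
    field_simp
    simp
  have huQ : u ∉ Q := by simp [hQ]
  have hvQ : v ∉ Q := by simp [hQ]
  have hDQ : Disjoint D Q := Finset.disjoint_sdiff
  set F : α × Finset α → Finset α := fun p => insert u (insert v (insert p.1 p.2)) with hF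
  have hDF : ∀ p ∈ D ×ˢ Q.powerset, D ∩ F p = {p.1} := by
    intro p hp
    obtain ⟨h1, h2⟩ := Finset.mem_product.1 hp
    have h2 := Finset.mem_powerset.1 h2
    ext z
    simp only [hF, Finset.mem_inter, Finset.mem_insert, Finset.mem_singleton]
    constructor
    · rintro ⟨hz, rfl | rfl | rfl | h⟩
      · exact absurd hz huD
      · exact absurd hz hvD
      · rfl
      · exact absurd (h2 h) (Finset.disjoint_left.1 hDQ hz)
    · rintro rfl; exact ⟨h1, Or.inr (Or.inr (Or.inl rfl))⟩
  have hQF : ∀ p ∈ D ×ˢ Q.powerset, F p ∩ Q = p.2 := by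
    intro p hp
    obtain ⟨h1, h2⟩ := Finset.mem_product.1 hp
    have h2 := Finset.mem_powerset.1 h2
    ext z
    simp only [hF, Finset.mem_inter, Finset.mem_insert]
    constructor
    · rintro ⟨rfl | rfl | rfl | h, hz⟩
      · exact absurd hz huQ
      · exact absurd hz hvQ
      · exact absurd hz (Finset.disjoint_left.1 hDQ h1)
      · exact h
    · intro h; exact ⟨Or.inr (Or.inr (Or.inr h)), h2 h⟩
  have hinj : Set.InjOn F (D ×ˢ Q.powerset : Finset _) := by
    intro p hp q hq hpq
    have e1 : ({p.1} : Finset α) = {q.1} := by rw [← hDF p hp, ← hDF q hq, hpq]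
    have e2 : p.2 = q.2 := by rw [← hQF p hp, ← hQF q hq, hpq]
    exact Prod.ext (by simpa using e1) e2
  have hcF : ∀ p ∈ D ×ˢ Q.powerset, (F p).card - 3 = p.2.card := by
    intro p hp
    obtain ⟨h1, h2⟩ := Finset.mem_product.1 hp
    have h2 := Finset.mem_powerset.1 h2
    have hp1 : p.1 ∉ p.2 := fun h => Finset.disjoint_left.1 hDQ h1 (h2 h)
    have hv1 : v ∉ insert p.1 p.2 := by
      rw [Finset.mem_insert]
      rintro (h | h)
      · exact hvD (h ▸ h1)
      · exact hvQ (h2 h)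
    have hu1 : u ∉ insert v (insert p.1 p.2) := by
      rw [Finset.mem_insert, Finset.mem_insert]
      rintro (h | h | h)
      · exact huv h
      · exact huD (h ▸ h1)
      · exact huQ (h2 h)
    simp only [hF]
    rw [Finset.card_insert_of_notMem hu1, Finset.card_insert_of_notMem hv1,
      Finset.card_insert_of_notMem hp1]
    omega
  rw [← hsum, ← Finset.sum_product (f := fun p : α × Finset α => phi N p.2.card)]
  rw [← Finset.sum_congr rfl (fun p hp => by rw [hcF p hp] :
    ∀ p ∈ D ×ˢ Q.powerset, phi N ((F p).card - 3) = phi N p.2.card)]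
  rw [← Finset.sum_image (f := fun S : Finset α => phi N (S.card - 3)) hinj]
  refine Finset.sum_le_sum_of_subset_of_nonneg ?_ (fun _ _ _ => phi_nonneg _ _)
  intro S hS
  obtain ⟨p, hp, rfl⟩ := Finset.mem_image.1 hS
  rw [Finset.mem_filter, Finset.mem_powerset, hDF p hp]
  obtain ⟨h1, h2⟩ := Finset.mem_product.1 hp
  have h2 := Finset.mem_powerset.1 h2
  refine ⟨?_, Finset.mem_insert_self _ _, Finset.mem_insert_of_mem (Finset.mem_insert_self _ _),
    Finset.card_singleton _⟩
  intro z hz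
  simp only [hF, Finset.mem_insert] at hz
  rcases hz with rfl | rfl | rfl | hz
  · exact hu
  · exact hv
  · exact hD h1
  · have := h2 hz
    rw [hQ, Finset.mem_sdiff, Finset.mem_erase, Finset.mem_erase] at this
    exact this.1.2.2

theorem sampling_bound {α ι : Type} [DecidableEq α] (V : Finset α) (Λ : Finset ι) (s t : ι → α)
    (D : ι → Finset α) (hsV : ∀ f ∈ Λ, s f ∈ V) (htV : ∀ f ∈ Λ, t f ∈ V)
    (hst : ∀ f ∈ Λ, s f ≠ t f) (hDV : ∀ f ∈ Λ, D f ⊆ V) (hne : ∀ f ∈ Λ, (D f).Nonempty)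
    (hsD : ∀ f ∈ Λ, s f ∉ D f) (htD : ∀ f ∈ Λ, t f ∉ D f)
    (hS : ∀ S ⊆ V, (Λ.filter fun f => s f ∈ S ∧ t f ∈ S ∧ (D f ∩ S).card = 1).card ≤
      8 * (S.card * (S.card - 1))) :
    (Λ.card : ℝ) ≤ 8 * V.card * (V.card - 1) * (harmonic (V.card - 2) : ℝ) := by
  have hcard3 : ∀ f ∈ Λ, ∀ S : Finset α, s f ∈ S → t f ∈ S → (D f ∩ S).Nonempty → 3 ≤ S.card := by
    intro f hf S h1 h2 h3
    obtain ⟨x, hx⟩ := h3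
    obtain ⟨hx1, hx2⟩ := Finset.mem_inter.1 hx
    have : ({s f, t f, x} : Finset α) ⊆ S := by
      intro z hz
      simp only [Finset.mem_insert, Finset.mem_singleton] at hz
      rcases hz with rfl | rfl | rfl <;> assumption
    rw [← Finset.card_eq_three.2 ⟨s f, t f, x, hst f hf, fun h => hsD f hf (h ▸ hx1),
      fun h => htD f hf (h ▸ hx1), rfl⟩]
    exact Finset.card_le_card this
  rcases Λ.eq_empty_or_nonempty with rfl | ⟨f₀, hf₀⟩
  · have h0 : (0 : ℝ) ≤ (harmonic (V.card - 2) : ℝ) := by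
      have : 0 ≤ harmonic (V.card - 2) := by unfold harmonic; positivity
      exact_mod_cast this
    rcases Nat.eq_zero_or_pos V.card with h | h
    · simp [h]
    · have : (1 : ℝ) ≤ V.card := by exact_mod_cast h
      have h2 : (0 : ℝ) ≤ V.card - 1 := by linarith
      simp only [Finset.card_empty, Nat.cast_zero]
      positivity
  have h3 : 3 ≤ V.card := by
    refine hcard3 f₀ hf₀ V (hsV _ hf₀) (htV _ hf₀) ?_
    rw [Finset.inter_eq_left.2 (hDV _ hf₀)]
    exact hne _ hf₀
  obtain ⟨N, hN⟩ : ∃ N, V.card = N + 3 := ⟨V.card - 3, by omega⟩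
  set W : ℕ → ℝ := fun m => if 3 ≤ m then phi N (m - 3) * (8 * (m * (m - 1))) else 0 with hW
  have step1 : (Λ.card : ℝ) ≤ ∑ f ∈ Λ, ∑ S ∈ V.powerset,
      if s f ∈ S ∧ t f ∈ S ∧ (D f ∩ S).card = 1 then phi N (S.card - 3) else 0 := by
    rw [Finset.card_eq_sum_ones]
    push_cast
    refine Finset.sum_le_sum fun f hf => ?_
    rw [← Finset.sum_filter]
    exact sample_one hN (hsV f hf) (htV f hf) (hst f hf) (hDV f hf) (hne f hf) (hsD f hf) (htD f hf)
  have step2 : ∑ f ∈ Λ, ∑ S ∈ V.powerset,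
      (if s f ∈ S ∧ t f ∈ S ∧ (D f ∩ S).card = 1 then phi N (S.card - 3) else 0) ≤
      ∑ S ∈ V.powerset, W S.card := by
    rw [Finset.sum_comm]
    refine Finset.sum_le_sum fun S hSV => ?_
    rw [← Finset.sum_filter, Finset.sum_const, nsmul_eq_mul]
    have hb := hS S (Finset.mem_powerset.1 hSV)
    simp only [hW]
    split_ifs with h
    · have hb' : ((Λ.filter fun f => s f ∈ S ∧ t f ∈ S ∧ (D f ∩ S).card = 1).card : ℝ) ≤
          8 * (S.card * (S.card - 1)) := by
        have e : ((S.card - 1 : ℕ) : ℝ) = (S.card : ℝ) - 1 := by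
          rw [Nat.cast_sub (by omega)]; simp
        rw [← e]
        exact_mod_cast hb
      rw [mul_comm (phi _ _)]
      exact mul_le_mul_of_nonneg_right hb' (phi_nonneg _ _)
    · have : Λ.filter (fun f => s f ∈ S ∧ t f ∈ S ∧ (D f ∩ S).card = 1) = ∅ := by
        rw [Finset.filter_eq_empty_iff]
        rintro f hf ⟨h1, h2, h4⟩
        exact h (hcard3 f hf S h1 h2 (Finset.card_pos.1 (by omega)))
      rw [this]; simp
  have step3 : ∑ S ∈ V.powerset, W S.card = 8 * V.card * (V.card - 1) * (harmonic (V.card - 2) : ℝ) := by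
    rw [Finset.sum_powerset_apply_card, hN, show N + 3 + 1 = (N + 1) + 1 + 1 + 1 by ring,
      Finset.sum_range_succ', Finset.sum_range_succ', Finset.sum_range_succ']
    have w0 : W 0 = 0 := by simp [hW]
    have w1 : W (0 + 1) = 0 := by simp [hW]
    have w2 : W (0 + 1 + 1) = 0 := by simp [hW]
    rw [w0, w1, w2, show N + 3 - 2 = N + 1 by omega]
    unfold harmonic
    push_cast
    rw [Finset.mul_sum]
    simp only [smul_zero, add_zero]
    refine Finset.sum_congr rfl fun k hk => ?_
    have hk' : k ≤ N := by have := Finset.mem_range.1 hk; omega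
    have hc := choose_three N k
    have hpos : (0 : ℝ) < (N.choose k : ℝ) := by exact_mod_cast Nat.choose_pos hk'
    simp only [hW, show 3 ≤ k + 1 + 1 + 1 by omega, if_true, show k + 1 + 1 + 1 - 3 = k by omega,
      nsmul_eq_mul, phi]
    rw [show k + 1 + 1 + 1 = k + 3 by ring]
    push_cast
    have h1 : (0 : ℝ) < N + 1 := by positivity
    have h2 : (0 : ℝ) < k + 1 := by positivity
    field_simp
    linear_combination hc
  linarith [step1, step2, step3.le]

theorem final_arith (n : ℕ) (hn : 2 ≤ n) (e : ℝ)
    (he : e ≤ n * (n - 1) / 2 + 8 * n * (n - 1) * (harmonic (n - 2) : ℝ)) :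
    e ≤ 64 * (n : ℝ) ^ 2 * Real.logb 2 n := by
  have hn' : (2 : ℝ) ≤ n := by exact_mod_cast hn
  have h1 : 1 ≤ Real.logb 2 n := by
    rw [Real.le_logb_iff_rpow_le (by norm_num) (by linarith)]
    simpa using hn'
  have h2 : (harmonic (n - 2) : ℝ) ≤ 1 + Real.logb 2 n := by
    have hm : (harmonic (n - 2) : ℝ) ≤ (harmonic n : ℝ) := by
      have : harmonic (n - 2) ≤ harmonic n := by
        unfold harmonic
        refine Finset.sum_le_sum_of_subset_of_nonneg ?_ ?_
        · exact Finset.range_mono (by omega)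
        · intro i _ _; positivity
      exact_mod_cast this
    have hl := harmonic_le_one_add_log n
    have hlog : Real.log n ≤ Real.logb 2 n := by
      unfold Real.logb
      rw [le_div_iff₀ (Real.log_pos (by norm_num))]
      have a1 : 0 ≤ Real.log n := Real.log_nonneg (by linarith)
      have a2 : Real.log 2 ≤ 1 := by
        have := Real.log_two_lt_d9; linarith
      nlinarith
    linarith
  set L := Real.logb 2 (n : ℝ)
  have h3 : (0 : ℝ) ≤ n * (n - 1) := by nlinarith
  have h4 : (n : ℝ) * (n - 1) ≤ n ^ 2 := by nlinarith
  have h5 : 8 * (n : ℝ) * (n - 1) * (harmonic (n - 2) : ℝ) ≤ 8 * (n * (n - 1)) * (1 + L) := by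
    have := mul_le_mul_of_nonneg_left h2 (by positivity : (0 : ℝ) ≤ 8 * (n * (n - 1)))
    linarith
  nlinarith [mul_le_mul_of_nonneg_right h4 (by linarith : (0 : ℝ) ≤ L), sq_nonneg (n : ℝ),
    mul_le_mul_of_nonneg_left h1 (sq_nonneg (n : ℝ)), mul_le_mul_of_nonneg_left h1 h3]

end LW

namespace LW

/-! ### From drawings to the edge bound -/

/-- Systems of arcs satisfying the hypotheses of the theorem. -/
structure Drawing (ι : Type) (γ : ι → ℝ → ℂ) (V : Finset ℂ) : Prop where
  cont : ∀ i, Continuous (γ i)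
  inj : ∀ i, InjOn (γ i) (Icc 0 1)
  src : ∀ i, γ i 0 ∈ V
  tgt : ∀ i, γ i 1 ∈ V
  avoid : ∀ i, ∀ x ∈ V, x ∈ img (γ i) → x = γ i 0 ∨ x = γ i 1
  sub : ∀ i j, γ i 0 ≠ γ j 0 → γ i 0 ≠ γ j 1 → γ i 1 ≠ γ j 0 → γ i 1 ≠ γ j 1 →
    (img (γ i) ∩ img (γ j)).Subsingleton
  par : ∀ i j, i ≠ j → γ i 0 = γ j 0 → γ i 1 = γ j 1 → img (γ i) ∩ img (γ j) ⊆ {γ i 0, γ i 1}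
  orient : ∀ i j, γ i 0 = γ j 1 → γ i 1 = γ j 0 → False
  lens : ∀ i, ∀ z ∉ ⋃ j : {j // γ j 0 = γ i 0 ∧ γ j 1 = γ i 1}, img (γ j),
    Bornology.IsBounded (connectedComponentIn
      (⋃ j : {j // γ j 0 = γ i 0 ∧ γ j 1 = γ i 1}, img (γ j))ᶜ z) →
    ∃ x ∈ V, x ∈ connectedComponentIn
      (⋃ j : {j // γ j 0 = γ i 0 ∧ γ j 1 = γ i 1}, img (γ j))ᶜ z

section

variable {ι : Type} {γ : ι → ℝ → ℂ} {V : Finset ℂ}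

theorem Drawing.ends_ne (h : Drawing ι γ V) (i : ι) : γ i 0 ≠ γ i 1 := by
  intro h0
  have := h.inj i z_mem o_mem h0
  norm_num at this

/-- The pair of consecutive edges `f`, `pred f` with the vertices in between. -/
structure Strip (γ : ι → ℝ → ℂ) (V : Finset ℂ) (pred : ι → ι) (D : ι → Finset ℂ) (f : ι) :
    Prop where
  zero : γ (pred f) 0 = γ f 0
  one : γ (pred f) 1 = γ f 1
  ne : (D f).Nonempty
  mem : ∀ x, x ∈ D f ↔ x ∈ V ∧ x ≠ γ f 0 ∧ x ≠ γ f 1 ∧ Odd (wd (γ f) (γ (pred f)) x)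

open Classical in
theorem Drawing.class_decomp [Finite ι] (h : Drawing ι γ V) (p : ℂ × ℂ) :
    ∃ (A : Finset ι) (pred : ι → ι) (D : ι → Finset ℂ), A.card ≤ 1 ∧
      (∀ f, γ f 0 = p.1 → γ f 1 = p.2 → f ∉ A → Strip γ V pred D f) ∧
      ∀ f g, γ f 0 = p.1 → γ f 1 = p.2 → γ g 0 = p.1 → γ g 1 = p.2 → f ∉ A → g ∉ A → f ≠ g →
        Disjoint (D f) (D g) := by
  by_cases hne : ∃ i, γ i 0 = p.1 ∧ γ i 1 = p.2
  swap
  · refine ⟨∅, id, fun _ => ∅, by simp, fun f h0 h1 => absurd ⟨f, h0, h1⟩ hne, ?_⟩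
    intro f g h0 h1; exact absurd ⟨f, h0, h1⟩ hne
  obtain ⟨i, hi0, hi1⟩ := hne
  rw [← hi0, ← hi1]
  set I := {j // γ j 0 = γ i 0 ∧ γ j 1 = γ i 1} with hI
  have hFam : Fam I (fun j => γ j.1) (γ i 0) (γ i 1) := by
    refine ⟨fun j => h.cont _, fun j => h.inj _, fun j => j.2.1, fun j => j.2.2, ?_⟩
    intro j k hjk
    have := h.par j.1 k.1 (fun h => hjk (Subtype.ext h)) (j.2.1.trans k.2.1.symm)
      (j.2.2.trans k.2.2.symm)
    rw [j.2.1, j.2.2] at this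
    exact this
  have : Nonempty I := ⟨⟨i, rfl, rfl⟩⟩
  obtain ⟨a, pred, D, h1, h2⟩ := hFam.decomp (V := V) (by
    intro j x hx hxj
    have := h.avoid j.1 x hx hxj
    rw [j.2.1, j.2.2] at this
    exact this) (h.lens i)
  refine ⟨{a.1}, fun f => if hf : γ f 0 = γ i 0 ∧ γ f 1 = γ i 1 then (pred ⟨f, hf⟩).1 else f,
    fun f => if hf : γ f 0 = γ i 0 ∧ γ f 1 = γ i 1 then D ⟨f, hf⟩ else ∅, by simp, ?_, ?_⟩
  · intro f hf0 hf1 hfa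
    have hf : γ f 0 = γ i 0 ∧ γ f 1 = γ i 1 := ⟨hf0, hf1⟩
    have hfa' : (⟨f, hf⟩ : I) ≠ a := fun h => hfa (by rw [← h]; simp)
    obtain ⟨k1, k2⟩ := h1 ⟨f, hf⟩ hfa'
    refine ⟨?_, ?_, ?_, ?_⟩
    · simp only [hf, and_self, dif_pos]
      exact (pred _).2.1
    · simp only [hf, and_self, dif_pos]
      exact (pred _).2.2
    · rw [dif_pos hf]
      exact k1
    · intro x
      rw [dif_pos hf, dif_pos hf, hf0, hf1]
      exact k2 x
  · intro f g hf0 hf1 hg0 hg1 hfa hga hfg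
    have hf : γ f 0 = γ i 0 ∧ γ f 1 = γ i 1 := ⟨hf0, hf1⟩
    have hg : γ g 0 = γ i 0 ∧ γ g 1 = γ i 1 := ⟨hg0, hg1⟩
    have hfa' : (⟨f, hf⟩ : I) ≠ a := fun h => hfa (by rw [← h]; simp)
    have hga' : (⟨g, hg⟩ : I) ≠ a := fun h => hga (by rw [← h]; simp)
    simp only [dif_pos hf, dif_pos hg]
    exact h2 _ _ hfa' hga' (fun h => hfg (congrArg Subtype.val h))

theorem Drawing.odd_pair (h : Drawing ι γ V) {pred : ι → ι} {D : ι → Finset ℂ} {f g : ι}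
    {S : Finset ℂ} {w : ℂ} (hS : S ⊆ V) (hf : Strip γ V pred D f) (hg : Strip γ V pred D g)
    (f0 : γ f 0 ∈ S) (f1 : γ f 1 ∈ S) (g0 : γ g 0 ∈ S) (g1 : γ g 1 ∈ S)
    (hfw : D f ∩ S = {w}) (hgw : D g ∩ S = {w})
    (h00 : γ f 0 ≠ γ g 0) (h01 : γ f 0 ≠ γ g 1) (h10 : γ f 1 ≠ γ g 0) (h11 : γ f 1 ≠ γ g 1) :
    Odd (crZ (γ f) (γ g)) := by
  have hwf : w ∈ D f ∩ S := by rw [hfw]; simp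
  have hwg : w ∈ D g ∩ S := by rw [hgw]; simp
  obtain ⟨hwV, wf0, wf1, wfo⟩ := (hf.mem w).1 (Finset.mem_inter.1 hwf).1
  obtain ⟨-, wg0, wg1, wgo⟩ := (hg.mem w).1 (Finset.mem_inter.1 hwg).1
  have off : ∀ i x, x ∈ V → x ≠ γ i 0 → x ≠ γ i 1 → x ∉ img (γ i) := by
    intro i x hx h0 h1 hxi
    rcases h.avoid i x hx hxi with h' | h'
    · exact h0 h'
    · exact h1 h'
  have ev : ∀ e, Strip γ V pred D e → D e ∩ S = {w} → ∀ x ∈ S, x ≠ γ e 0 → x ≠ γ e 1 → x ≠ w →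
      Even (wd (γ e) (γ (pred e)) x) := by
    intro e he hew x hx h0 h1 hxw
    by_contra hodd
    rw [Int.not_even_iff_odd] at hodd
    have : x ∈ D e ∩ S := Finset.mem_inter.2 ⟨(he.mem x).2 ⟨hS hx, h0, h1, hodd⟩, hx⟩
    rw [hew, Finset.mem_singleton] at this
    exact hxw this
  have pf0 := hf.zero
  have pf1 := hf.one
  have pg0 := hg.zero
  have pg1 := hg.one
  refine odd_crossing (w := w) (e' := γ (pred f)) (f' := γ (pred g)) (h.cont _) (h.cont _)
    (h.cont _) (h.cont _) (h.inj _) (h.inj _) (h.inj _) (h.inj _) pf0.symm pf1.symm pg0.symm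
    pg1.symm ?_ ?_ ?_ ?_ ?_ ?_ ?_ ?_ ?_ ?_ ?_ ?_ ?_ ?_ ?_ ?_ ?_ ?_ ?_ ?_ wfo wgo
  · exact off _ _ (h.src _) h00.symm h10.symm
  · exact off _ _ (h.tgt _) h01.symm h11.symm
  · exact off _ _ (h.src _) (pf0 ▸ h00.symm) (pf1 ▸ h10.symm)
  · exact off _ _ (h.tgt _) (pf0 ▸ h01.symm) (pf1 ▸ h11.symm)
  · exact off _ _ (h.src _) h00 h01
  · exact off _ _ (h.tgt _) h10 h11
  · exact off _ _ (h.src _) (pg0 ▸ h00) (pg1 ▸ h01)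
  · exact off _ _ (h.tgt _) (pg0 ▸ h10) (pg1 ▸ h11)
  · exact h.sub _ _ h00 h01 h10 h11
  · apply h.sub <;> simp only [pf0, pf1, pg0, pg1] <;> assumption
  · apply h.sub <;> simp only [pf0, pf1, pg0, pg1] <;> assumption
  · apply h.sub <;> simp only [pf0, pf1, pg0, pg1] <;> assumption
  · exact ev f hf hfw _ g0 h00.symm h10.symm wg0.symm
  · exact ev f hf hfw _ g1 h01.symm h11.symm wg1.symm
  · exact ev g hg hgw _ f0 h00 h01 wf0.symm
  · exact ev g hg hgw _ f1 h10 h11 wf1.symm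
  · exact off _ _ hwV wf0 wf1
  · exact off _ _ hwV (pf0 ▸ wf0) (pf1 ▸ wf1)
  · exact off _ _ hwV wg0 wg1
  · exact off _ _ hwV (pg0 ▸ wg0) (pg1 ▸ wg1)

theorem Drawing.local_bound [DecidableEq ι] (h : Drawing ι γ V) {pred : ι → ι} {D : ι → Finset ℂ} {Λ : Finset ι}
    (hΛ : ∀ f ∈ Λ, Strip γ V pred D f)
    (hdisj : ∀ f ∈ Λ, ∀ g ∈ Λ, f ≠ g → γ f 0 = γ g 0 → γ f 1 = γ g 1 → Disjoint (D f) (D g))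
    {S : Finset ℂ} (hS : S ⊆ V) {w : ℂ} (hw : w ∈ S) :
    (Λ.filter fun f => γ f 0 ∈ S ∧ γ f 1 ∈ S ∧ D f ∩ S = {w}).card ≤ 8 * (S.card - 1) := by
  set Φ := Λ.filter fun f => γ f 0 ∈ S ∧ γ f 1 ∈ S ∧ D f ∩ S = {w} with hΦ
  have hm : ∀ f ∈ Φ, Strip γ V pred D f ∧ γ f 0 ∈ S.erase w ∧ γ f 1 ∈ S.erase w ∧
      γ f 0 ∈ S ∧ γ f 1 ∈ S ∧ D f ∩ S = {w} ∧ w ∈ D f := by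
    intro f hf
    obtain ⟨h1, h2, h3, h4⟩ := Finset.mem_filter.1 hf
    have hwf : w ∈ D f ∩ S := by rw [h4]; simp
    have hwD := (Finset.mem_inter.1 hwf).1
    obtain ⟨-, w0, w1, -⟩ := ((hΛ f h1).mem w).1 hwD
    exact ⟨hΛ f h1, Finset.mem_erase.2 ⟨w0.symm, h2⟩, Finset.mem_erase.2 ⟨w1.symm, h3⟩, h2, h3, h4, hwD⟩
  have key := thrackle_bound (V := {x // x ∈ S.erase w}) (ι := {f // f ∈ Φ}) Finset.univ
    (fun f => ⟨γ f.1 0, (hm f.1 f.2).2.1⟩) (fun f => ⟨γ f.1 1, (hm f.1 f.2).2.2.1⟩)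
    (fun f _ h' => h.ends_ne f.1 (congrArg Subtype.val h'))
    (fun f _ g _ h0 h1 => by
      by_contra hfg
      have hd := hdisj f.1 (Finset.mem_filter.1 f.2).1 g.1 (Finset.mem_filter.1 g.2).1
        (fun h => hfg (Subtype.ext h)) (congrArg Subtype.val h0) (congrArg Subtype.val h1)
      exact Finset.disjoint_left.1 hd (hm f.1 f.2).2.2.2.2.2.2 (hm g.1 g.2).2.2.2.2.2.2)
    (fun f _ g _ h0 h1 => h.orient f.1 g.1 (congrArg Subtype.val h0) (congrArg Subtype.val h1))
    (fun x y => (ord x.1 y.1 : ZMod 2))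
    (fun x y hxy => by
      have := (ang_ord (fun h => hxy (Subtype.ext h) : x.1 ≠ y.1)).2
      have h2 := congrArg (fun n : ℤ => (n : ZMod 2)) this
      push_cast at h2
      exact h2)
    (fun f x => (kz (γ f.1) x.1 : ZMod 2))
    (fun f _ g _ h00 h01 h10 h11 => by
      have hodd := h.odd_pair hS (hm f.1 f.2).1 (hm g.1 g.2).1 (hm f.1 f.2).2.2.2.1
        (hm f.1 f.2).2.2.2.2.1 (hm g.1 g.2).2.2.2.1 (hm g.1 g.2).2.2.2.2.1
        (hm f.1 f.2).2.2.2.2.2.1 (hm g.1 g.2).2.2.2.2.2.1 (fun h => h00 (Subtype.ext h))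
        (fun h => h01 (Subtype.ext h)) (fun h => h10 (Subtype.ext h)) (fun h => h11 (Subtype.ext h))
      have := ZMod.intCast_eq_one_iff_odd.2 hodd
      unfold crZ at this
      push_cast at this
      simp only [CharTwo.sub_eq_add] at this
      rw [← this]
      ring)
  rw [Finset.card_univ, Fintype.card_coe, Fintype.card_coe, Finset.card_erase_of_mem hw] at key
  exact key

theorem Drawing.subset_bound [DecidableEq ι] (h : Drawing ι γ V) {pred : ι → ι} {D : ι → Finset ℂ} {Λ : Finset ι}
    (hΛ : ∀ f ∈ Λ, Strip γ V pred D f)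
    (hdisj : ∀ f ∈ Λ, ∀ g ∈ Λ, f ≠ g → γ f 0 = γ g 0 → γ f 1 = γ g 1 → Disjoint (D f) (D g))
    {S : Finset ℂ} (hS : S ⊆ V) :
    (Λ.filter fun f => γ f 0 ∈ S ∧ γ f 1 ∈ S ∧ (D f ∩ S).card = 1).card ≤
      8 * (S.card * (S.card - 1)) := by
  have hsub : (Λ.filter fun f => γ f 0 ∈ S ∧ γ f 1 ∈ S ∧ (D f ∩ S).card = 1) ⊆
      S.biUnion fun w => Λ.filter fun f => γ f 0 ∈ S ∧ γ f 1 ∈ S ∧ D f ∩ S = {w} := by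
    intro f hf
    obtain ⟨h1, h2, h3, h4⟩ := Finset.mem_filter.1 hf
    obtain ⟨w, hw⟩ := Finset.card_eq_one.1 h4
    have hwf : w ∈ D f ∩ S := by rw [hw]; simp
    exact Finset.mem_biUnion.2 ⟨w, (Finset.mem_inter.1 hwf).2, Finset.mem_filter.2 ⟨h1, h2, h3, hw⟩⟩
  refine (Finset.card_le_card hsub).trans (Finset.card_biUnion_le.trans ?_)
  refine (Finset.sum_le_card_nsmul _ _ _ fun w hw => h.local_bound hΛ hdisj hS hw).trans ?_
  rw [smul_eq_mul]
  exact le_of_eq (by ring)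

open Classical in
theorem Drawing.edge_bound [Fintype ι] (h : Drawing ι γ V) (hn : 2 ≤ V.card) :
    (Fintype.card ι : ℝ) ≤ 64 * (V.card : ℝ) ^ 2 * Real.logb 2 V.card := by
  choose A pred D hA hst hdj using h.class_decomp
  set P : ι → ℂ × ℂ := fun f => (γ f 0, γ f 1) with hP
  set Λ := Finset.univ.filter fun f : ι => f ∉ A (P f) with hΛ
  set M := Finset.univ.filter fun f : ι => f ∈ A (P f) with hM
  have hcard : Fintype.card ι = M.card + Λ.card := by
    rw [hΛ, hM, Finset.card_filter_add_card_filter_not, Finset.card_univ]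
  have hMinj : ∀ f ∈ M, ∀ g ∈ M, P f = P g → f = g := by
    intro f hf g hg hfg
    have h1 := (Finset.mem_filter.1 hf).2
    have h2 := (Finset.mem_filter.1 hg).2
    rw [hfg] at h1
    exact Finset.card_le_one.1 (hA (P g)) f h1 g h2
  have hMc : 2 * M.card ≤ V.card * V.card - V.card := by
    rw [← Finset.offDiag_card]
    have : (M.image P ∪ M.image (fun f => (P f).swap)).card = 2 * M.card := by
      rw [Finset.card_union_of_disjoint, Finset.card_image_of_injOn, Finset.card_image_of_injOn]
      · ring
      · intro f hf g hg hfg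
        exact hMinj f hf g hg (Prod.swap_injective hfg)
      · intro f hf g hg hfg
        exact hMinj f hf g hg hfg
      · rw [Finset.disjoint_left]
        intro p hp hp'
        obtain ⟨f, hf, rfl⟩ := Finset.mem_image.1 hp
        obtain ⟨g, hg, hfg⟩ := Finset.mem_image.1 hp'
        simp only [hP, Prod.swap_prod_mk, Prod.mk.injEq] at hfg
        exact h.orient f g hfg.1.symm hfg.2.symm
    rw [← this]
    refine Finset.card_le_card ?_
    intro p hp
    rw [Finset.mem_offDiag]
    rcases Finset.mem_union.1 hp with hp | hp
    · obtain ⟨f, hf, rfl⟩ := Finset.mem_image.1 hp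
      exact ⟨h.src f, h.tgt f, h.ends_ne f⟩
    · obtain ⟨f, hf, rfl⟩ := Finset.mem_image.1 hp
      exact ⟨h.tgt f, h.src f, (h.ends_ne f).symm⟩
  have hstrip : ∀ f ∈ Λ, Strip γ V (fun f => pred (P f) f) (fun f => D (P f) f) f := by
    intro f hf
    have := hst (P f) f rfl rfl (Finset.mem_filter.1 hf).2
    exact ⟨this.zero, this.one, this.ne, this.mem⟩
  have hdisj : ∀ f ∈ Λ, ∀ g ∈ Λ, f ≠ g → γ f 0 = γ g 0 → γ f 1 = γ g 1 →
      Disjoint (D (P f) f) (D (P g) g) := by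
    intro f hf g hg hfg h0 h1
    have hPP : P f = P g := Prod.ext h0 h1
    have hf2 := (Finset.mem_filter.1 hf).2
    have hg2 := (Finset.mem_filter.1 hg).2
    rw [hPP] at hf2 ⊢
    exact hdj (P g) f g h0 h1 rfl rfl hf2 hg2 hfg
  have hbound := sampling_bound V Λ (fun f => γ f 0) (fun f => γ f 1) (fun f => D (P f) f)
    (fun f _ => h.src f) (fun f _ => h.tgt f) (fun f _ => h.ends_ne f)
    (fun f hf x hx => (((hstrip f hf).mem x).1 hx).1) (fun f hf => (hstrip f hf).ne)
    (fun f hf hx => (((hstrip f hf).mem _).1 hx).2.1 rfl)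
    (fun f hf hx => (((hstrip f hf).mem _).1 hx).2.2.1 rfl)
    (fun S hS => h.subset_bound hstrip hdisj hS)
  refine final_arith V.card hn _ ?_
  have hM' : (2 : ℝ) * M.card ≤ V.card * (V.card - 1) := by
    have h1 : 2 * M.card + V.card ≤ V.card * V.card := by
      have : V.card ≤ V.card * V.card := Nat.le_mul_self _
      omega
    have h2 : (2 : ℝ) * M.card + V.card ≤ V.card * V.card := by exact_mod_cast h1
    linarith
  rw [hcard]
  push_cast
  linarith

end

end LW

namespace LW

/-! ### Transport to the complex plane -/

/-- The plane as the complex numbers. -/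
noncomputable def toC : ℝ × ℝ ≃ₜ ℂ := Complex.equivRealProdCLM.symm.toHomeomorph

/-- Parametrization, reversed when needed. -/
noncomputable def rev (G : TopMultigraph) (e : G.ι) (t : unitInterval) : unitInterval :=
  open Classical in if toLex (G.arc e 0) < toLex (G.arc e 1) then t else unitInterval.symm t

/-- The edges as curves in the complex plane. -/
noncomputable def crv (G : TopMultigraph) (e : G.ι) (t : ℝ) : ℂ :=
  toC (G.arc e (rev G e (projIcc 0 1 zero_le_one t)))

variable (G : TopMultigraph)

theorem rev_cases (e : G.ι) : (toLex (G.arc e 0) < toLex (G.arc e 1) ∧ rev G e = id) ∨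
    (toLex (G.arc e 1) < toLex (G.arc e 0) ∧ rev G e = unitInterval.symm) := by
  by_cases h : toLex (G.arc e 0) < toLex (G.arc e 1)
  · left
    refine ⟨h, ?_⟩
    funext t
    simp [rev, h]
  · right
    constructor
    · refine lt_of_le_of_ne (not_lt.1 h) ?_
      intro h'
      exact G.ends_ne e (toLex.injective h'.symm)
    · funext t
      simp [rev, h]

theorem rev_cont (e : G.ι) : Continuous (rev G e) := by
  rcases rev_cases G e with ⟨-, h⟩ | ⟨-, h⟩ <;> rw [h]
  · exact continuous_id
  · exact unitInterval.continuous_symm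

theorem rev_bij (e : G.ι) : Function.Bijective (rev G e) := by
  rcases rev_cases G e with ⟨-, h⟩ | ⟨-, h⟩ <;> rw [h]
  · exact Function.bijective_id
  · exact unitInterval.symm_bijective

theorem crv_cont (e : G.ι) : Continuous (crv G e) :=
  toC.continuous.comp ((G.continuous_arc e).comp ((rev_cont G e).comp continuous_projIcc))

theorem crv_inj (e : G.ι) : InjOn (crv G e) (Icc 0 1) := by
  intro s hs t ht h
  have := (rev_bij G e).1 (G.injective_arc e (toC.injective h))
  rw [projIcc_of_mem _ hs, projIcc_of_mem _ ht] at this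
  exact congrArg Subtype.val this

theorem crv_img (e : G.ι) : img (crv G e) = toC '' range (G.arc e) := by
  ext z
  constructor
  · rintro ⟨t, ht, rfl⟩
    exact ⟨_, ⟨_, rfl⟩, rfl⟩
  · rintro ⟨_, ⟨t, rfl⟩, rfl⟩
    obtain ⟨s, rfl⟩ := (rev_bij G e).2 t
    refine ⟨s.1, s.2, ?_⟩
    simp only [crv]
    rw [projIcc_of_mem _ s.2]

theorem crv_ends (e : G.ι) : ({crv G e 0, crv G e 1} : Set ℂ) = toC '' G.endpoints e := by
  have h0 : projIcc (0 : ℝ) 1 zero_le_one 0 = 0 := projIcc_left _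
  have h1 : projIcc (0 : ℝ) 1 zero_le_one 1 = 1 := projIcc_right _
  unfold TopMultigraph.endpoints
  rw [image_pair]
  simp only [crv, h0, h1]
  rcases rev_cases G e with ⟨-, h⟩ | ⟨-, h⟩ <;> rw [h]
  · rfl
  · rw [unitInterval.symm_zero, unitInterval.symm_one, pair_comm]

theorem crv_lt (e : G.ι) : toLex (toC.symm (crv G e 0)) < toLex (toC.symm (crv G e 1)) := by
  have h0 : projIcc (0 : ℝ) 1 zero_le_one 0 = 0 := projIcc_left _
  have h1 : projIcc (0 : ℝ) 1 zero_le_one 1 = 1 := projIcc_right _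
  simp only [crv, h0, h1, Homeomorph.symm_apply_apply]
  rcases rev_cases G e with ⟨h', h⟩ | ⟨h', h⟩ <;> rw [h]
  · exact h'
  · rw [unitInterval.symm_zero, unitInterval.symm_one]; exact h'

theorem ends_iff (e f : G.ι) : G.endpoints e = G.endpoints f ↔
    crv G e 0 = crv G f 0 ∧ crv G e 1 = crv G f 1 := by
  rw [← toC.injective.image_injective.eq_iff, ← crv_ends, ← crv_ends, pair_eq_pair_iff]
  constructor
  · rintro (h | ⟨h1, h2⟩)
    · exact h
    · have a := crv_lt G e
      have b := crv_lt G f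
      rw [h1, h2] at a
      exact absurd a (lt_asymm b)
  · exact Or.inl

theorem mem_arc {e : G.ι} {x : ℝ × ℝ} (h : x ∈ range (G.arc e)) :
    (x ∈ G.endpoints e ∧ x ∈ G.V) ∨ (x ∈ G.arcInterior e ∧ x ∉ G.V) := by
  obtain ⟨t, rfl⟩ := h
  by_cases h0 : t = 0
  · subst h0; exact Or.inl ⟨Or.inl rfl, G.source_mem e⟩
  by_cases h1 : t = 1
  · subst h1; exact Or.inl ⟨Or.inr rfl, G.target_mem e⟩
  exact Or.inr ⟨⟨t, ⟨h0, h1⟩, rfl⟩, G.interior_avoids e t h0 h1⟩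

theorem crv_zero_mem (e : G.ι) : crv G e 0 ∈ toC '' G.endpoints e := by
  rw [← crv_ends]; exact Or.inl rfl

theorem crv_one_mem (e : G.ι) : crv G e 1 ∈ toC '' G.endpoints e := by
  rw [← crv_ends]; exact Or.inr rfl

theorem endpoints_sub (e : G.ι) {x : ℝ × ℝ} (h : x ∈ G.endpoints e) : x ∈ G.V := by
  rcases h with rfl | h
  · exact G.source_mem e
  · rw [mem_singleton_iff.1 h]; exact G.target_mem e

open Classical in
theorem toDrawing (hsc : G.SingleCrossing) (hsep : G.Separated) :
    Drawing G.ι (crv G) (G.V.image toC) := by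
  have hV : ∀ e, ∀ z ∈ toC '' G.endpoints e, z ∈ G.V.image toC := by
    rintro e _ ⟨x, hx, rfl⟩
    exact Finset.mem_image_of_mem _ (endpoints_sub G e hx)
  refine ⟨crv_cont G, crv_inj G, fun i => hV i _ (crv_zero_mem G i),
    fun i => hV i _ (crv_one_mem G i), ?_, ?_, ?_, ?_, ?_⟩
  · intro i x hx hxi
    rw [crv_img] at hxi
    obtain ⟨y, hy, rfl⟩ := hxi
    obtain ⟨y', hy', hyy⟩ := Finset.mem_image.1 hx
    have := toC.injective hyy
    subst this
    rcases mem_arc G hy with h | h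
    · have : toC y' ∈ ({crv G i 0, crv G i 1} : Set ℂ) := by
        rw [crv_ends]; exact mem_image_of_mem _ h.1
      simpa using this
    · exact absurd hy' h.2
  · intro i j h00 h01 h10 h11
    have hij : i ≠ j := fun h => h00 (by rw [h])
    have hdis : ∀ x, x ∈ G.endpoints i → x ∈ G.endpoints j → False := by
      intro x hi hj
      have hi' : toC x ∈ ({crv G i 0, crv G i 1} : Set ℂ) := by
        rw [crv_ends]; exact mem_image_of_mem _ hi
      have hj' : toC x ∈ ({crv G j 0, crv G j 1} : Set ℂ) := by
        rw [crv_ends]; exact mem_image_of_mem _ hj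
      simp only [mem_insert_iff, mem_singleton_iff] at hi' hj'
      rcases hi' with a | a <;> rcases hj' with b | b
      · exact h00 (a.symm.trans b)
      · exact h01 (a.symm.trans b)
      · exact h10 (a.symm.trans b)
      · exact h11 (a.symm.trans b)
    have key : ∀ z ∈ img (crv G i) ∩ img (crv G j),
        toC.symm z ∈ G.arcInterior i ∩ G.arcInterior j := by
      rintro z ⟨hzi, hzj⟩
      rw [crv_img] at hzi hzj
      obtain ⟨x, hx, rfl⟩ := hzi
      obtain ⟨y, hy, hxy⟩ := hzj
      have := toC.injective hxy
      subst this
      rw [Homeomorph.symm_apply_apply]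
      rcases mem_arc G hx with h1 | h1 <;> rcases mem_arc G hy with h2 | h2
      · exact absurd (hdis _ h1.1 h2.1) id
      · exact absurd h1.2 h2.2
      · exact absurd h2.2 h1.2
      · exact ⟨h1.1, h2.1⟩
    intro z hz w hw
    exact toC.symm.injective (hsc i j hij (key z hz) (key w hw))
  · intro i j hij h0 h1
    have hends := (ends_iff G i j).2 ⟨h0, h1⟩
    rw [crv_ends]
    rintro z ⟨hzi, hzj⟩
    rw [crv_img] at hzi hzj
    obtain ⟨x, hx, rfl⟩ := hzi
    obtain ⟨y, hy, hxy⟩ := hzj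
    have := toC.injective hxy
    subst this
    rcases mem_arc G hx with h1 | h1
    · exact mem_image_of_mem _ h1.1
    · rcases mem_arc G hy with h2 | h2
      · exact absurd h2.2 h1.2
      · exact absurd ⟨_, h1.1, h2.1⟩ (hsep.1 i j ⟨hij, hends⟩)
  · intro i j h1 h2
    have a := crv_lt G i
    have b := crv_lt G j
    rw [h1, h2] at a
    exact lt_asymm a b
  · intro i
    set U := ⋃ j : {j // crv G j 0 = crv G i 0 ∧ crv G j 1 = crv G i 1}, img (crv G j) with hU
    have hUeq : U = toC '' G.pairUnion (G.arc i 0) (G.arc i 1) := by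
      unfold TopMultigraph.pairUnion
      rw [hU, image_iUnion₂]
      ext z
      simp only [mem_iUnion, Subtype.exists]
      constructor
      · rintro ⟨j, hj, hz⟩
        exact ⟨j, (ends_iff G j i).2 hj, by rwa [← crv_img]⟩
      · rintro ⟨j, hj, hz⟩
        exact ⟨j, (ends_iff G j i).1 hj, by rwa [crv_img]⟩
    have hUc : Uᶜ = toC '' (G.pairUnion (G.arc i 0) (G.arc i 1))ᶜ := by
      rw [hUeq, image_compl_eq toC.bijective]
    intro z hz hbd
    obtain ⟨x, rfl⟩ := toC.surjective z
    have hx : x ∈ (G.pairUnion (G.arc i 0) (G.arc i 1))ᶜ := by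
      intro hx
      exact hz (by rw [hUeq]; exact mem_image_of_mem _ hx)
    rw [hUc, ← toC.image_connectedComponentIn hx] at hbd ⊢
    have hbd' : Bornology.IsBounded
        (connectedComponentIn (G.pairUnion (G.arc i 0) (G.arc i 1))ᶜ x) := by
      have := Complex.equivRealProdCLM.lipschitz.isBounded_image hbd
      have e : ∀ y : ℝ × ℝ, Complex.equivRealProdCLM (toC y) = y := fun y =>
        Complex.equivRealProdCLM.apply_symm_apply y
      rw [image_image] at this
      simp only [e, image_id'] at this
      exact this
    obtain ⟨v, hv, hvl⟩ := hsep.2 _ ⟨G.arc i 0, G.arc i 1, G.ends_ne i, ⟨i, rfl⟩,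
      fun e f he hf hef => hsep.1 e f ⟨hef, he.trans hf.symm⟩, hbd', x, hx, rfl⟩
    exact ⟨toC v, Finset.mem_image_of_mem _ hv, mem_image_of_mem _ hvl⟩

end LW

theorem edge_bound_separated_singleCrossing (G : TopMultigraph) (hn : 2 ≤ G.V.card)
    (hsc : G.SingleCrossing) (hsep : G.Separated) :
    (G.edgeCount : ℝ) ≤ 64 * (G.V.card : ℝ) ^ 2 * Real.logb 2 (G.V.card : ℝ) := by
  classical
  have hc : (G.V.image LW.toC).card = G.V.card :=
    Finset.card_image_of_injective _ LW.toC.injective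
  have h := (LW.toDrawing G hsc hsep).edge_bound (by convert hn)
  unfold TopMultigraph.edgeCount
  rw [Nat.card_eq_fintype_card]
  convert h using 4 <;> rw [hc]
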